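/- Riemann Hypothesis for ξ^{G₂/P_short}: if s is a complex number not lying in the exceptional set S₂ = {−2, −1, 0, 1/2, 1, 2, 3} and ξ^{G₂/P_short}(s) = 0, then Re(s) = 1/2. -/

import Mathlib

open Complex

noncomputable def xiG2Pshort (s : ℂ) : ℂ :=
  completedRiemannZeta 2 * completedRiemannZeta (s + 2) * completedRiemannZeta (2 * s) / (s - 3)
  - completedRiemannZeta 2 * completedRiemannZeta (s - 2) * completedRiemannZeta (2 * s - 1) /
      (s + 2)
  + completedRiemannZeta (s - 2) * completedRiemannZeta (2 * s - 1) / (2 * s - 2)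
  - completedRiemannZeta (s + 2) * completedRiemannZeta (2 * s) / (2 * s)
  - completedRiemannZeta (s - 1) * completedRiemannZeta (2 * s - 1) / (s * (s - 3))
  - completedRiemannZeta (s + 1) * completedRiemannZeta (2 * s) / ((s - 1) * (s + 2))
  - completedRiemannZeta s * completedRiemannZeta (2 * s) / ((2 * s - 2) * (s + 1))
  - completedRiemannZeta s * completedRiemannZeta (2 * s - 1) / ((2 * s) * (s - 2))

def S2 : Set ℂ := {-2, -1, 0, 1/2, 1, 2, 3}

namespace G2RH
open Complex MeasureTheory Set Filter Topology

/-! ### Power series of the completed zeta function at `1/2` -/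

noncomputable def om (x : ℝ) : ℝ :=
  x ^ (-(3/4) : ℝ) * ((HurwitzZeta.hurwitzEvenFEPair 0).f_modif x).re

lemma fmod_real {x : ℝ} (hx : 0 < x) :
    0 ≤ ((HurwitzZeta.hurwitzEvenFEPair 0).f_modif x).re ∧
    (HurwitzZeta.hurwitzEvenFEPair 0).f_modif x =
      (((HurwitzZeta.hurwitzEvenFEPair 0).f_modif x).re : ℂ) := by
  have hcos : ∀ y : ℝ, 0 < y → 1 ≤ HurwitzZeta.cosKernel 0 y := by
    intro y hy
    have h := HurwitzZeta.hasSum_nat_cosKernel₀ 0 hy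
    have h2 : 0 ≤ HurwitzZeta.cosKernel ((0:ℝ) : UnitAddCircle) y - 1 :=
      h.nonneg (fun n => by simp; positivity)
    simp only [QuotientAddGroup.mk_zero] at h2
    linarith
  rcases lt_trichotomy x 1 with h | h | h
  · have e : (HurwitzZeta.hurwitzEvenFEPair 0).f_modif x =
        ((HurwitzZeta.evenKernel 0 x - x ^ (-(1/2) : ℝ) : ℝ) : ℂ) := by
      simp only [WeakFEPair.f_modif, Pi.add_apply]
      rw [indicator_of_notMem (by simp; linarith), indicator_of_mem (by simp [hx, h])]
      simp [HurwitzZeta.hurwitzEvenFEPair]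
    rw [e, ofReal_re]
    refine ⟨?_, rfl⟩
    rw [HurwitzZeta.evenKernel_functional_equation, Real.rpow_neg hx.le, one_div]
    have := hcos (1/x) (by positivity)
    have h3 : 0 < (x ^ (1/2:ℝ))⁻¹ := by positivity
    have h4 := mul_le_mul_of_nonneg_left this h3.le
    simp only [one_div] at h4 ⊢
    linarith
  · subst h
    simp [WeakFEPair.f_modif]
  · have e : (HurwitzZeta.hurwitzEvenFEPair 0).f_modif x =
        ((HurwitzZeta.evenKernel 0 x - 1 : ℝ) : ℂ) := by
      simp only [WeakFEPair.f_modif, Pi.add_apply]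
      rw [indicator_of_mem (by simpa using h), indicator_of_notMem (by simp; intro; linarith)]
      simp [HurwitzZeta.hurwitzEvenFEPair]
    rw [e, ofReal_re]
    refine ⟨?_, rfl⟩
    rw [HurwitzZeta.evenKernel_eq_cosKernel_of_zero]
    linarith [hcos x hx]

lemma om_nonneg {x : ℝ} (hx : 0 < x) : 0 ≤ om x :=
  mul_nonneg (by positivity) (fmod_real hx).1

lemma mellin_integrand {x : ℝ} (hx : 0 < x) (z : ℂ) :
    (x : ℂ) ^ ((1/2 + z)/2 - 1) • (HurwitzZeta.hurwitzEvenFEPair 0).f_modif x =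
      cexp (z * ((Real.log x / 2 : ℝ) : ℂ)) * (om x : ℂ) := by
  rw [(fmod_real hx).2, om]
  have hx' : (x : ℂ) ≠ 0 := by exact_mod_cast hx.ne'
  have e1 : ((x ^ (-(3/4) : ℝ) : ℝ) : ℂ) = (x : ℂ) ^ (-(3/4) : ℂ) := by
    rw [ofReal_cpow hx.le]; push_cast; rfl
  rw [ofReal_mul, e1, ← mul_assoc, smul_eq_mul]
  congr 1
  rw [show (1/2 + z)/2 - 1 = z/2 + (-(3/4)) by ring, cpow_add _ _ hx', cpow_def_of_ne_zero hx',
    ← ofReal_log hx.le]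
  congr 2
  push_cast; ring

lemma int_om (z : ℂ) :
    IntegrableOn (fun x : ℝ => cexp (z * ((Real.log x / 2 : ℝ) : ℂ)) * (om x : ℂ)) (Ioi 0) := by
  have h := ((HurwitzZeta.hurwitzEvenFEPair 0).isStrongFEPair_toStrongFEPair.hasMellin
    ((1/2 + z)/2)).1
  refine IntegrableOn.congr_fun h ?_ measurableSet_Ioi
  intro x hx
  exact mellin_integrand hx z

lemma Lam0_eq (z : ℂ) : completedRiemannZeta₀ (1/2 + z) =
    (∫ x in Ioi (0:ℝ), cexp (z * ((Real.log x / 2 : ℝ) : ℂ)) * (om x : ℂ)) / 2 := by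
  have : completedRiemannZeta₀ (1/2 + z) =
    (mellin (HurwitzZeta.hurwitzEvenFEPair 0).f_modif ((1/2 + z)/2)) / 2 := rfl
  rw [this, mellin]
  congr 1
  exact setIntegral_congr_fun measurableSet_Ioi (fun x hx => mellin_integrand hx z)

noncomputable def lam (n : ℕ) : ℝ :=
  (∫ x in Ioi (0:ℝ), (Real.log x / 2) ^ (2 * n) / ((2*n).factorial : ℝ) * om x) / 2

lemma lam_nonneg (n : ℕ) : 0 ≤ lam n := by
  refine div_nonneg (setIntegral_nonneg measurableSet_Ioi fun x hx => ?_) (by norm_num)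
  refine mul_nonneg (div_nonneg ?_ (by positivity)) (om_nonneg hx)
  rw [pow_mul]; positivity

lemma Lam0_even (z : ℂ) : completedRiemannZeta₀ (1/2 - z) = completedRiemannZeta₀ (1/2 + z) := by
  rw [← completedRiemannZeta₀_one_sub]; congr 1; ring

lemma Lam0_cosh (z : ℂ) : completedRiemannZeta₀ (1/2 + z) =
    (∫ x in Ioi (0:ℝ), cosh (z * ((Real.log x / 2 : ℝ) : ℂ)) * (om x : ℂ)) / 2 := by
  have h1 := Lam0_eq z
  have h2 := Lam0_eq (-z)
  rw [← sub_eq_add_neg, Lam0_even] at h2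
  have h3 : (∫ x in Ioi (0:ℝ), cosh (z * ((Real.log x / 2 : ℝ) : ℂ)) * (om x : ℂ)) =
     ((∫ x in Ioi (0:ℝ), cexp (z * ((Real.log x / 2 : ℝ) : ℂ)) * (om x : ℂ)) +
      (∫ x in Ioi (0:ℝ), cexp (-z * ((Real.log x / 2 : ℝ) : ℂ)) * (om x : ℂ))) / 2 := by
    rw [← integral_add (int_om z) (int_om (-z)), ← integral_div]
    congr 1; ext x
    rw [cosh, neg_mul]; ring
  rw [h3]
  linear_combination h1/2 + h2/2

lemma om_meas : AEStronglyMeasurable (fun x : ℝ => (om x : ℂ)) (volume.restrict (Ioi 0)) := by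
  have := (int_om 0).aestronglyMeasurable
  simpa using this

lemma hasSum_Lam0 (z : ℂ) :
    HasSum (fun n : ℕ => (lam n : ℂ) * (z^2) ^ n) (completedRiemannZeta₀ (1/2 + z)) := by
  rw [Lam0_cosh]
  have key : HasSum (fun n : ℕ => ∫ x in Ioi (0:ℝ),
      ((z * ((Real.log x / 2 : ℝ) : ℂ)) ^ (2 * n) / ((2*n).factorial : ℂ)) * (om x : ℂ))
      (∫ x in Ioi (0:ℝ), cosh (z * ((Real.log x / 2 : ℝ) : ℂ)) * (om x : ℂ)) := by
    refine hasSum_integral_of_dominated_convergence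
      (fun n x => (‖z‖ * (Real.log x / 2)) ^ (2 * n) / ((2*n).factorial : ℝ) * om x) ?_ ?_ ?_ ?_ ?_
    · intro n
      refine AEStronglyMeasurable.mul ?_ om_meas
      refine Measurable.aestronglyMeasurable ?_
      fun_prop
    · intro n
      refine (ae_restrict_iff' measurableSet_Ioi).2 (Eventually.of_forall fun x hx => ?_)
      rw [norm_mul, norm_div, norm_pow, norm_mul, norm_real, norm_real, Real.norm_eq_abs,
        Real.norm_eq_abs, abs_of_nonneg (om_nonneg hx), mul_pow, mul_pow]
      simp only [norm_natCast]
      rw [pow_mul |Real.log x / 2|, sq_abs, ← pow_mul]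
    · refine (ae_restrict_iff' measurableSet_Ioi).2 (Eventually.of_forall fun x hx => ?_)
      exact (Real.hasSum_cosh (‖z‖ * (Real.log x / 2))).summable.mul_right _
    · have h1 : IntegrableOn (fun x : ℝ => ((cosh ((‖z‖:ℂ) * ((Real.log x / 2 : ℝ) : ℂ)) *
          (om x : ℂ)).re)) (Ioi 0) := by
        suffices h : IntegrableOn (fun x : ℝ => ((cosh ((‖z‖:ℂ) * ((Real.log x / 2 : ℝ) : ℂ)) *
          (om x : ℂ)))) (Ioi 0) from Integrable.re (𝕜 := ℂ) h
        have := ((int_om (‖z‖:ℂ)).add (int_om (-(‖z‖:ℂ)))).div_const 2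
        refine this.congr (Eventually.of_forall fun x => ?_)
        simp only [Pi.add_apply]
        rw [cosh, neg_mul]; ring
      refine h1.congr (Eventually.of_forall fun x => ?_)
      simp only
      rw [tsum_mul_right, ← Real.cosh_eq_tsum, ← ofReal_mul, ← ofReal_cosh, ← ofReal_mul, ofReal_re]
    · refine (ae_restrict_iff' measurableSet_Ioi).2 (Eventually.of_forall fun x hx => ?_)
      exact (Complex.hasSum_cosh _).mul_right _
  refine (key.div_const 2).congr_fun ?_
  intro n
  rw [lam, ofReal_div, ← integral_complex_ofReal]
  have : ∀ x : ℝ, ((z * ((Real.log x / 2 : ℝ) : ℂ)) ^ (2 * n) / ((2*n).factorial : ℂ)) * (om x : ℂ)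
     = (z^2)^n * (((Real.log x / 2) ^ (2 * n) / ((2*n).factorial : ℝ) * om x : ℝ) : ℂ) := by
    intro x; push_cast; rw [mul_pow, pow_mul z]; ring
  simp_rw [this]
  rw [integral_const_mul]
  push_cast; ring

end G2RH


namespace G2RH
open Complex Filter Topology

/-! ### Power series with nonnegative coefficients -/

def NN (a : ℕ → ℝ) : Prop := (∀ n, 0 ≤ a n) ∧ ∀ x : ℝ, 0 ≤ x → Summable fun n => a n * x ^ n

noncomputable def evr (a : ℕ → ℝ) (x : ℝ) : ℝ := ∑' n, a n * x ^ n
noncomputable def evc (a : ℕ → ℝ) (w : ℂ) : ℂ := ∑' n, (a n : ℂ) * w ^ n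

lemma NN.norm_term {a : ℕ → ℝ} (h : NN a) (w : ℂ) (n : ℕ) :
    ‖(a n : ℂ) * w ^ n‖ = a n * ‖w‖ ^ n := by
  rw [norm_mul, norm_pow, norm_real, Real.norm_eq_abs, abs_of_nonneg (h.1 n)]

lemma NN.summ {a : ℕ → ℝ} (h : NN a) (w : ℂ) : Summable fun n => (a n : ℂ) * w ^ n := by
  refine Summable.of_norm ?_
  simp_rw [h.norm_term]
  exact h.2 _ (norm_nonneg _)

lemma NN.hasSum {a : ℕ → ℝ} (h : NN a) (w : ℂ) :
    HasSum (fun n => (a n : ℂ) * w ^ n) (evc a w) := (h.summ w).hasSum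

lemma NN.hasSumR {a : ℕ → ℝ} (h : NN a) {x : ℝ} (hx : 0 ≤ x) :
    HasSum (fun n => a n * x ^ n) (evr a x) := (h.2 x hx).hasSum

lemma evc_ofReal (a : ℕ → ℝ) (x : ℝ) : evc a x = (evr a x : ℂ) := by
  rw [evc, evr, ofReal_tsum]; push_cast; rfl

lemma NN.norm_le {a : ℕ → ℝ} (h : NN a) {w : ℂ} {x : ℝ} (hw : ‖w‖ ≤ x) :
    ‖evc a w‖ ≤ evr a x := by
  have hx : 0 ≤ x := (norm_nonneg _).trans hw
  refine tsum_of_norm_bounded (h.hasSumR hx) fun n => ?_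
  rw [h.norm_term]
  exact mul_le_mul_of_nonneg_left (pow_le_pow_left₀ (norm_nonneg _) hw n) (h.1 n)

lemma NN.evr_nonneg {a : ℕ → ℝ} (h : NN a) {x : ℝ} (hx : 0 ≤ x) : 0 ≤ evr a x :=
  (h.hasSumR hx).nonneg fun n => mul_nonneg (h.1 n) (pow_nonneg hx n)

lemma NN.evr_mono {a : ℕ → ℝ} (h : NN a) {x y : ℝ} (hx : 0 ≤ x) (hxy : x ≤ y) :
    evr a x ≤ evr a y :=
  hasSum_le (fun n => mul_le_mul_of_nonneg_left (pow_le_pow_left₀ hx hxy n) (h.1 n))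
    (h.hasSumR hx) (h.hasSumR (hx.trans hxy))

lemma NN.re_ge {a : ℕ → ℝ} (h : NN a) {w : ℂ} {x θ : ℝ} (hx : 0 ≤ x) (h0 : 0 ≤ θ) (h1 : θ ≤ 1)
    (hw : ‖w‖ ≤ θ * x) : -(θ * evr a x) ≤ (evc a w).re := by
  have s1 := (hasSum_re (h.hasSum w))
  have s2 := ((h.hasSumR hx).mul_left θ).neg
  refine hasSum_le (fun n => ?_) s2 s1
  have e1 : -(a n * ‖w‖ ^ n) ≤ ((a n : ℂ) * w ^ n).re := by
    have := Complex.abs_re_le_norm ((a n : ℂ) * w ^ n)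
    rw [h.norm_term] at this
    linarith [neg_abs_le ((a n : ℂ) * w ^ n).re]
  rcases Nat.eq_zero_or_pos n with rfl | hn
  · have := h.1 0
    simp
    nlinarith
  · have e2 : ‖w‖ ^ n ≤ θ * x ^ n := by
      calc ‖w‖ ^ n ≤ (θ * x) ^ n := pow_le_pow_left₀ (norm_nonneg _) hw n
        _ = θ ^ n * x ^ n := mul_pow _ _ _
        _ ≤ θ * x ^ n := by
          refine mul_le_mul_of_nonneg_right ?_ (pow_nonneg hx n)
          calc θ ^ n ≤ θ ^ 1 := pow_le_pow_of_le_one h0 h1 hn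
            _ = θ := pow_one _
    have := mul_le_mul_of_nonneg_left e2 (h.1 n)
    linarith

lemma abs_im_pow (w : ℂ) (n : ℕ) : |(w ^ n).im| ≤ n * ‖w‖ ^ (n - 1) * |w.im| := by
  induction n with
  | zero => simp
  | succ n ih =>
    rw [pow_succ, mul_im]
    have h1 : |(w ^ n).re * w.im| ≤ ‖w‖ ^ n * |w.im| := by
      rw [abs_mul, ← norm_pow]
      exact mul_le_mul_of_nonneg_right (abs_re_le_norm _) (abs_nonneg _)
    have h2 : |(w ^ n).im * w.re| ≤ n * ‖w‖ ^ n * |w.im| := by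
      rw [abs_mul]
      calc |(w ^ n).im| * |w.re| ≤ (n * ‖w‖ ^ (n - 1) * |w.im|) * ‖w‖ :=
            mul_le_mul ih (abs_re_le_norm _) (abs_nonneg _) (by positivity)
        _ = n * ‖w‖ ^ n * |w.im| := by
            rcases n with _ | n
            · simp
            · simp only [Nat.add_sub_cancel]; ring
    calc _ ≤ _ := abs_add_le _ _
      _ ≤ ‖w‖ ^ n * |w.im| + n * ‖w‖ ^ n * |w.im| := add_le_add h1 h2
      _ = _ := by push_cast; ring

lemma pow_diff {x y : ℝ} (hx : 0 ≤ x) (hxy : x ≤ y) (n : ℕ) :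
    n * x ^ (n - 1) * (y - x) ≤ y ^ n - x ^ n := by
  induction n with
  | zero => simp
  | succ n ih =>
    have h1 : x ^ n ≤ y ^ n := pow_le_pow_left₀ hx hxy n
    have h2 : (n : ℝ) * x ^ (n - 1) * x = n * x ^ n := by
      rcases n with _ | n
      · simp
      · simp only [Nat.add_sub_cancel]; ring
    simp only [Nat.add_sub_cancel]
    push_cast
    have h3 := mul_le_mul_of_nonneg_right ih hx
    rw [pow_succ, pow_succ]
    nlinarith [mul_nonneg (sub_nonneg.2 h1) (sub_nonneg.2 hxy)]

lemma NN.im_le {a : ℕ → ℝ} (h : NN a) {w : ℂ} {x y : ℝ} (hw : ‖w‖ ≤ x) (hxy : x ≤ y) :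
    |(evc a w).im| * (y - x) ≤ |w.im| * (evr a y - evr a x) := by
  have hx : 0 ≤ x := (norm_nonneg _).trans hw
  have s1 := (hasSum_im (h.hasSum w)).mul_right (y - x)
  have s2 := (((h.hasSumR (hx.trans hxy)).sub (h.hasSumR hx)).mul_left |w.im|)
  have key : ∀ n, ‖((a n : ℂ) * w ^ n).im * (y - x)‖ ≤ |w.im| * (a n * y ^ n - a n * x ^ n) := by
    intro n
    rw [im_ofReal_mul, Real.norm_eq_abs, abs_mul, abs_mul, abs_of_nonneg (h.1 n),
      abs_of_nonneg (sub_nonneg.2 hxy)]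
    have h1 := abs_im_pow w n
    have h2 := pow_diff hx hxy n
    have h3 : (n:ℝ) * ‖w‖ ^ (n - 1) * |w.im| ≤ n * x ^ (n-1) * |w.im| := by gcongr
    have h4 : |(w ^ n).im| * (y - x) ≤ (y ^ n - x ^ n) * |w.im| := by
      calc _ ≤ (n * x ^ (n-1) * |w.im|) * (y - x) :=
            mul_le_mul_of_nonneg_right (h1.trans h3) (sub_nonneg.2 hxy)
        _ = (n * x ^ (n-1) * (y - x)) * |w.im| := by ring
        _ ≤ _ := mul_le_mul_of_nonneg_right h2 (abs_nonneg _)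
    have := mul_le_mul_of_nonneg_left h4 (h.1 n)
    linarith
  have := tsum_of_norm_bounded s2 key
  rw [s1.tsum_eq, Real.norm_eq_abs, abs_mul, abs_of_nonneg (sub_nonneg.2 hxy)] at this
  exact this

/-- the divided difference step -/
noncomputable def bst (a : ℕ → ℝ) (x : ℝ) (k : ℕ) : ℝ := ∑' j, a (k + 1 + j) * x ^ j

lemma NN.summ_shift {a : ℕ → ℝ} (h : NN a) {x : ℝ} (hx : 0 ≤ x) (k : ℕ) :
    Summable fun j => a (k + j) * x ^ j := by
  have h1 := h.2 (x + 1) (by linarith)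
  have h2 : Summable fun j => a (k + j) * (x+1) ^ (k + j) := by
    simp_rw [add_comm k]
    exact (summable_nat_add_iff k).2 h1
  refine Summable.of_nonneg_of_le (fun j => mul_nonneg (h.1 _) (pow_nonneg hx _)) (fun j => ?_) h2
  refine mul_le_mul_of_nonneg_left ?_ (h.1 _)
  calc x ^ j ≤ (x+1)^j := pow_le_pow_left₀ hx (by linarith) _
    _ ≤ (x+1)^(k+j) := pow_le_pow_right₀ (by linarith) (by omega)

lemma NN.bst_rec {a : ℕ → ℝ} (h : NN a) {x : ℝ} (hx : 0 ≤ x) (k : ℕ) :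
    bst a x k = a (k+1) + x * bst a x (k+1) := by
  rw [bst, (h.summ_shift hx (k+1)).tsum_eq_zero_add, bst, ← tsum_mul_left]
  congr 1
  · simp
  · congr 1; ext j
    rw [show k + 1 + (j+1) = k + 1 + 1 + j by ring]; ring

lemma NN.bst_zero {a : ℕ → ℝ} (h : NN a) {x : ℝ} (hx : 0 ≤ x) :
    evr a x = a 0 + x * bst a x 0 := by
  rw [evr, (h.2 x hx).tsum_eq_zero_add, bst, ← tsum_mul_left]
  congr 1
  · simp
  · congr 1; ext j
    rw [show 0 + 1 + j = j + 1 by ring]; ring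

lemma NN.bst_le {a : ℕ → ℝ} (h : NN a) {x R : ℝ} (hx : 0 ≤ x) (hR : x ≤ R) (k : ℕ) :
    bst a x k * R ^ (k+1) ≤ evr a R := by
  have hR0 := hx.trans hR
  have s1 : HasSum (fun j => a (k+1+j) * x ^ j * R ^ (k+1)) (bst a x k * R ^ (k+1)) :=
    (h.summ_shift hx (k+1)).hasSum.mul_right _
  have h2 : Summable fun j => a (k + 1 + j) * R ^ (k + 1 + j) := by
    have h5 := (summable_nat_add_iff (f := fun n => a n * R ^ n) (k+1)).2 (h.2 R hR0)
    refine h5.congr fun j => ?_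
    rw [add_comm j]
  have h3 : ∑' j, a (k + 1 + j) * R ^ (k + 1 + j) ≤ evr a R := by
    have := (h.2 R hR0).sum_add_tsum_nat_add (k+1)
    have h6 : ∑' j, a (k + 1 + j) * R ^ (k + 1 + j) = ∑' j, a (j + (k + 1)) * R ^ (j + (k + 1)) :=
      tsum_congr fun j => by rw [add_comm j]
    rw [evr, ← this, h6]
    have h4 : 0 ≤ ∑ i ∈ Finset.range (k+1), a i * R ^ i :=
      Finset.sum_nonneg fun i _ => mul_nonneg (h.1 _) (pow_nonneg hR0 _)
    linarith
  refine le_trans ?_ h3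
  refine hasSum_le (fun j => ?_) s1 h2.hasSum
  have : x ^ j * R ^ (k+1) ≤ R ^ (k+1+j) := by
    rw [pow_add R (k+1) j, mul_comm]
    exact mul_le_mul_of_nonneg_left (pow_le_pow_left₀ hx hR j) (pow_nonneg hR0 _)
  have := mul_le_mul_of_nonneg_left this (h.1 (k+1+j))
  linarith

lemma NN.bst {a : ℕ → ℝ} (h : NN a) {x : ℝ} (hx : 0 ≤ x) : NN (bst a x) := by
  have hnn : ∀ k, 0 ≤ G2RH.bst a x k :=
    fun k => tsum_nonneg fun j => mul_nonneg (h.1 _) (pow_nonneg hx _)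
  refine ⟨hnn, fun y hy => ?_⟩
  set R := 2 * (x + y + 1) with hR
  have hR0 : 0 < R := by positivity
  have hg : Summable fun k : ℕ => (evr a R / R) * (1/2 : ℝ) ^ k :=
    (summable_geometric_of_lt_one (by norm_num) (by norm_num)).mul_left _
  refine Summable.of_nonneg_of_le (fun j => mul_nonneg (hnn _) (pow_nonneg hy _)) (fun k => ?_) hg
  have h1 := h.bst_le hx (show x ≤ R by rw [hR]; linarith) k
  have h2 : y ^ k ≤ R ^ k * (1/2) ^ k := by
    rw [← mul_pow]; exact pow_le_pow_left₀ hy (by rw [hR]; linarith) k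
  calc _ ≤ G2RH.bst a x k * (R ^ k * (1/2)^k) := mul_le_mul_of_nonneg_left h2 (hnn k)
    _ = (G2RH.bst a x k * R ^ (k+1)) / R * (1/2)^k := by rw [pow_succ]; field_simp
    _ ≤ _ := by gcongr

lemma NN.step {a : ℕ → ℝ} (h : NN a) {x : ℝ} (hx : 0 ≤ x) (w : ℂ) :
    evc a w = evr a x + (w - x) * evc (G2RH.bst a x) w := by
  have hb := h.bst hx
  have s1 := hb.hasSum w
  have s2 := (h.hasSum w)
  have s3 := s1.mul_left w
  have s4 := s1.mul_left (x:ℂ)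
  rw [← hasSum_nat_add_iff' 1] at s4 s2
  have s5 := s3.sub s2
  have e : (fun n => w * ((G2RH.bst a x n : ℂ) * w ^ n) - (a (n+1) : ℂ) * w ^ (n+1)) =
      fun n => (x:ℂ) * ((G2RH.bst a x (n+1) : ℂ) * w ^ (n+1)) := by
    ext n
    have := h.bst_rec hx n
    rw [this]; push_cast; ring
  rw [e] at s5
  have := s5.unique s4
  simp only [Finset.sum_range_one, pow_zero, mul_one] at this
  have h0 := h.bst_zero hx
  rw [h0]; push_cast
  linear_combination -this

/-! ### The Newton scheme for the completed zeta function -/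

lemma lam_NN : NN lam := by
  refine ⟨lam_nonneg, fun x hx => ?_⟩
  have h := (hasSum_Lam0 ((Real.sqrt x : ℝ) : ℂ)).summable
  rw [← ofReal_pow, Real.sq_sqrt hx] at h
  have := Complex.reCLM.summable h
  refine this.congr fun n => ?_
  simp only [reCLM_apply]
  rw [← ofReal_pow, ← ofReal_mul, ofReal_re]

lemma Lam0_evc (z : ℂ) : completedRiemannZeta₀ (1/2 + z) = evc lam (z^2) :=
  (hasSum_Lam0 z).tsum_eq.symm

noncomputable def nd (j : ℕ) : ℝ := (2 * j + 3/2) ^ 2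

noncomputable def cs : ℕ → ℕ → ℝ
  | 0 => lam
  | j+1 => bst (cs j) (nd j)

lemma nd_nonneg (j : ℕ) : 0 ≤ nd j := sq_nonneg _

lemma cs_NN (j : ℕ) : NN (cs j) := by
  induction j with
  | zero => exact lam_NN
  | succ j ih => exact ih.bst (nd_nonneg j)

noncomputable def dc (j : ℕ) : ℝ := evr (cs j) (nd j)

lemma dc_nonneg (j : ℕ) : 0 ≤ dc j := (cs_NN j).evr_nonneg (nd_nonneg j)

lemma cs_step (j : ℕ) (w : ℂ) : evc (cs j) w = dc j + (w - nd j) * evc (cs (j+1)) w :=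
  (cs_NN j).step (nd_nonneg j) w

lemma cs_stepR (j : ℕ) (x : ℝ) : evr (cs j) x = dc j + (x - nd j) * evr (cs (j+1)) x := by
  have := cs_step j (x:ℂ)
  rw [evc_ofReal, evc_ofReal] at this
  exact_mod_cast this

lemma nd_lt (j : ℕ) : nd j < nd (j+1) := by
  unfold nd; push_cast; nlinarith [(Nat.cast_nonneg j : (0:ℝ) ≤ j)]

lemma cs_im (j : ℕ) {w : ℂ} (hw : ‖w‖ ≤ nd j) : |(evc (cs j) w).im| ≤ |w.im| * dc (j+1) := by
  have h := (cs_NN j).im_le hw (nd_lt j).le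
  have h1 := cs_stepR j (nd (j+1))
  have h2 : evr (cs j) (nd j) = dc j := rfl
  have h3 : evr (cs (j+1)) (nd (j+1)) = dc (j+1) := rfl
  rw [h2, h1, h3] at h
  have h4 := sub_pos.2 (nd_lt j)
  have h5 : |(evc (cs j) w).im| * (nd (j+1) - nd j) ≤ (|w.im| * dc (j+1)) * (nd (j+1) - nd j) := by
    linarith
  exact le_of_mul_le_mul_right h5 h4

lemma cs_re_le (j : ℕ) {w : ℂ} (hw : ‖w‖ ≤ nd j) : (evc (cs j) w).re ≤ dc j :=
  (re_le_norm _).trans ((cs_NN j).norm_le hw)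

lemma cs_re_ge (j : ℕ) {w : ℂ} {θ : ℝ} (h0 : 0 ≤ θ) (h1 : θ ≤ 1) (hw : ‖w‖ ≤ θ * nd j) :
    -(θ * dc j) ≤ (evc (cs j) w).re :=
  (cs_NN j).re_ge (nd_nonneg j) h0 h1 hw

end G2RH


namespace G2RH
open Complex Filter Topology

/-! ### The entire function `X` -/

noncomputable def X (w : ℂ) : ℂ := 1 + w * (w - 1) * completedRiemannZeta₀ w

lemma X_diff : Differentiable ℂ X := by
  unfold X
  have := differentiable_completedZeta₀
  fun_prop

lemma X_one_sub (w : ℂ) : X (1 - w) = X w := by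
  unfold X; rw [completedRiemannZeta₀_one_sub]; ring

lemma X_eq {w : ℂ} (h0 : w ≠ 0) (h1 : w ≠ 1) : X w = w * (w - 1) * completedRiemannZeta w := by
  rw [X, completedRiemannZeta_eq]
  have : 1 - w ≠ 0 := sub_ne_zero.2 (Ne.symm h1)
  field_simp; ring

lemma X_zero : X 0 = 1 := by simp [X]
lemma X_one : X 1 = 1 := by simp [X]

lemma X_evc (z : ℂ) : X (1/2 + z) = 1 + (z^2 - 1/4) * evc lam (z^2) := by
  rw [X, Lam0_evc]; ring

lemma evc_conj (a : ℕ → ℝ) (w : ℂ) :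
    evc a ((starRingEnd ℂ) w) = (starRingEnd ℂ) (evc a w) := by
  rw [evc, evc, Complex.conj_tsum]
  congr 1; ext n; simp

lemma X_conj (w : ℂ) : X ((starRingEnd ℂ) w) = (starRingEnd ℂ) (X w) := by
  have h1 := X_evc ((starRingEnd ℂ) w - 1/2)
  have h2 := X_evc (w - 1/2)
  have e : ((starRingEnd ℂ) w - 1/2)^2 = (starRingEnd ℂ) ((w - 1/2)^2) := by simp [Complex.conj_ofNat]
  rw [e, evc_conj] at h1
  rw [show (1:ℂ)/2 + ((starRingEnd ℂ) w - 1/2) = (starRingEnd ℂ) w by ring] at h1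
  rw [show (1:ℂ)/2 + (w - 1/2) = w by ring] at h2
  rw [h1, h2]; simp [Complex.conj_ofNat]

noncomputable def Xr (x : ℝ) : ℝ := 1 + ((x - 1/2)^2 - 1/4) * evr lam ((x-1/2)^2)

lemma X_ofReal (x : ℝ) : X x = (Xr x : ℂ) := by
  have := X_evc ((x:ℂ) - 1/2)
  rw [show (1:ℂ)/2 + ((x:ℂ) - 1/2) = x by ring] at this
  rw [this, Xr]
  rw [show ((x:ℂ) - 1/2)^2 = (((x - 1/2)^2 : ℝ) : ℂ) by push_cast; ring, evc_ofReal]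
  push_cast; ring

lemma Xr_mono {x y : ℝ} (hx : 1 ≤ x) (hxy : x ≤ y) : Xr x ≤ Xr y := by
  unfold Xr
  have h1 : (x-1/2)^2 ≤ (y-1/2)^2 := by nlinarith
  have h2 : 1/4 ≤ (x-1/2)^2 := by nlinarith
  have h3 := lam_NN.evr_mono (sq_nonneg _) h1
  have h4 := lam_NN.evr_nonneg (sq_nonneg (x-1/2))
  have := mul_le_mul (show (x-1/2)^2 - 1/4 ≤ (y-1/2)^2 - 1/4 by linarith) h3 h4 (by linarith)
  linarith

lemma Xr_pos {x : ℝ} (hx : 1 ≤ x) : 1 ≤ Xr x := by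
  unfold Xr
  have h2 : 1/4 ≤ (x-1/2)^2 := by nlinarith
  have h4 := lam_NN.evr_nonneg (sq_nonneg (x-1/2))
  nlinarith [mul_nonneg (sub_nonneg.2 h2) h4]

lemma X_ne_zero {w : ℂ} (hw : 1 ≤ w.re) : X w ≠ 0 := by
  by_cases h1 : w = 1
  · rw [h1, X_one]; exact one_ne_zero
  have h0 : w ≠ 0 := by rintro rfl; norm_num at hw
  rw [X_eq h0 h1]
  have hz := riemannZeta_ne_zero_of_one_le_re hw
  rw [riemannZeta_def_of_ne_zero h0] at hz
  have := (div_ne_zero_iff.1 hz).1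
  exact mul_ne_zero (mul_ne_zero h0 (sub_ne_zero.2 h1)) this

/-! ### Growth -/

lemma Gamma_compare {x : ℝ} (hx : 1/2 ≤ x) (y : ℝ) :
    ‖Gamma x‖ * ‖Gamma (1/2 + y * I)‖ ≤ ‖Gamma (x + y * I)‖ * ‖Gamma (1/2)‖ := by
  have t1 := ((GammaSeq_tendsto_Gamma (x:ℂ)).norm).mul ((GammaSeq_tendsto_Gamma (1/2 + y * I)).norm)
  have t2 := ((GammaSeq_tendsto_Gamma ((x:ℂ) + y * I)).norm).mul
    ((GammaSeq_tendsto_Gamma (1/2)).norm)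
  refine le_of_tendsto_of_tendsto t1 t2 ?_
  filter_upwards [eventually_gt_atTop 0] with n hn
  have hnp : (0:ℝ) < n := by exact_mod_cast hn
  have key : ∀ j ∈ Finset.range (n+1), ‖(x:ℂ) + y * I + j‖ * ‖(1/2 : ℂ) + j‖ ≤
      ‖(x:ℂ) + j‖ * ‖(1/2 : ℂ) + y * I + j‖ := by
    intro j _
    have hj : (0:ℝ) ≤ j := Nat.cast_nonneg j
    refine le_of_sq_le_sq ?_ (by positivity)
    rw [mul_pow, mul_pow, ← normSq_eq_norm_sq, ← normSq_eq_norm_sq, ← normSq_eq_norm_sq,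
      ← normSq_eq_norm_sq]
    simp [normSq_apply]
    have : (2⁻¹ + (j:ℝ))^2 ≤ (x + j)^2 := pow_le_pow_left₀ (by positivity) (by linarith) 2
    nlinarith [mul_le_mul_of_nonneg_right this (sq_nonneg y)]
  have kp := Finset.prod_le_prod (fun j _ => by positivity) key
  rw [Finset.prod_mul_distrib, Finset.prod_mul_distrib] at kp
  have np : ∀ s : ℂ, 0 < s.re → 0 < ∏ j ∈ Finset.range (n+1), ‖s + j‖ := by
    intro s hs
    refine Finset.prod_pos fun j _ => ?_
    rw [norm_pos_iff]
    intro h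
    have := congrArg re h
    simp at this
    have hj : (0:ℝ) ≤ j := Nat.cast_nonneg j
    linarith
  have p1 := np x (by simp; linarith)
  have p2 := np (1/2 + y * I) (by norm_num)
  have p3 := np (x + y * I) (by simp; linarith)
  have p4 := np (1/2) (by norm_num)
  have ns : ∀ s : ℂ, ‖GammaSeq s n‖ = (n:ℝ)^s.re * n.factorial /
      ∏ j ∈ Finset.range (n+1), ‖s + j‖ := by
    intro s
    rw [GammaSeq, norm_div, norm_mul, norm_natCast_cpow_of_pos hn, norm_prod]
    simp
  rw [ns, ns, ns, ns, div_mul_div_comm, div_mul_div_comm]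
  have e : ((1/2 + (y:ℂ) * I).re) = 1/2 := by norm_num
  have e2 : (((x:ℂ) + (y:ℂ) * I).re) = x := by simp
  have e3 : ((1/2 : ℂ).re) = 1/2 := by norm_num
  rw [e, e2, e3, ofReal_re]
  refine div_le_div_of_nonneg_left (by positivity) (by positivity) kp

lemma Gamma_half_line (y : ℝ) : ‖Gamma (1/2 + y * I)‖^2 * Real.cosh (Real.pi * y) = Real.pi := by
  have h := Complex.Gamma_mul_Gamma_one_sub (1/2 + y * I)
  rw [show (1:ℂ) - (1/2 + y * I) = (starRingEnd ℂ) (1/2 + y * I) by simp [Complex.conj_ofNat]; ring,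
    Gamma_conj, mul_conj] at h
  rw [show (Real.pi:ℂ) * (1/2 + y * I) = ((Real.pi * y : ℝ) : ℂ) * I + Real.pi/2 by push_cast; ring,
    Complex.sin_add_pi_div_two, Complex.cos_mul_I, ← ofReal_cosh] at h
  rw [← normSq_eq_norm_sq]
  have hc : Real.cosh (Real.pi * y) ≠ 0 := (Real.cosh_pos _).ne'
  have h2 : (normSq (Gamma (1/2 + y * I))) = Real.pi / Real.cosh (Real.pi * y) := by exact_mod_cast h
  rw [h2]; field_simp

lemma Gamma_lower {x : ℝ} (hx : 1/2 ≤ x) (y : ℝ) :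
    Real.Gamma x * Real.exp (-(2 * |y|)) ≤ ‖Gamma (x + y * I)‖ := by
  have h1 := Gamma_compare hx y
  have h2 := Gamma_half_line y
  have h3 : ‖Gamma (1/2)‖ ^ 2 = Real.pi := by
    have := Gamma_half_line 0; simpa using this
  have hG : ‖Gamma (x:ℂ)‖ = Real.Gamma x := by
    rw [Gamma_ofReal, norm_real, Real.norm_eq_abs, abs_of_pos (Real.Gamma_pos_of_pos (by linarith))]
  rw [hG] at h1
  have hx0 := Real.Gamma_pos_of_pos (show 0 < x by linarith)
  have hc : Real.cosh (Real.pi * y) ≤ Real.exp (2 * |y|) ^ 2 := by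
    have e : Real.exp (2 * |y|) ^ 2 = Real.exp (4 * |y|) := by
      rw [pow_two, ← Real.exp_add]; congr 1; ring
    rw [e, ← Real.cosh_abs, Real.cosh_eq]
    have h5 : |Real.pi * y| ≤ 4 * |y| := by
      rw [abs_mul, abs_of_pos Real.pi_pos]
      nlinarith [abs_nonneg y, Real.pi_le_four]
    have h6 := Real.exp_le_exp.2 h5
    have h7 := Real.exp_le_exp.2 (show -|Real.pi * y| ≤ 4 * |y| by
      linarith [abs_nonneg (Real.pi * y)])
    linarith
  have hp : 0 < ‖Gamma (1/2)‖ := by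
    rcases (norm_nonneg (Gamma (1/2))).lt_or_eq with h | h
    · exact h
    · rw [← h] at h3; norm_num at h3; exact absurd h3.symm Real.pi_ne_zero
  have h6 : ‖Gamma (1/2)‖ ≤ ‖Gamma (1/2 + y * I)‖ * Real.exp (2 * |y|) := by
    refine le_of_sq_le_sq ?_ (by positivity)
    rw [mul_pow, h3, ← h2]
    exact mul_le_mul_of_nonneg_left hc (by positivity)
  rw [Real.exp_neg]
  have he := Real.exp_pos (2 * |y|)
  rw [← div_eq_mul_inv, div_le_iff₀ he]
  refine le_of_mul_le_mul_right ?_ hp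
  calc Real.Gamma x * ‖Gamma (1/2)‖ ≤ Real.Gamma x * (‖Gamma (1/2 + y * I)‖ * Real.exp (2 * |y|)) :=
        mul_le_mul_of_nonneg_left h6 hx0.le
    _ = (Real.Gamma x * ‖Gamma (1/2 + y * I)‖) * Real.exp (2 * |y|) := by ring
    _ ≤ (‖Gamma (x + y * I)‖ * ‖Gamma (1/2)‖) * Real.exp (2 * |y|) :=
        mul_le_mul_of_nonneg_right h1 he.le
    _ = _ := by ring

lemma Gamma_real_lower : ∃ c > 0, ∀ x : ℝ, 1/2 ≤ x → c ≤ Real.Gamma x := by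
  have hc : ContinuousOn Real.Gamma (Set.Icc (1/2) 2) := fun x hx =>
    (Real.differentiableAt_Gamma fun m => by
      have : (0:ℝ) ≤ m := Nat.cast_nonneg m
      have := hx.1
      intro h; linarith).continuousAt.continuousWithinAt
  obtain ⟨x0, hx0, hmin⟩ := isCompact_Icc.exists_isMinOn ⟨1, by norm_num⟩ hc
  refine ⟨Real.Gamma x0, Real.Gamma_pos_of_pos (by linarith [hx0.1]), fun x hx => ?_⟩
  rcases le_or_gt x 2 with h | h
  · exact hmin ⟨hx, h⟩
  · have h1 : Real.Gamma x0 ≤ Real.Gamma 2 := hmin ⟨by norm_num, le_rfl⟩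
    exact h1.trans (Real.Gamma_strictMonoOn_Ici.monotoneOn Set.self_mem_Ici h.le h.le)

lemma zeta_lower {σ : ℝ} (hσ : 1 < σ) : ∃ C > 0, ∀ w : ℂ, σ ≤ w.re → 1 ≤ C * ‖riemannZeta w‖ := by
  have hs := ArithmeticFunction.LSeriesSummable_zeta_iff.2 (show 1 < (σ:ℂ).re by simpa using hσ)
  refine ⟨∑' n, ‖LSeries.term (fun n => (ArithmeticFunction.zeta n : ℂ)) σ n‖ + 1, by positivity,
    fun w hw => ?_⟩
  have hw1 : 1 < w.re := lt_of_lt_of_le hσ hw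
  have h := ArithmeticFunction.LSeries_zeta_mul_Lseries_moebius hw1
  rw [ArithmeticFunction.LSeries_zeta_eq_riemannZeta hw1] at h
  have h2 := congrArg norm h
  rw [norm_mul, norm_one] at h2
  have h3 : ‖LSeries (fun n => (ArithmeticFunction.moebius n : ℂ)) w‖ ≤
      ∑' n, ‖LSeries.term (fun n => (ArithmeticFunction.zeta n : ℂ)) σ n‖ := by
    refine tsum_of_norm_bounded hs.norm.hasSum fun n => ?_
    rw [LSeries.norm_term_eq, LSeries.norm_term_eq]
    split_ifs with hn
    · rfl
    have hn1 : (1:ℝ) ≤ n := by exact_mod_cast Nat.one_le_iff_ne_zero.2 hn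
    have e1 : ‖((ArithmeticFunction.moebius n : ℤ) : ℂ)‖ ≤ 1 := by
      rw [Complex.norm_intCast]
      exact_mod_cast ArithmeticFunction.abs_moebius_le_one
    have e2 : ‖((ArithmeticFunction.zeta n : ℕ) : ℂ)‖ = 1 := by
      rw [ArithmeticFunction.zeta_apply_ne hn]; simp
    rw [e2]
    have e3 : (n:ℝ)^σ ≤ (n:ℝ)^w.re := Real.rpow_le_rpow_of_exponent_le hn1 hw
    have : 0 < (n:ℝ)^σ := by positivity
    rw [ofReal_re]
    gcongr
  rw [← h2, mul_comm]
  exact mul_le_mul_of_nonneg_right (by linarith) (norm_nonneg _)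

lemma X_lower {σ : ℝ} (hσ : 1 < σ) : ∃ C > 0, ∀ w : ℂ, σ ≤ w.re →
    1 ≤ C * Real.exp (3 * ‖w‖) * ‖X w‖ := by
  obtain ⟨c, hc, hG⟩ := Gamma_real_lower
  obtain ⟨C, hC, hZ⟩ := zeta_lower hσ
  refine ⟨C / (c * (σ - 1)), div_pos hC (mul_pos hc (by linarith)), fun w hw => ?_⟩
  have h0 : w ≠ 0 := by rintro rfl; norm_num at hw; linarith
  have h1 : w ≠ 1 := by rintro rfl; norm_num at hw; linarith
  have hz := hZ w hw
  have hgr : Gammaℝ w ≠ 0 := Gammaℝ_ne_zero_of_re_pos (by linarith)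
  have hL : completedRiemannZeta w = Gammaℝ w * riemannZeta w := by
    rw [riemannZeta_def_of_ne_zero h0]; field_simp
  rw [X_eq h0 h1, hL, norm_mul, norm_mul, norm_mul]
  have hw1 : 1 ≤ ‖w‖ := by linarith [re_le_norm w]
  have hw2 : σ - 1 ≤ ‖w - 1‖ := by
    have := re_le_norm (w - 1); simp at this; linarith
  have hg : c * Real.exp (-(3 * ‖w‖)) ≤ ‖Gammaℝ w‖ := by
    rw [Gammaℝ_def, norm_mul]
    have e1 : ‖(Real.pi : ℂ) ^ (-w/2)‖ = Real.pi ^ (-w.re/2) := by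
      rw [norm_cpow_eq_rpow_re_of_pos Real.pi_pos]; congr 1
      simp
    have e2 : Real.exp (-‖w‖) ≤ Real.pi ^ (-w.re/2) := by
      rw [Real.rpow_def_of_pos Real.pi_pos]
      refine Real.exp_le_exp.2 ?_
      have : Real.log Real.pi ≤ 2 := by
        rw [Real.log_le_iff_le_exp Real.pi_pos]
        have := Real.exp_one_gt_d9
        rw [show (2:ℝ) = 1 + 1 by norm_num, Real.exp_add]
        nlinarith [Real.pi_le_four]
      nlinarith [re_le_norm w]
    have e3 := Gamma_lower (show 1/2 ≤ w.re/2 by linarith) (w.im/2)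
    rw [show (((w.re/2 : ℝ) : ℂ) + ((w.im/2 : ℝ):ℂ) * I) = w/2 by
      conv_rhs => rw [← re_add_im w]
      push_cast; ring] at e3
    have e4 := hG (w.re/2) (by linarith)
    have e5 : Real.exp (-(2*‖w‖)) ≤ Real.exp (-(2 * |w.im/2|)) := by
      refine Real.exp_le_exp.2 ?_
      have := abs_im_le_norm w
      rw [abs_div, abs_two]
      linarith [abs_nonneg w.im]
    have e6 : c * Real.exp (-(2*‖w‖)) ≤ ‖Gamma (w/2)‖ :=
      (mul_le_mul e4 e5 (by positivity) (Real.Gamma_pos_of_pos (by linarith)).le).trans e3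
    rw [e1, show -(3 * ‖w‖) = -‖w‖ + -(2*‖w‖) by ring, Real.exp_add]
    calc _ = Real.exp (-‖w‖) * (c * Real.exp (-(2*‖w‖))) := by ring
      _ ≤ _ := mul_le_mul e2 e6 (by positivity) (by positivity)
  have hs : 0 < σ - 1 := by linarith
  have hE := Real.exp_pos (3 * ‖w‖)
  have e7 : 1 ≤ ‖Gammaℝ w‖ * Real.exp (3 * ‖w‖) / c := by
    rw [Real.exp_neg, ← div_eq_mul_inv, div_le_iff₀ hE] at hg
    rw [le_div_iff₀ hc]; linarith
  calc (1:ℝ) = 1 * 1 * 1 * 1 := by ring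
    _ ≤ ‖w‖ * (‖w - 1‖ / (σ - 1)) * (‖Gammaℝ w‖ * Real.exp (3 * ‖w‖) / c) * (C * ‖riemannZeta w‖) := by
        have : 1 ≤ ‖w - 1‖ / (σ - 1) := by rw [le_div_iff₀ hs]; linarith
        gcongr
    _ = _ := by field_simp

lemma zeta_upper : ∃ C > 0, ∀ w : ℂ, 2 ≤ w.re → ‖riemannZeta w‖ ≤ C := by
  have hs := ArithmeticFunction.LSeriesSummable_zeta_iff.2 (show 1 < (2:ℂ).re by norm_num)
  refine ⟨∑' n, ‖LSeries.term (fun n => (ArithmeticFunction.zeta n : ℂ)) 2 n‖ + 1, by positivity,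
    fun w hw => ?_⟩
  have hw1 : 1 < w.re := by linarith
  rw [← ArithmeticFunction.LSeries_zeta_eq_riemannZeta hw1]
  suffices h : ‖LSeries (fun n => (ArithmeticFunction.zeta n : ℂ)) w‖ ≤
      ∑' n, ‖LSeries.term (fun n => (ArithmeticFunction.zeta n : ℂ)) 2 n‖ by linarith
  refine tsum_of_norm_bounded hs.norm.hasSum fun n => ?_
  rw [LSeries.norm_term_eq, LSeries.norm_term_eq]
  split_ifs with hn
  · rfl
  have hn1 : (1:ℝ) ≤ n := by exact_mod_cast Nat.one_le_iff_ne_zero.2 hn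
  have e3 : (n:ℝ)^(2:ℂ).re ≤ (n:ℝ)^w.re := Real.rpow_le_rpow_of_exponent_le hn1 (by simpa using hw)
  have : 0 < (n:ℝ)^(2:ℂ).re := by positivity
  gcongr

lemma X_upper : ∃ C > 0, ∀ z : ℂ, ‖X (1/2 + z)‖ ≤ C * Real.exp (4 * (‖z‖ + 2) ^ (3/2 : ℝ)) := by
  obtain ⟨C, hC, hZ⟩ := zeta_upper
  refine ⟨2 * C + 1, by positivity, fun z => ?_⟩
  set r := ‖z‖ with hr
  have hr0 : 0 ≤ r := norm_nonneg z
  set n := ⌈r⌉₊ with hn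
  have hn1 : r ≤ n := Nat.le_ceil r
  have hn2 : (n:ℝ) < r + 1 := Nat.ceil_lt_add_one hr0
  have hNr : X ((2 * (n + 1) : ℝ) : ℂ) = (Xr (2*(n+1)) : ℂ) := X_ofReal _
  have hxle : ‖X (1/2 + z)‖ ≤ 1 + (r^2 + 1/4) * evr lam (r^2) := by
    rw [X_evc]
    have e1 : ‖evc lam (z^2)‖ ≤ evr lam (r^2) := lam_NN.norm_le (by rw [norm_pow])
    have e2 : ‖z^2 - 1/4‖ ≤ r^2 + 1/4 := by
      refine (norm_sub_le _ _).trans ?_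
      rw [norm_pow]; norm_num [hr]
    calc _ ≤ ‖(1:ℂ)‖ + ‖(z^2 - 1/4) * evc lam (z^2)‖ := norm_add_le _ _
      _ ≤ _ := by
        rw [norm_one, norm_mul]
        have := mul_le_mul e2 e1 (norm_nonneg _) (by positivity)
        linarith
  set m : ℝ := 2*(n+1) with hm
  have hmn : (0:ℝ) ≤ n := Nat.cast_nonneg n
  have h1 : evr lam (r^2) ≤ evr lam ((m-1/2)^2) := by
    refine lam_NN.evr_mono (sq_nonneg r) (pow_le_pow_left₀ hr0 (by rw [hm]; linarith) 2)
  have hm2 : 2 ≤ m := by rw [hm]; linarith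
  have h2 : (r^2 + 1/4) ≤ (m-1/2)^2 - 1/4 := by
    rw [hm]; nlinarith
  have h3 : ‖X (1/2 + z)‖ ≤ Xr m := by
    refine hxle.trans ?_
    unfold Xr
    have := mul_le_mul h2 h1 (lam_NN.evr_nonneg (sq_nonneg r)) (by nlinarith)
    linarith
  have h4 : Xr m ≤ m * m * (C * Real.exp (2 * (r+2)^(3/2:ℝ))) := by
    have e0 : (m:ℂ) ≠ 0 := by exact_mod_cast (show m ≠ 0 by linarith)
    have e1 : (m:ℂ) ≠ 1 := by exact_mod_cast (show m ≠ 1 by linarith)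
    have hX := X_eq e0 e1
    rw [hNr] at hX
    have hgr : Gammaℝ m ≠ 0 := Gammaℝ_ne_zero_of_re_pos (by simp; linarith)
    have hL : completedRiemannZeta m = Gammaℝ m * riemannZeta m := by
      rw [riemannZeta_def_of_ne_zero e0]; field_simp
    rw [hL] at hX
    have hX2 := congrArg norm hX
    rw [norm_real, Real.norm_eq_abs, norm_mul, norm_mul, norm_mul] at hX2
    have hz := hZ m (by simpa using hm2)
    have hg : ‖Gammaℝ m‖ ≤ Real.exp (2 * (r+2)^(3/2:ℝ)) := by
      rw [Gammaℝ_def, norm_mul]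
      have a1 : ‖(Real.pi : ℂ) ^ (-(m:ℂ)/2)‖ ≤ 1 := by
        rw [norm_cpow_eq_rpow_re_of_pos Real.pi_pos]
        refine Real.rpow_le_one_of_one_le_of_nonpos (by linarith [Real.pi_gt_three]) ?_
        simp; linarith
      have a2 : Gamma ((m:ℂ)/2) = (n.factorial : ℂ) := by
        rw [hm]; push_cast
        rw [show (2 * ((n:ℂ) + 1))/2 = n + 1 by ring]
        exact Gamma_nat_eq_factorial n
      have a3 : ‖Gamma ((m:ℂ)/2)‖ ≤ Real.exp (2 * (r+2)^(3/2:ℝ)) := by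
        rw [a2, norm_natCast]
        have b1 : (n.factorial : ℝ) ≤ (n+1:ℝ)^(n:ℝ) := by
          rw [Real.rpow_natCast]
          calc (n.factorial : ℝ) ≤ (n:ℝ)^n := by exact_mod_cast Nat.factorial_le_pow n
            _ ≤ _ := pow_le_pow_left₀ hmn (by linarith) n
        refine b1.trans ?_
        rw [Real.rpow_def_of_pos (by linarith)]
        refine Real.exp_le_exp.2 ?_
        have b2 : Real.log (n+1) ≤ (r+2)^(1/2:ℝ) / (1/2) :=
          (Real.log_le_rpow_div (x := (n:ℝ)+1) (ε := 1/2) (by linarith) (by norm_num)).trans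
            (div_le_div_of_nonneg_right
              (Real.rpow_le_rpow (by linarith) (by linarith) (by norm_num)) (by norm_num))
        have b3 : (r+2)^(3/2:ℝ) = (r+2)^(1/2:ℝ) * (r+2) := by
          rw [← Real.rpow_add_one (by linarith)]; norm_num
        have b4 : 0 ≤ (r+2)^(1/2:ℝ) := by positivity
        calc Real.log (n+1) * n ≤ ((r+2)^(1/2:ℝ) / (1/2)) * (r+2) := by
              refine mul_le_mul b2 (by linarith) hmn (by positivity)
          _ = _ := by rw [b3]; ring
      calc _ ≤ 1 * Real.exp (2 * (r+2)^(3/2:ℝ)) := mul_le_mul a1 a3 (norm_nonneg _) (by norm_num)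
        _ = _ := one_mul _
    have n1 : ‖(m:ℂ)‖ = m := by rw [norm_real, Real.norm_eq_abs, abs_of_nonneg (by linarith)]
    have n2 : ‖(m:ℂ) - 1‖ ≤ m := by
      rw [show (m:ℂ) - 1 = ((m - 1 : ℝ) : ℂ) by push_cast; ring, norm_real, Real.norm_eq_abs,
        abs_of_nonneg (by linarith)]
      linarith
    rw [n1] at hX2
    calc Xr m ≤ |Xr m| := le_abs_self _
      _ = m * ‖(m:ℂ) - 1‖ * (‖Gammaℝ m‖ * ‖riemannZeta m‖) := hX2
      _ ≤ m * m * (Real.exp (2 * (r+2)^(3/2:ℝ)) * C) := by gcongr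
      _ = _ := by ring
  have h5 : m * m ≤ 2 * Real.exp (2 * (r+2)^(3/2:ℝ)) := by
    have b3 : (r+2) ≤ (r+2)^(3/2:ℝ) := by
      conv_lhs => rw [← Real.rpow_one (r+2)]
      exact Real.rpow_le_rpow_of_exponent_le (by linarith) (by norm_num)
    have b4 : 1 + 2*(r+2) + (2*(r+2))^2/2 ≤ Real.exp (2 * (r+2)) :=
      Real.quadratic_le_exp_of_nonneg (by linarith)
    have b5 : Real.exp (2 * (r+2)) ≤ Real.exp (2 * (r+2)^(3/2:ℝ)) := Real.exp_le_exp.2 (by linarith)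
    have b6 : m ≤ 2 * (r+2) := by rw [hm]; linarith
    nlinarith
  have hE := Real.exp_pos (2 * (r+2)^(3/2:ℝ))
  calc _ ≤ _ := h3
    _ ≤ _ := h4
    _ ≤ (2 * Real.exp (2 * (r+2)^(3/2:ℝ))) * (C * Real.exp (2 * (r+2)^(3/2:ℝ))) := by gcongr
    _ = 2 * C * Real.exp (4 * (r+2)^(3/2:ℝ)) := by
      rw [show 4 * (r+2)^(3/2:ℝ) = 2 * (r+2)^(3/2:ℝ) + 2 * (r+2)^(3/2:ℝ) by ring, Real.exp_add]; ring
    _ ≤ _ := by gcongr; linarith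

end G2RH


namespace G2RH
open Complex Filter Topology Bornology

lemma X_cmp_lt {a : ℝ} (ha : 1/2 < a) {v : ℂ} (hv : 1/2 ≤ v.re) : ‖X (v - a)‖ ≤ ‖X (v + a)‖ := by
  set f : ℂ → ℂ := fun z => X (1/2 + (z - a)) / X (1/2 + (z + a)) with hf
  have hne : ∀ z : ℂ, 0 ≤ z.re → X (1/2 + (z + a)) ≠ 0 := fun z hz =>
    X_ne_zero (by simp; linarith)
  have key : ∀ z : ℂ, 0 ≤ z.re → ‖f z‖ ≤ 1 := by
    intro z hz
    refine PhragmenLindelof.right_half_plane_of_bounded_on_real (f := f) ?_ ?_ ?_ ?_ hz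
    · refine DifferentiableOn.diffContOnCl fun w hw => ?_
      have hcl : closure {z : ℂ | 0 < z.re} = {z : ℂ | 0 ≤ z.re} := by
        have := closure_preimage_re (Set.Ioi (0:ℝ))
        rw [closure_Ioi] at this
        exact this
      rw [hcl] at hw
      have d1 := (X_diff (1/2 + (w - a))).comp w
        (show DifferentiableAt ℂ (fun z : ℂ => 1/2 + (z - a)) w by fun_prop)
      have d2 := (X_diff (1/2 + (w + a))).comp w
        (show DifferentiableAt ℂ (fun z : ℂ => 1/2 + (z + a)) w by fun_prop)
      exact (d1.div d2 (hne w hw)).differentiableWithinAt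
    · obtain ⟨C1, hC1, h1⟩ := X_upper
      obtain ⟨C2, hC2, h2⟩ := X_lower (show 1 < 1/2 + a by linarith)
      refine ⟨3/2, by norm_num, 4 * (a+3)^(3/2:ℝ) + 3 * (a+3), ?_⟩
      refine Asymptotics.IsBigO.of_bound (C1 * C2) ?_
      rw [eventually_inf_principal]
      have hb : ∀ᶠ z : ℂ in cobounded ℂ, 1 ≤ ‖z‖ :=
        tendsto_norm_cobounded_atTop.eventually (eventually_ge_atTop 1)
      filter_upwards [hb] with w hw1 hw0
      have hw0' : 0 ≤ w.re := le_of_lt hw0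
      have u := h1 (w - a)
      have l := h2 (1/2 + (w + a)) (by simp; linarith)
      have hX := norm_pos_iff.2 (hne w hw0')
      rw [hf]; simp only
      rw [norm_div, div_le_iff₀ hX, Real.norm_eq_abs, abs_of_pos (Real.exp_pos _)]
      have na : ‖(a:ℂ)‖ = a := by rw [norm_real, Real.norm_eq_abs, abs_of_nonneg (by linarith)]
      have b1 : ‖w - a‖ + 2 ≤ (a+3) * ‖w‖ := by
        have := norm_sub_le w a
        rw [na] at this
        nlinarith
      have b2 : ‖(1/2:ℂ) + (w + a)‖ ≤ (a + 3) * ‖w‖ := by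
        have t1 := norm_add_le (1/2:ℂ) (w + a)
        have t2 := norm_add_le w a
        have t3 : ‖(1/2:ℂ)‖ = 1/2 := by norm_num
        rw [na] at t2
        rw [t3] at t1
        nlinarith
      have b3 : (‖w - a‖ + 2)^(3/2:ℝ) ≤ (a+3)^(3/2:ℝ) * ‖w‖^(3/2:ℝ) := by
        rw [← Real.mul_rpow (by linarith) (norm_nonneg _)]
        exact Real.rpow_le_rpow (by positivity) b1 (by norm_num)
      have b4 : ‖w‖ ≤ ‖w‖^(3/2:ℝ) := by
        conv_lhs => rw [← Real.rpow_one ‖w‖]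
        exact Real.rpow_le_rpow_of_exponent_le hw1 (by norm_num)
      have b5 : 4 * (‖w - a‖ + 2)^(3/2:ℝ) + 3 * ‖(1/2:ℂ) + (w + a)‖ ≤
          (4 * (a+3)^(3/2:ℝ) + 3 * (a+3)) * ‖w‖^(3/2:ℝ) := by
        nlinarith
      have b6 := Real.exp_le_exp.2 b5
      rw [Real.exp_add] at b6
      calc ‖X (1/2 + (w - a))‖ ≤ C1 * Real.exp (4 * (‖w - a‖ + 2) ^ (3/2 : ℝ)) * 1 := by
            rw [mul_one]; exact u
        _ ≤ C1 * Real.exp (4 * (‖w - a‖ + 2) ^ (3/2 : ℝ)) *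
            (C2 * Real.exp (3 * ‖(1/2:ℂ) + (w + a)‖) * ‖X (1/2 + (w + a))‖) := by gcongr
        _ = C1 * C2 * (Real.exp (4 * (‖w - a‖ + 2) ^ (3/2 : ℝ)) *
            Real.exp (3 * ‖(1/2:ℂ) + (w + a)‖)) * ‖X (1/2 + (w + a))‖ := by ring
        _ ≤ _ := by gcongr
    · refine ⟨1, ?_⟩
      rw [eventually_map]
      filter_upwards [eventually_ge_atTop (a+1)] with x hx
      have e1 : X (1/2 + ((x:ℂ) - a)) = (Xr (1/2 + (x - a)) : ℂ) := by
        rw [← X_ofReal]; push_cast; rfl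
      have e2 : X (1/2 + ((x:ℂ) + a)) = (Xr (1/2 + (x + a)) : ℂ) := by
        rw [← X_ofReal]; push_cast; rfl
      rw [hf]; simp only
      rw [e1, e2, ← ofReal_div, norm_real, Real.norm_eq_abs]
      have p1 := Xr_pos (show 1 ≤ 1/2 + (x - a) by linarith)
      have p2 := Xr_mono (show 1 ≤ 1/2 + (x - a) by linarith)
        (show 1/2 + (x - a) ≤ 1/2 + (x + a) by linarith)
      rw [abs_of_nonneg (div_nonneg (by linarith) (by linarith)), div_le_one (by linarith)]
      exact p2
    · intro x
      rw [hf]; simp only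
      have : X (1/2 + ((x:ℂ) * I - a)) = (starRingEnd ℂ) (X (1/2 + ((x:ℂ) * I + a))) := by
        rw [← X_conj, ← X_one_sub]
        congr 1
        simp [Complex.conj_ofNat]; ring
      rw [this, norm_div, RCLike.norm_conj]
      exact div_self_le_one _
  have := key (v - 1/2) (by simp; linarith)
  rw [hf] at this; simp only at this
  rw [show (1:ℂ)/2 + (v - 1/2 - a) = v - a by ring, show (1:ℂ)/2 + (v - 1/2 + a) = v + a by ring,
    norm_div] at this
  have hX := norm_pos_iff.2 (X_ne_zero (show 1 ≤ (v + a).re by simp; linarith))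
  rwa [div_le_one hX] at this

lemma X_cmp {a : ℝ} (ha : 1/2 ≤ a) {v : ℂ} (hv : 1/2 ≤ v.re) : ‖X (v - a)‖ ≤ ‖X (v + a)‖ := by
  have hX := X_diff.continuous
  have t1 : Tendsto (fun b : ℝ => ‖X (v - b)‖) (𝓝[>] a) (𝓝 ‖X (v - a)‖) :=
    ((show Continuous fun b : ℝ => ‖X (v - b)‖ by fun_prop).tendsto a).mono_left nhdsWithin_le_nhds
  have t2 : Tendsto (fun b : ℝ => ‖X (v + b)‖) (𝓝[>] a) (𝓝 ‖X (v + a)‖) :=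
    ((show Continuous fun b : ℝ => ‖X (v + b)‖ by fun_prop).tendsto a).mono_left nhdsWithin_le_nhds
  refine le_of_tendsto_of_tendsto t1 t2 ?_
  filter_upwards [self_mem_nhdsWithin] with b hb
  exact X_cmp_lt (lt_of_le_of_lt ha hb) hv

end G2RH


namespace G2RH
open Complex Filter Topology Bornology

/-! ### Schwarz–Pick -/

lemma mob_disc {A B C D f φ : ℂ} (h : 0 < normSq D - normSq C) (hφ : ‖φ‖ ≤ 1)
    (hf : f * (D + C * φ) = B + A * φ) :
    ‖f * ((normSq D - normSq C : ℝ) : ℂ) - (B * (starRingEnd ℂ) D - A * (starRingEnd ℂ) C)‖ ≤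
      ‖A * D - B * C‖ := by
  have hφ2 : normSq φ ≤ 1 := by
    rw [normSq_eq_norm_sq]; nlinarith [norm_nonneg φ]
  have e1 : normSq (D + C * φ) - normSq (φ * (starRingEnd ℂ) D + (starRingEnd ℂ) C) =
      (normSq D - normSq C) * (1 - normSq φ) := by
    simp only [normSq_apply, add_re, add_im, mul_re, mul_im, conj_re, conj_im]; ring
  have e2 : normSq (φ * (starRingEnd ℂ) D + (starRingEnd ℂ) C) ≤ normSq (D + C * φ) := by
    nlinarith [mul_nonneg h.le (sub_nonneg.2 hφ2)]
  have e3 : ‖φ * (starRingEnd ℂ) D + (starRingEnd ℂ) C‖ ≤ ‖D + C * φ‖ := by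
    refine le_of_sq_le_sq ?_ (norm_nonneg _)
    rwa [← normSq_eq_norm_sq, ← normSq_eq_norm_sq]
  have hne : D + C * φ ≠ 0 := by
    intro h0
    have h1 : D = -(C * φ) := by linear_combination h0
    have h2 : normSq D = normSq C * normSq φ := by rw [h1, normSq_neg, normSq_mul]
    nlinarith [normSq_nonneg C, mul_nonneg (normSq_nonneg C) (sub_nonneg.2 hφ2)]
  have e4 : (f * ((normSq D - normSq C : ℝ) : ℂ) -
      (B * (starRingEnd ℂ) D - A * (starRingEnd ℂ) C)) * (D + C * φ) =
      (A * D - B * C) * (φ * (starRingEnd ℂ) D + (starRingEnd ℂ) C) := by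
    push_cast
    rw [← mul_conj D, ← mul_conj C]
    linear_combination (D * (starRingEnd ℂ) D - C * (starRingEnd ℂ) C) * hf
  have e5 := congrArg norm e4
  rw [norm_mul, norm_mul] at e5
  have hp := norm_pos_iff.2 hne
  refine le_of_mul_le_mul_right ?_ hp
  rw [e5]
  exact mul_le_mul_of_nonneg_left e3 (norm_nonneg _)

lemma moeb_le {g : ℝ} (hg : |g| < 1) {f : ℂ} (hf : ‖f‖ ≤ 1) :
    1 - (g:ℂ) * f ≠ 0 ∧ ‖(f - g) / (1 - (g:ℂ) * f)‖ ≤ 1 := by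
  have hne : 1 - (g:ℂ) * f ≠ 0 := by
    intro h
    have : (g:ℂ) * f = 1 := by linear_combination -h
    have := congrArg norm this
    rw [norm_mul, norm_one, norm_real, Real.norm_eq_abs] at this
    nlinarith [norm_nonneg f, abs_nonneg g]
  refine ⟨hne, ?_⟩
  rw [norm_div, div_le_one (norm_pos_iff.2 hne)]
  refine le_of_sq_le_sq ?_ (norm_nonneg _)
  rw [← normSq_eq_norm_sq, ← normSq_eq_norm_sq]
  have hf2 : normSq f ≤ 1 := by rw [normSq_eq_norm_sq]; nlinarith [norm_nonneg f]
  have hg2 : g^2 < 1 := by rw [← sq_abs]; nlinarith [abs_nonneg g]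
  rw [normSq_apply] at *
  simp [normSq_apply]
  nlinarith [mul_nonneg (sub_nonneg.2 hf2) (sub_nonneg.2 hg2.le)]

/-- One Schur step in a right half plane. -/
lemma schur_step {e x g : ℝ} (hx : e < x) {f : ℂ → ℂ} (hd : DifferentiableOn ℂ f {s | e < s.re})
    (hb : ∀ s : ℂ, e < s.re → ‖f s‖ ≤ 1) (hfx : f x = g) (hg : |g| < 1) :
    ∃ f1 : ℂ → ℂ, DifferentiableOn ℂ f1 {s | e < s.re} ∧ (∀ s : ℂ, e < s.re → ‖f1 s‖ ≤ 1) ∧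
      ∀ s : ℂ, e < s.re → (f s - g) * (s + x - 2 * e) = (s - x) * f1 s * (1 - g * f s) := by
  set h : ℂ → ℂ := fun s => (f s - g) / (1 - (g:ℂ) * f s) with hh
  set ψ : ℂ → ℂ := fun z => (x + z * (x - 2 * e)) / (1 - z) with hψ
  set b : ℂ → ℂ := fun s => (s - x) / (s + x - 2 * e) with hbdef
  have hψre : ∀ z ∈ Metric.ball (0:ℂ) 1, e < (ψ z).re ∧ 1 - z ≠ 0 := by
    intro z hz
    rw [mem_ball_zero_iff] at hz
    have hz1 : 1 - z ≠ 0 := by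
      intro h0
      have : z = 1 := by linear_combination -h0
      rw [this] at hz; norm_num at hz
    refine ⟨?_, hz1⟩
    have e1 : ψ z = e + (x - e) * ((1 + z) / (1 - z)) := by
      rw [hψ]; field_simp; ring
    have e2 : 0 < ((1 + z) / (1 - z)).re := by
      rw [div_re]
      have hn : 0 < normSq (1 - z) := normSq_pos.2 hz1
      have : normSq z < 1 := by rw [normSq_eq_norm_sq]; nlinarith [norm_nonneg z]
      rw [← add_div]
      refine div_pos ?_ hn
      rw [normSq_apply] at this
      simp; nlinarith
    rw [e1]
    have : ((x:ℂ) - e) * ((1 + z) / (1 - z)) = ((x - e : ℝ) : ℂ) * ((1 + z) / (1 - z)) := by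
      push_cast; ring
    rw [add_re, this, re_ofReal_mul, ofReal_re]
    have := mul_pos (sub_pos.2 hx) e2
    linarith
  have hbb : ∀ s : ℂ, e < s.re → b s ∈ Metric.ball (0:ℂ) 1 ∧ s + x - 2 * e ≠ 0 := by
    intro s hs
    have hn : s + x - 2 * e ≠ 0 := by
      intro h0
      have := congrArg re h0
      simp at this; linarith
    refine ⟨?_, hn⟩
    rw [mem_ball_zero_iff, hbdef]; simp only
    rw [norm_div, div_lt_one (norm_pos_iff.2 hn)]
    refine lt_of_pow_lt_pow_left₀ 2 (norm_nonneg _) ?_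
    rw [← normSq_eq_norm_sq, ← normSq_eq_norm_sq]
    simp [normSq_apply]
    nlinarith
  have hhd : DifferentiableOn ℂ h {s | e < s.re} := by
    refine DifferentiableOn.div (hd.sub_const _) ((differentiableOn_const 1).sub (hd.const_mul _)) ?_
    intro s hs
    exact (moeb_le hg (hb s hs)).1
  have hψd : DifferentiableOn ℂ ψ (Metric.ball 0 1) := by
    refine DifferentiableOn.div (by fun_prop) (by fun_prop) fun z hz => (hψre z hz).2
  set H : ℂ → ℂ := fun z => h (ψ z) with hH
  have hHd : DifferentiableOn ℂ H (Metric.ball 0 1) :=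
    hhd.comp hψd fun z hz => (hψre z hz).1
  have hψ0 : ψ 0 = x := by simp [hψ]
  have hH0 : H 0 = 0 := by rw [hH]; simp only; rw [hψ0, hh]; simp [hfx]
  have hmaps : Set.MapsTo H (Metric.ball 0 1) (Metric.closedBall (H 0) 1) := by
    intro z hz
    rw [hH0, mem_closedBall_zero_iff]
    exact (moeb_le hg (hb _ (hψre z hz).1)).2
  refine ⟨fun s => dslope H 0 (b s), ?_, ?_, ?_⟩
  · have d1 : DifferentiableOn ℂ (dslope H 0) (Metric.ball 0 1) :=
      (Complex.differentiableOn_dslope (Metric.ball_mem_nhds 0 one_pos)).2 hHd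
    refine d1.comp (DifferentiableOn.div (by fun_prop) (by fun_prop) fun s hs => (hbb s hs).2)
      fun s hs => (hbb s hs).1
  · intro s hs
    have := Complex.norm_dslope_le_div_of_mapsTo_ball hHd hmaps (hbb s hs).1
    simpa using this
  · intro s hs
    have hn := (hbb s hs).2
    have hψb : ψ (b s) = s := by
      have hx2 : (x:ℂ) - e ≠ 0 := by exact_mod_cast (sub_pos.2 hx).ne'
      have h1 : 1 - b s ≠ 0 := (hψre _ (hbb s hs).1).2
      rw [hψ]; simp only
      rw [div_eq_iff h1, hbdef]; simp only
      field_simp; ring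
    have h1 : b s * dslope H 0 (b s) = h s := by
      have := sub_smul_dslope H 0 (b s)
      rw [hH0, sub_zero, sub_zero, smul_eq_mul] at this
      rw [this, hH]; simp only; rw [hψb]
    have h2 := (moeb_le hg (hb s hs)).1
    have h3 : (f s - g) = h s * (1 - g * f s) := by
      rw [hh]; simp only; exact (div_mul_cancel₀ _ h2).symm
    have h4 : (s - x) = b s * (s + x - 2 * e) := by
      rw [hbdef]; simp only; field_simp
    rw [h3, h4, ← h1]; ring

/-- The disc coming from two interpolation points. -/
lemma np_disc {e x y g g2 h : ℝ} (hx : e < x) (hy : e < y) {f : ℂ → ℂ}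
    (hd : DifferentiableOn ℂ f {s | e < s.re})
    (hb : ∀ s : ℂ, e < s.re → ‖f s‖ ≤ 1) (hfx : f x = g) (hg : |g| < 1) (hfy : f y = g2)
    (hh : (g2 - g) * (y + x - 2 * e) = (y - x) * h * (1 - g * g2)) (hh1 : |h| < 1) (hxy : x ≠ y)
    {s : ℂ} (hs : e < s.re) {A B C D n0 n1 b0 b1 : ℂ}
    (hn0 : n0 = s - x) (hn1 : n1 = s - y) (hb0 : b0 = s + x - 2 * e) (hb1 : b1 = s + y - 2 * e)
    (hD : D = b1 * (b0 + g * h * n0)) (hB : B = b1 * (g * b0 + h * n0))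
    (hA : A = n1 * (g * h * b0 + n0)) (hC : C = n1 * (h * b0 + g * n0))
    (hM : 0 < normSq D - normSq C) :
    ‖f s * ((normSq D - normSq C : ℝ) : ℂ) - (B * (starRingEnd ℂ) D - A * (starRingEnd ℂ) C)‖ ≤
      (1 - g^2) * (1 - h^2) * ‖n0 * n1 * b0 * b1‖ := by
  obtain ⟨f1, hd1, hb1', hf1⟩ := schur_step hx hd hb hfx hg
  have hgg : (1:ℂ) - g * g2 ≠ 0 := by
    have := (moeb_le hg (hb (y:ℂ) (by simpa using hy))).1
    rwa [hfy] at this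
  have hf1y : f1 y = h := by
    have h1 := hf1 y (by simpa using hy)
    rw [hfy] at h1
    have h2 : ((g2:ℂ) - g) * (y + x - 2 * e) = (y - x) * h * (1 - g * g2) := by exact_mod_cast hh
    rw [h2] at h1
    have h3 : (y:ℂ) - x ≠ 0 := by
      exact_mod_cast sub_ne_zero.2 (Ne.symm hxy)
    have h4 := mul_right_cancel₀ hgg h1
    exact (mul_left_cancel₀ h3 h4).symm
  obtain ⟨φ, hdφ, hbφ, hφ⟩ := schur_step hy hd1 hb1' hf1y hh1
  have e1 := hf1 s hs
  have e2 := hφ s hs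
  rw [← hn0, ← hb0] at e1
  rw [← hn1, ← hb1] at e2
  have hne : b1 + h * n1 * φ s ≠ 0 := by
    intro h0
    have hbn : normSq n1 < normSq b1 := by
      rw [hn1, hb1]; simp [normSq_apply]; nlinarith
    have h5 : b1 = -(h * n1 * φ s) := by linear_combination h0
    have h6 : ‖b1‖ ≤ ‖n1‖ := by
      rw [h5, norm_neg, norm_mul, norm_mul, norm_real, Real.norm_eq_abs]
      have := hbφ s hs
      calc |h| * ‖n1‖ * ‖φ s‖ ≤ 1 * ‖n1‖ * 1 := by gcongr
        _ = _ := by ring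
    rw [normSq_eq_norm_sq, normSq_eq_norm_sq] at hbn
    nlinarith [norm_nonneg b1]
  have e3 : f1 s * (b1 + h * n1 * φ s) = h * b1 + n1 * φ s := by linear_combination e2
  have key : f s * (D + C * φ s) = B + A * φ s := by
    rw [hD, hC, hB, hA]
    linear_combination (b1 + h * n1 * φ s) * e1 + n0 * (1 - g * f s) * e3
  have := mob_disc hM (hbφ s hs) key
  refine this.trans (le_of_eq ?_)
  have e4 : A * D - B * C = (((1 - g^2) * (1 - h^2) : ℝ) : ℂ) * (n0 * n1 * b0 * b1) := by
    rw [hA, hB, hC, hD]; push_cast; ring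
  rw [e4, norm_mul, norm_real, Real.norm_eq_abs, abs_of_nonneg]
  have hg2 : g^2 < 1 := by rw [← sq_abs]; nlinarith [abs_nonneg g]
  have hh2 : h^2 < 1 := by rw [← sq_abs]; nlinarith [abs_nonneg h]
  exact mul_nonneg (by linarith) (by linarith)

end G2RH


namespace G2RH
open Complex Filter Topology

/-! ### Numerical values -/

lemma evr_nd (j : ℕ) : evr lam (nd j) = Real.pi ^ (j+1) *
    ((-1)^(j+2) * 2^(2*j+1) * (bernoulli (2*j+2) : ℝ) * j.factorial / (2*j+2).factorial)
    + 1/(2*j+2) - 1/(2*j+1) := by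
  have h1 := Lam0_evc (((2*j+3/2 : ℝ)) : ℂ)
  rw [show (((2*j+3/2 : ℝ)) : ℂ)^2 = ((nd j : ℝ) : ℂ) by unfold nd; push_cast; rfl,
    evc_ofReal] at h1
  have h2 : (1:ℂ)/2 + ((2*j+3/2 : ℝ) : ℂ) = 2 * ((j+1 : ℕ) : ℂ) := by push_cast; ring
  rw [h2] at h1
  set w : ℂ := 2 * ((j+1 : ℕ) : ℂ) with hw
  have h3 := completedRiemannZeta_eq w
  have w0 : w ≠ 0 := by
    rw [hw]; exact mul_ne_zero two_ne_zero (by exact_mod_cast Nat.succ_ne_zero j)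
  have h4 := riemannZeta_two_mul_nat (k := j+1) (Nat.succ_ne_zero j)
  rw [← hw, riemannZeta_def_of_ne_zero w0, Gammaℝ_def] at h4
  have h5 : Gamma (w/2) = (j.factorial : ℂ) := by
    rw [hw, mul_div_cancel_left₀ _ (two_ne_zero)]
    push_cast
    exact Gamma_nat_eq_factorial j
  have hpi : (Real.pi : ℂ) ≠ 0 := by exact_mod_cast Real.pi_ne_zero
  have h6 : (Real.pi : ℂ) ^ (-w/2) = ((Real.pi : ℂ)^(j+1))⁻¹ := by
    rw [hw, show -(2 * ((j+1 : ℕ) : ℂ))/2 = -((j+1 : ℕ) : ℂ) by ring, cpow_neg, cpow_natCast]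
  rw [h5, h6] at h4
  have hf : (j.factorial : ℂ) ≠ 0 := by exact_mod_cast Nat.factorial_ne_zero j
  have hf2 : ((2*j+2).factorial : ℂ) ≠ 0 := by exact_mod_cast Nat.factorial_ne_zero _
  have h7 : completedRiemannZeta w = (Real.pi:ℂ) ^ (j+1) *
    ((-1)^(j+2) * 2^(2*j+1) * (bernoulli (2*j+2) : ℂ) * j.factorial / (2*j+2).factorial) := by
    rw [div_eq_iff (mul_ne_zero (inv_ne_zero (pow_ne_zero _ hpi)) hf)] at h4
    rw [h4, show 2 * (j+1) - 1 = 2*j+1 by omega, show 2 * (j+1) = 2*j+2 by ring]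
    have : (Real.pi:ℂ)^(2*j+2) = (Real.pi:ℂ)^(j+1) * (Real.pi:ℂ)^(j+1) := by ring
    rw [this]
    field_simp
  have h8 : completedRiemannZeta₀ w = completedRiemannZeta w + 1/w + 1/(1-w) := by rw [h3]; ring
  rw [h1, h7] at h8
  have h9 : (1:ℂ)/(1-w) = -(1/(2*j+1)) := by
    rw [hw]; push_cast
    rw [show (1:ℂ) - 2 * (j+1) = -(2*j+1) by ring, div_neg]
  have h10 : (1:ℂ)/w = 1/(2*j+2) := by rw [hw]; push_cast; congr 1; ring
  rw [h9, h10] at h8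
  have : ((evr lam (nd j) : ℝ) : ℂ) = ((Real.pi ^ (j+1) *
    ((-1)^(j+2) * 2^(2*j+1) * (bernoulli (2*j+2) : ℝ) * j.factorial / (2*j+2).factorial)
    + 1/(2*j+2) - 1/(2*j+1) : ℝ) : ℂ) := by
    rw [h8]; push_cast; ring
  exact_mod_cast this

end G2RH


namespace G2RH
open Complex Filter Topology

lemma newt (x : ℝ) (n : ℕ) : evr lam x =
    ∑ i ∈ Finset.range n, dc i * ∏ l ∈ Finset.range i, (x - nd l) +
      (∏ l ∈ Finset.range n, (x - nd l)) * evr (cs n) x := by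
  induction n with
  | zero => simp [cs]
  | succ n ih =>
    rw [ih, Finset.sum_range_succ, Finset.prod_range_succ, cs_stepR n x]; ring

lemma newt_nd (n : ℕ) : evr lam (nd n) =
    ∑ i ∈ Finset.range (n+1), dc i * ∏ l ∈ Finset.range i, (nd n - nd l) := by
  rw [newt (nd n) n, Finset.sum_range_succ]
  change _ + _ * dc n = _
  ring

lemma bn2 : bernoulli 2 = 1/6 := by rw [bernoulli_two]; norm_num

lemma bn4 : bernoulli 4 = -1/30 := by
  have h := sum_bernoulli 5
  simp only [Finset.sum_range_succ, Finset.sum_range_zero, bernoulli_zero, bernoulli_one, bn2,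
    bernoulli_eq_zero_of_odd (n := 3) (by decide) (by norm_num)] at h
  norm_num [Nat.choose] at h
  linarith

lemma bn6 : bernoulli 6 = 1/42 := by
  have h := sum_bernoulli 7
  simp only [Finset.sum_range_succ, Finset.sum_range_zero, bernoulli_zero, bernoulli_one, bn2, bn4,
    bernoulli_eq_zero_of_odd (n := 3) (by decide) (by norm_num),
    bernoulli_eq_zero_of_odd (n := 5) (by decide) (by norm_num)] at h
  norm_num [Nat.choose] at h
  linarith

lemma bn8 : bernoulli 8 = -1/30 := by
  have h := sum_bernoulli 9
  simp only [Finset.sum_range_succ, Finset.sum_range_zero, bernoulli_zero, bernoulli_one, bn2, bn4, bn6,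
    bernoulli_eq_zero_of_odd (n := 3) (by decide) (by norm_num),
    bernoulli_eq_zero_of_odd (n := 5) (by decide) (by norm_num),
    bernoulli_eq_zero_of_odd (n := 7) (by decide) (by norm_num)] at h
  norm_num [Nat.choose] at h
  linarith

lemma bn10 : bernoulli 10 = 5/66 := by
  have h := sum_bernoulli 11
  simp only [Finset.sum_range_succ, Finset.sum_range_zero, bernoulli_zero, bernoulli_one, bn2, bn4, bn6, bn8,
    bernoulli_eq_zero_of_odd (n := 3) (by decide) (by norm_num),
    bernoulli_eq_zero_of_odd (n := 5) (by decide) (by norm_num),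
    bernoulli_eq_zero_of_odd (n := 7) (by decide) (by norm_num),
    bernoulli_eq_zero_of_odd (n := 9) (by decide) (by norm_num)] at h
  norm_num [Nat.choose] at h
  linarith

lemma bn12 : bernoulli 12 = -691/2730 := by
  have h := sum_bernoulli 13
  simp only [Finset.sum_range_succ, Finset.sum_range_zero, bernoulli_zero, bernoulli_one, bn2, bn4, bn6, bn8, bn10,
    bernoulli_eq_zero_of_odd (n := 3) (by decide) (by norm_num),
    bernoulli_eq_zero_of_odd (n := 5) (by decide) (by norm_num),
    bernoulli_eq_zero_of_odd (n := 7) (by decide) (by norm_num),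
    bernoulli_eq_zero_of_odd (n := 9) (by decide) (by norm_num),
    bernoulli_eq_zero_of_odd (n := 11) (by decide) (by norm_num)] at h
  norm_num [Nat.choose] at h
  linarith

lemma bn14 : bernoulli 14 = 7/6 := by
  have h := sum_bernoulli 15
  simp only [Finset.sum_range_succ, Finset.sum_range_zero, bernoulli_zero, bernoulli_one, bn2, bn4, bn6, bn8, bn10, bn12,
    bernoulli_eq_zero_of_odd (n := 3) (by decide) (by norm_num),
    bernoulli_eq_zero_of_odd (n := 5) (by decide) (by norm_num),
    bernoulli_eq_zero_of_odd (n := 7) (by decide) (by norm_num),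
    bernoulli_eq_zero_of_odd (n := 9) (by decide) (by norm_num),
    bernoulli_eq_zero_of_odd (n := 11) (by decide) (by norm_num),
    bernoulli_eq_zero_of_odd (n := 13) (by decide) (by norm_num)] at h
  norm_num [Nat.choose] at h
  linarith

lemma bn16 : bernoulli 16 = -3617/510 := by
  have h := sum_bernoulli 17
  simp only [Finset.sum_range_succ, Finset.sum_range_zero, bernoulli_zero, bernoulli_one, bn2, bn4, bn6, bn8, bn10, bn12, bn14,
    bernoulli_eq_zero_of_odd (n := 3) (by decide) (by norm_num),
    bernoulli_eq_zero_of_odd (n := 5) (by decide) (by norm_num),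
    bernoulli_eq_zero_of_odd (n := 7) (by decide) (by norm_num),
    bernoulli_eq_zero_of_odd (n := 9) (by decide) (by norm_num),
    bernoulli_eq_zero_of_odd (n := 11) (by decide) (by norm_num),
    bernoulli_eq_zero_of_odd (n := 13) (by decide) (by norm_num),
    bernoulli_eq_zero_of_odd (n := 15) (by decide) (by norm_num)] at h
  norm_num [Nat.choose] at h
  linarith

lemma bn18 : bernoulli 18 = 43867/798 := by
  have h := sum_bernoulli 19
  simp only [Finset.sum_range_succ, Finset.sum_range_zero, bernoulli_zero, bernoulli_one, bn2, bn4, bn6, bn8, bn10, bn12, bn14, bn16,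
    bernoulli_eq_zero_of_odd (n := 3) (by decide) (by norm_num),
    bernoulli_eq_zero_of_odd (n := 5) (by decide) (by norm_num),
    bernoulli_eq_zero_of_odd (n := 7) (by decide) (by norm_num),
    bernoulli_eq_zero_of_odd (n := 9) (by decide) (by norm_num),
    bernoulli_eq_zero_of_odd (n := 11) (by decide) (by norm_num),
    bernoulli_eq_zero_of_odd (n := 13) (by decide) (by norm_num),
    bernoulli_eq_zero_of_odd (n := 15) (by decide) (by norm_num),
    bernoulli_eq_zero_of_odd (n := 17) (by decide) (by norm_num)] at h
  norm_num [Nat.choose] at h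
  linarith

lemma bn20 : bernoulli 20 = -174611/330 := by
  have h := sum_bernoulli 21
  simp only [Finset.sum_range_succ, Finset.sum_range_zero, bernoulli_zero, bernoulli_one, bn2, bn4, bn6, bn8, bn10, bn12, bn14, bn16, bn18,
    bernoulli_eq_zero_of_odd (n := 3) (by decide) (by norm_num),
    bernoulli_eq_zero_of_odd (n := 5) (by decide) (by norm_num),
    bernoulli_eq_zero_of_odd (n := 7) (by decide) (by norm_num),
    bernoulli_eq_zero_of_odd (n := 9) (by decide) (by norm_num),
    bernoulli_eq_zero_of_odd (n := 11) (by decide) (by norm_num),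
    bernoulli_eq_zero_of_odd (n := 13) (by decide) (by norm_num),
    bernoulli_eq_zero_of_odd (n := 15) (by decide) (by norm_num),
    bernoulli_eq_zero_of_odd (n := 17) (by decide) (by norm_num),
    bernoulli_eq_zero_of_odd (n := 19) (by decide) (by norm_num)] at h
  norm_num [Nat.choose] at h
  linarith

lemma bn22 : bernoulli 22 = 854513/138 := by
  have h := sum_bernoulli 23
  simp only [Finset.sum_range_succ, Finset.sum_range_zero, bernoulli_zero, bernoulli_one, bn2, bn4, bn6, bn8, bn10, bn12, bn14, bn16, bn18, bn20,
    bernoulli_eq_zero_of_odd (n := 3) (by decide) (by norm_num),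
    bernoulli_eq_zero_of_odd (n := 5) (by decide) (by norm_num),
    bernoulli_eq_zero_of_odd (n := 7) (by decide) (by norm_num),
    bernoulli_eq_zero_of_odd (n := 9) (by decide) (by norm_num),
    bernoulli_eq_zero_of_odd (n := 11) (by decide) (by norm_num),
    bernoulli_eq_zero_of_odd (n := 13) (by decide) (by norm_num),
    bernoulli_eq_zero_of_odd (n := 15) (by decide) (by norm_num),
    bernoulli_eq_zero_of_odd (n := 17) (by decide) (by norm_num),
    bernoulli_eq_zero_of_odd (n := 19) (by decide) (by norm_num),
    bernoulli_eq_zero_of_odd (n := 21) (by decide) (by norm_num)] at h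
  norm_num [Nat.choose] at h
  linarith

lemma pi_pow_bd (k : ℕ) : (3.14159265358979323846:ℝ)^k ≤ Real.pi^k ∧
    Real.pi^k ≤ (3.14159265358979323847:ℝ)^k :=
  ⟨pow_le_pow_left₀ (by norm_num) Real.pi_gt_d20.le k,
    pow_le_pow_left₀ Real.pi_pos.le Real.pi_lt_d20.le k⟩

lemma Lv0 : evr lam (nd 0) = 1/6 * Real.pi^1 - 1/2 := by
  rw [evr_nd]
  rw [show 2*0+2 = 2 by norm_num, bn2]
  norm_num [Nat.factorial]; ring

lemma Lv1 : evr lam (nd 1) = 1/90 * Real.pi^2 - 1/12 := by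
  rw [evr_nd]
  rw [show 2*1+2 = 4 by norm_num, bn4]
  norm_num [Nat.factorial]; ring

lemma Lv2 : evr lam (nd 2) = 2/945 * Real.pi^3 - 1/30 := by
  rw [evr_nd]
  rw [show 2*2+2 = 6 by norm_num, bn6]
  norm_num [Nat.factorial]; ring

lemma Lv3 : evr lam (nd 3) = 1/1575 * Real.pi^4 - 1/56 := by
  rw [evr_nd]
  rw [show 2*3+2 = 8 by norm_num, bn8]
  norm_num [Nat.factorial]; ring

lemma Lv4 : evr lam (nd 4) = 8/31185 * Real.pi^5 - 1/90 := by
  rw [evr_nd]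
  rw [show 2*4+2 = 10 by norm_num, bn10]
  norm_num [Nat.factorial]; ring

lemma Lv5 : evr lam (nd 5) = 5528/42567525 * Real.pi^6 - 1/132 := by
  rw [evr_nd]
  rw [show 2*5+2 = 12 by norm_num, bn12]
  norm_num [Nat.factorial]; ring

lemma Lv6 : evr lam (nd 6) = 32/405405 * Real.pi^7 - 1/182 := by
  rw [evr_nd]
  rw [show 2*6+2 = 14 by norm_num, bn14]
  norm_num [Nat.factorial]; ring

lemma Lv7 : evr lam (nd 7) = 28936/516891375 * Real.pi^8 - 1/240 := by
  rw [evr_nd]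
  rw [show 2*7+2 = 16 by norm_num, bn16]
  norm_num [Nat.factorial]; ring

lemma Lv8 : evr lam (nd 8) = 5614976/123743795175 * Real.pi^9 - 1/306 := by
  rw [evr_nd]
  rw [show 2*8+2 = 18 by norm_num, bn18]
  norm_num [Nat.factorial]; ring

lemma Lv9 : evr lam (nd 9) = 22350208/540151486875 * Real.pi^10 - 1/380 := by
  rw [evr_nd]
  rw [show 2*9+2 = 20 by norm_num, bn20]
  norm_num [Nat.factorial]; ring

lemma Lv10 : evr lam (nd 10) = 39773696/948702429675 * Real.pi^11 - 1/462 := by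
  rw [evr_nd]
  rw [show 2*10+2 = 22 by norm_num, bn22]
  norm_num [Nat.factorial]; ring

lemma Nw0 : evr lam (nd 0) = dc 0 := by
  rw [newt_nd]
  simp only [Finset.sum_range_succ, Finset.sum_range_zero, Finset.prod_range_succ,
    Finset.prod_range_zero, nd]
  norm_num

lemma Nw1 : evr lam (nd 1) = dc 0 + dc 1 * (10) := by
  rw [newt_nd]
  simp only [Finset.sum_range_succ, Finset.sum_range_zero, Finset.prod_range_succ,
    Finset.prod_range_zero, nd]
  norm_num

lemma Nw2 : evr lam (nd 2) = dc 0 + dc 1 * (28) + dc 2 * (504) := by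
  rw [newt_nd]
  simp only [Finset.sum_range_succ, Finset.sum_range_zero, Finset.prod_range_succ,
    Finset.prod_range_zero, nd]
  norm_num

lemma Nw3 : evr lam (nd 3) = dc 0 + dc 1 * (54) + dc 2 * (2376) + dc 3 * (61776) := by
  rw [newt_nd]
  simp only [Finset.sum_range_succ, Finset.sum_range_zero, Finset.prod_range_succ,
    Finset.prod_range_zero, nd]
  norm_num

lemma Nw4 : evr lam (nd 4) = dc 0 + dc 1 * (88) + dc 2 * (6864) + dc 3 * (411840) + dc 4 * (14002560) := by
  rw [newt_nd]
  simp only [Finset.sum_range_succ, Finset.sum_range_zero, Finset.prod_range_succ,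
    Finset.prod_range_zero, nd]
  norm_num

lemma Nw5 : evr lam (nd 5) = dc 0 + dc 1 * (130) + dc 2 * (15600) + dc 3 * (1591200) + dc 4 * (120931200) + dc 5 * (5079110400) := by
  rw [newt_nd]
  simp only [Finset.sum_range_succ, Finset.sum_range_zero, Finset.prod_range_succ,
    Finset.prod_range_zero, nd]
  norm_num

lemma Nw6 : evr lam (nd 6) = dc 0 + dc 1 * (180) + dc 2 * (30600) + dc 3 * (4651200) + dc 4 * (586051200) + dc 5 * (53916710400) + dc 6 * (2695835520000) := by
  rw [newt_nd]
  simp only [Finset.sum_range_succ, Finset.sum_range_zero, Finset.prod_range_succ,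
    Finset.prod_range_zero, nd]
  norm_num

lemma Nw7 : evr lam (nd 7) = dc 0 + dc 1 * (238) + dc 2 * (54264) + dc 3 * (11395440) + dc 4 * (2096760960) + dc 5 * (314514144000) + dc 6 * (33967527552000) + dc 7 * (1970116598016000) := by
  rw [newt_nd]
  simp only [Finset.sum_range_succ, Finset.sum_range_zero, Finset.prod_range_succ,
    Finset.prod_range_zero, nd]
  norm_num

lemma Nw8 : evr lam (nd 8) = dc 0 + dc 1 * (304) + dc 2 * (89376) + dc 3 * (24667776) + dc 4 * (6166944000) + dc 5 * (1332059904000) + dc 6 * (231778423296000) + dc 7 * (28740524488704000) + dc 8 * (1896874616254464000) := by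
  rw [newt_nd]
  simp only [Finset.sum_range_succ, Finset.sum_range_zero, Finset.prod_range_succ,
    Finset.prod_range_zero, nd]
  norm_num

lemma Nw9 : evr lam (nd 9) = dc 0 + dc 1 * (378) + dc 2 * (139104) + dc 3 * (48686400) + dc 4 * (15774393600) + dc 5 * (4574574144000) + dc 6 * (1134494387712000) + dc 7 * (224629888766976000) + dc 8 * (31448184427376640000) + dc 9 * (2327165647625871360000) := by
  rw [newt_nd]
  simp only [Finset.sum_range_succ, Finset.sum_range_zero, Finset.prod_range_succ,
    Finset.prod_range_zero, nd]
  norm_num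

lemma Nw10 : evr lam (nd 10) = dc 0 + dc 1 * (460) + dc 2 * (207000) + dc 3 * (89424000) + dc 4 * (36306144000) + dc 5 * (13505885568000) + dc 6 * (4456942237440000) + dc 7 * (1247943826483200000) + dc 8 * (277043529479270400000) + dc 9 * (43218790598766182400000) + dc 10 * (3543940829098826956800000) := by
  rw [newt_nd]
  simp only [Finset.sum_range_succ, Finset.sum_range_zero, Finset.prod_range_succ,
    Finset.prod_range_zero, nd]
  norm_num

lemma dcv0 : |dc 0 * 2^180 - 36165018374287770000000000000000000000000000000000000| ≤ 3616504391588011920585203897163977383482 := by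
  rw [abs_le]
  have n0 := Nw0
  rw [Lv0] at n0
  obtain ⟨l0, u0⟩ := pi_pow_bd 1
  norm_num at n0 l0 u0
  constructor <;> norm_num <;> linarith

lemma dcv1 : |dc 1 * 2^180 - 418396138444142000000000000000000000000000000000000| ≤ 41839976248709523618204444451000326951 := by
  rw [abs_le]
  have n0 := Nw0
  rw [Lv0] at n0
  obtain ⟨l0, u0⟩ := pi_pow_bd 1
  norm_num at n0 l0 u0
  have n1 := Nw1
  rw [Lv1] at n1
  obtain ⟨l1, u1⟩ := pi_pow_bd 2
  norm_num at n1 l1 u1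
  constructor <;> norm_num <;> linarith

lemma dcv2 : |dc 2 * 2^180 - 3178062859279201000000000000000000000000000000000| ≤ 317823257131122752871017356731973733 := by
  rw [abs_le]
  have n0 := Nw0
  rw [Lv0] at n0
  obtain ⟨l0, u0⟩ := pi_pow_bd 1
  norm_num at n0 l0 u0
  have n1 := Nw1
  rw [Lv1] at n1
  obtain ⟨l1, u1⟩ := pi_pow_bd 2
  norm_num at n1 l1 u1
  have n2 := Nw2
  rw [Lv2] at n2
  obtain ⟨l2, u2⟩ := pi_pow_bd 3
  norm_num at n2 l2 u2
  constructor <;> norm_num <;> linarith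

lemma dcv3 : |dc 3 * 2^180 - 17884566219612670000000000000000000000000000000| ≤ 1788853453846798425479073710559160 := by
  rw [abs_le]
  have n0 := Nw0
  rw [Lv0] at n0
  obtain ⟨l0, u0⟩ := pi_pow_bd 1
  norm_num at n0 l0 u0
  have n1 := Nw1
  rw [Lv1] at n1
  obtain ⟨l1, u1⟩ := pi_pow_bd 2
  norm_num at n1 l1 u1
  have n2 := Nw2
  rw [Lv2] at n2
  obtain ⟨l2, u2⟩ := pi_pow_bd 3
  norm_num at n2 l2 u2
  have n3 := Nw3
  rw [Lv3] at n3
  obtain ⟨l3, u3⟩ := pi_pow_bd 4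
  norm_num at n3 l3 u3
  constructor <;> norm_num <;> linarith

lemma dcv4 : |dc 4 * 2^180 - 79708500685195470000000000000000000000000000| ≤ 7976434267235027051342248230469 := by
  rw [abs_le]
  have n0 := Nw0
  rw [Lv0] at n0
  obtain ⟨l0, u0⟩ := pi_pow_bd 1
  norm_num at n0 l0 u0
  have n1 := Nw1
  rw [Lv1] at n1
  obtain ⟨l1, u1⟩ := pi_pow_bd 2
  norm_num at n1 l1 u1
  have n2 := Nw2
  rw [Lv2] at n2
  obtain ⟨l2, u2⟩ := pi_pow_bd 3
  norm_num at n2 l2 u2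
  have n3 := Nw3
  rw [Lv3] at n3
  obtain ⟨l3, u3⟩ := pi_pow_bd 4
  norm_num at n3 l3 u3
  have n4 := Nw4
  rw [Lv4] at n4
  obtain ⟨l4, u4⟩ := pi_pow_bd 5
  norm_num at n4 l4 u4
  constructor <;> norm_num <;> linarith

lemma dcv5 : |dc 5 * 2^180 - 293542145912459500000000000000000000000000| ≤ 29406922936059295917017127364 := by
  rw [abs_le]
  have n0 := Nw0
  rw [Lv0] at n0
  obtain ⟨l0, u0⟩ := pi_pow_bd 1
  norm_num at n0 l0 u0
  have n1 := Nw1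
  rw [Lv1] at n1
  obtain ⟨l1, u1⟩ := pi_pow_bd 2
  norm_num at n1 l1 u1
  have n2 := Nw2
  rw [Lv2] at n2
  obtain ⟨l2, u2⟩ := pi_pow_bd 3
  norm_num at n2 l2 u2
  have n3 := Nw3
  rw [Lv3] at n3
  obtain ⟨l3, u3⟩ := pi_pow_bd 4
  norm_num at n3 l3 u3
  have n4 := Nw4
  rw [Lv4] at n4
  obtain ⟨l4, u4⟩ := pi_pow_bd 5
  norm_num at n4 l4 u4
  have n5 := Nw5
  rw [Lv5] at n5
  obtain ⟨l5, u5⟩ := pi_pow_bd 6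
  norm_num at n5 l5 u5
  constructor <;> norm_num <;> linarith

lemma dcv6 : |dc 6 * 2^180 - 919916523804575900000000000000000000000| ≤ 92350160559983022220452116 := by
  rw [abs_le]
  have n0 := Nw0
  rw [Lv0] at n0
  obtain ⟨l0, u0⟩ := pi_pow_bd 1
  norm_num at n0 l0 u0
  have n1 := Nw1
  rw [Lv1] at n1
  obtain ⟨l1, u1⟩ := pi_pow_bd 2
  norm_num at n1 l1 u1
  have n2 := Nw2
  rw [Lv2] at n2
  obtain ⟨l2, u2⟩ := pi_pow_bd 3
  norm_num at n2 l2 u2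
  have n3 := Nw3
  rw [Lv3] at n3
  obtain ⟨l3, u3⟩ := pi_pow_bd 4
  norm_num at n3 l3 u3
  have n4 := Nw4
  rw [Lv4] at n4
  obtain ⟨l4, u4⟩ := pi_pow_bd 5
  norm_num at n4 l4 u4
  have n5 := Nw5
  rw [Lv5] at n5
  obtain ⟨l5, u5⟩ := pi_pow_bd 6
  norm_num at n5 l5 u5
  have n6 := Nw6
  rw [Lv6] at n6
  obtain ⟨l6, u6⟩ := pi_pow_bd 7
  norm_num at n6 l6 u6
  constructor <;> norm_num <;> linarith

lemma dcv7 : |dc 7 * 2^180 - 2506784486562037000000000000000000000| ≤ 252528455252084578118051 := by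
  rw [abs_le]
  have n0 := Nw0
  rw [Lv0] at n0
  obtain ⟨l0, u0⟩ := pi_pow_bd 1
  norm_num at n0 l0 u0
  have n1 := Nw1
  rw [Lv1] at n1
  obtain ⟨l1, u1⟩ := pi_pow_bd 2
  norm_num at n1 l1 u1
  have n2 := Nw2
  rw [Lv2] at n2
  obtain ⟨l2, u2⟩ := pi_pow_bd 3
  norm_num at n2 l2 u2
  have n3 := Nw3
  rw [Lv3] at n3
  obtain ⟨l3, u3⟩ := pi_pow_bd 4
  norm_num at n3 l3 u3
  have n4 := Nw4
  rw [Lv4] at n4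
  obtain ⟨l4, u4⟩ := pi_pow_bd 5
  norm_num at n4 l4 u4
  have n5 := Nw5
  rw [Lv5] at n5
  obtain ⟨l5, u5⟩ := pi_pow_bd 6
  norm_num at n5 l5 u5
  have n6 := Nw6
  rw [Lv6] at n6
  obtain ⟨l6, u6⟩ := pi_pow_bd 7
  norm_num at n6 l6 u6
  have n7 := Nw7
  rw [Lv7] at n7
  obtain ⟨l7, u7⟩ := pi_pow_bd 8
  norm_num at n7 l7 u7
  constructor <;> norm_num <;> linarith

lemma dcv8 : |dc 8 * 2^180 - 6038874784462419000000000000000000| ≤ 611419907368217477516 := by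
  rw [abs_le]
  have n0 := Nw0
  rw [Lv0] at n0
  obtain ⟨l0, u0⟩ := pi_pow_bd 1
  norm_num at n0 l0 u0
  have n1 := Nw1
  rw [Lv1] at n1
  obtain ⟨l1, u1⟩ := pi_pow_bd 2
  norm_num at n1 l1 u1
  have n2 := Nw2
  rw [Lv2] at n2
  obtain ⟨l2, u2⟩ := pi_pow_bd 3
  norm_num at n2 l2 u2
  have n3 := Nw3
  rw [Lv3] at n3
  obtain ⟨l3, u3⟩ := pi_pow_bd 4
  norm_num at n3 l3 u3
  have n4 := Nw4
  rw [Lv4] at n4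
  obtain ⟨l4, u4⟩ := pi_pow_bd 5
  norm_num at n4 l4 u4
  have n5 := Nw5
  rw [Lv5] at n5
  obtain ⟨l5, u5⟩ := pi_pow_bd 6
  norm_num at n5 l5 u5
  have n6 := Nw6
  rw [Lv6] at n6
  obtain ⟨l6, u6⟩ := pi_pow_bd 7
  norm_num at n6 l6 u6
  have n7 := Nw7
  rw [Lv7] at n7
  obtain ⟨l7, u7⟩ := pi_pow_bd 8
  norm_num at n7 l7 u7
  have n8 := Nw8
  rw [Lv8] at n8
  obtain ⟨l8, u8⟩ := pi_pow_bd 9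
  norm_num at n8 l8 u8
  constructor <;> norm_num <;> linarith

lemma dcv9 : |dc 9 * 2^180 - 13029829050807180000000000000000| ≤ 1327950662444896171 := by
  rw [abs_le]
  have n0 := Nw0
  rw [Lv0] at n0
  obtain ⟨l0, u0⟩ := pi_pow_bd 1
  norm_num at n0 l0 u0
  have n1 := Nw1
  rw [Lv1] at n1
  obtain ⟨l1, u1⟩ := pi_pow_bd 2
  norm_num at n1 l1 u1
  have n2 := Nw2
  rw [Lv2] at n2
  obtain ⟨l2, u2⟩ := pi_pow_bd 3
  norm_num at n2 l2 u2
  have n3 := Nw3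
  rw [Lv3] at n3
  obtain ⟨l3, u3⟩ := pi_pow_bd 4
  norm_num at n3 l3 u3
  have n4 := Nw4
  rw [Lv4] at n4
  obtain ⟨l4, u4⟩ := pi_pow_bd 5
  norm_num at n4 l4 u4
  have n5 := Nw5
  rw [Lv5] at n5
  obtain ⟨l5, u5⟩ := pi_pow_bd 6
  norm_num at n5 l5 u5
  have n6 := Nw6
  rw [Lv6] at n6
  obtain ⟨l6, u6⟩ := pi_pow_bd 7
  norm_num at n6 l6 u6
  have n7 := Nw7
  rw [Lv7] at n7
  obtain ⟨l7, u7⟩ := pi_pow_bd 8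
  norm_num at n7 l7 u7
  have n8 := Nw8
  rw [Lv8] at n8
  obtain ⟨l8, u8⟩ := pi_pow_bd 9
  norm_num at n8 l8 u8
  have n9 := Nw9
  rw [Lv9] at n9
  obtain ⟨l9, u9⟩ := pi_pow_bd 10
  norm_num at n9 l9 u9
  constructor <;> norm_num <;> linarith

lemma dcv10 : |dc 10 * 2^180 - 25448402276103890000000000000| ≤ 2613986711989858 := by
  rw [abs_le]
  have n0 := Nw0
  rw [Lv0] at n0
  obtain ⟨l0, u0⟩ := pi_pow_bd 1
  norm_num at n0 l0 u0
  have n1 := Nw1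
  rw [Lv1] at n1
  obtain ⟨l1, u1⟩ := pi_pow_bd 2
  norm_num at n1 l1 u1
  have n2 := Nw2
  rw [Lv2] at n2
  obtain ⟨l2, u2⟩ := pi_pow_bd 3
  norm_num at n2 l2 u2
  have n3 := Nw3
  rw [Lv3] at n3
  obtain ⟨l3, u3⟩ := pi_pow_bd 4
  norm_num at n3 l3 u3
  have n4 := Nw4
  rw [Lv4] at n4
  obtain ⟨l4, u4⟩ := pi_pow_bd 5
  norm_num at n4 l4 u4
  have n5 := Nw5
  rw [Lv5] at n5
  obtain ⟨l5, u5⟩ := pi_pow_bd 6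
  norm_num at n5 l5 u5
  have n6 := Nw6
  rw [Lv6] at n6
  obtain ⟨l6, u6⟩ := pi_pow_bd 7
  norm_num at n6 l6 u6
  have n7 := Nw7
  rw [Lv7] at n7
  obtain ⟨l7, u7⟩ := pi_pow_bd 8
  norm_num at n7 l7 u7
  have n8 := Nw8
  rw [Lv8] at n8
  obtain ⟨l8, u8⟩ := pi_pow_bd 9
  norm_num at n8 l8 u8
  have n9 := Nw9
  rw [Lv9] at n9
  obtain ⟨l9, u9⟩ := pi_pow_bd 10
  norm_num at n9 l9 u9
  have n10 := Nw10
  rw [Lv10] at n10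
  obtain ⟨l10, u10⟩ := pi_pow_bd 11
  norm_num at n10 l10 u10
  constructor <;> norm_num <;> linarith

end G2RH


namespace G2RH
open Complex

/-! ### Taylor models -/

structure TM where
  c : List ℤ
  r : ℕ

def ladd : List ℤ → List ℤ → List ℤ
  | [], q => q
  | a :: p, [] => a :: p
  | a :: p, b :: q => Int.add a b :: ladd p q

def lsmul (a : ℤ) : List ℤ → List ℤ
  | [] => []
  | b :: q => Int.mul a b :: lsmul a q

def lmul (q : List ℤ) : List ℤ → List ℤ
  | [] => []
  | a :: p => ladd (lsmul a q) (0 :: lmul q p)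

def lneg : List ℤ → List ℤ
  | [] => []
  | b :: q => Int.neg b :: lneg q

def nrm : List ℤ → ℕ
  | [] => 0
  | a :: p => Nat.add (Int.natAbs a) (nrm p)

def lo : ℕ → List ℤ → List ℤ
  | _, [] => []
  | 0, _ => []
  | n+1, c :: p => Int.ediv c (2^180) :: lo n p

def hi : ℕ → List ℤ → List ℤ
  | _, [] => []
  | 0, p => p
  | n+1, _ :: p => hi n p

namespace TM

def add (p q : TM) : TM := ⟨ladd p.c q.c, Nat.add p.r q.r⟩
def neg (p : TM) : TM := ⟨lneg p.c, p.r⟩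
def sub (p q : TM) : TM := add p (neg q)
def mul (p q : TM) : TM :=
  ⟨lo 5 (lmul q.c p.c), Nat.add (Nat.div (Nat.add (Nat.mul p.r (nrm q.c)) (Nat.add (Nat.mul q.r (nrm p.c))
    (Nat.add (Nat.mul p.r q.r) (nrm (hi 5 (lmul q.c p.c)))))) (2^180)) 6⟩

/-- lower bound test -/
def pos : TM → Bool
  | ⟨[], _⟩ => false
  | ⟨a :: p, r⟩ => Nat.blt (Nat.add (nrm p) r) (Int.toNat a)

/-- constant `n/4` -/
def qu (n : ℤ) : TM := ⟨[Int.mul n (2^178)], 0⟩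
def ivl (l h : ℤ) : TM := ⟨[Int.ediv (Int.add l h) 2], Nat.add (Int.toNat (Int.ediv (Int.sub h l) 2)) 1⟩

end TM

noncomputable def pev : List ℤ → ℝ → ℝ
  | [], _ => 0
  | a :: p, y => a + y * pev p y

lemma pev_ladd (y : ℝ) : ∀ p q : List ℤ, pev (ladd p q) y = pev p y + pev q y
  | [], q => by simp [ladd, pev]
  | a :: p, [] => by simp [ladd, pev]
  | a :: p, b :: q => by
    simp only [ladd, pev, pev_ladd y p q]
    have : ((Int.add a b : ℤ) : ℝ) = a + b := Int.cast_add a b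
    rw [this]; ring

lemma pev_lsmul (y : ℝ) (a : ℤ) : ∀ p : List ℤ, pev (lsmul a p) y = a * pev p y
  | [] => by simp [lsmul, pev]
  | b :: p => by
    simp only [lsmul, pev, pev_lsmul y a p]
    have : ((Int.mul a b : ℤ) : ℝ) = a * b := Int.cast_mul a b
    rw [this]; ring

lemma pev_lmul (y : ℝ) (q : List ℤ) : ∀ p : List ℤ, pev (lmul q p) y = pev p y * pev q y
  | [] => by simp [lmul, pev]
  | a :: p => by
    simp only [lmul, pev, pev_ladd, pev_lsmul, pev_lmul y q p]; push_cast; ring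

lemma pev_lneg (y : ℝ) : ∀ p : List ℤ, pev (lneg p) y = -pev p y
  | [] => by simp [lneg, pev]
  | b :: p => by
    simp only [lneg, pev, pev_lneg y p]
    have : ((Int.neg b : ℤ) : ℝ) = -b := Int.cast_neg b
    rw [this]; ring

lemma nrm_cons (a : ℤ) (p : List ℤ) : ((nrm (a :: p) : ℕ) : ℝ) = |(a:ℝ)| + nrm p := by
  simp only [nrm]
  have : ((Nat.add (Int.natAbs a) (nrm p) : ℕ) : ℝ) = (Int.natAbs a : ℝ) + nrm p := Nat.cast_add _ _
  rw [this, Nat.cast_natAbs, Int.cast_abs]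

lemma pev_le {y : ℝ} (hy : |y| ≤ 1) : ∀ p : List ℤ, |pev p y| ≤ (nrm p : ℝ)
  | [] => by simp [pev, nrm]
  | a :: p => by
    rw [nrm_cons]; simp only [pev]
    have h1 := pev_le hy p
    have h2 : |y * pev p y| ≤ (nrm p : ℝ) := by
      rw [abs_mul]; nlinarith [abs_nonneg y, abs_nonneg (pev p y)]
    exact (abs_add_le _ _).trans (by linarith)

lemma pev_lohi {y : ℝ} (hy : |y| ≤ 1) : ∀ (n : ℕ) (p : List ℤ),
    |pev p y - 2^180 * pev (lo n p) y| ≤ (n:ℝ) * 2^180 + (nrm (hi n p) : ℝ)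
  | n, [] => by cases n <;> simp [lo, hi, pev, nrm] <;> positivity
  | 0, a :: p => by simpa [lo, hi, pev] using pev_le hy (a :: p)
  | n+1, a :: p => by
    simp only [lo, hi, pev]
    have h1 := pev_lohi hy n p
    set d := pev p y - 2^180 * pev (lo n p) y
    have h2 : |(a:ℝ) - 2^180 * ((Int.ediv a (2^180) : ℤ) : ℝ)| ≤ 2^180 := by
      have e1 : a - 2^180 * (a / 2^180) = a % 2^180 := by
        have := Int.emod_add_mul_ediv a (2^180); omega
      have e2 := Int.emod_nonneg a (show (2^180:ℤ) ≠ 0 by norm_num)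
      have e3 := Int.emod_lt_of_pos a (show (0:ℤ) < 2^180 by norm_num)
      have e4 : (a:ℝ) - 2^180 * ((a / 2^180 : ℤ) : ℝ) = ((a % 2^180 : ℤ) : ℝ) := by
        rw [← e1]; push_cast; ring
      change |(a:ℝ) - 2^180 * ((a / 2^180 : ℤ) : ℝ)| ≤ 2^180
      rw [e4, abs_of_nonneg (by exact_mod_cast e2)]
      exact_mod_cast e3.le
    have h3 : |y * d| ≤ |d| := by
      rw [abs_mul]; nlinarith [abs_nonneg y, abs_nonneg d]
    calc _ = |((a:ℝ) - 2^180 * ((Int.ediv a (2^180) : ℤ) : ℝ)) + y * d| := by congr 1; ring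
      _ ≤ _ := abs_add_le _ _
      _ ≤ _ := by
        have e : ((n + 1 : ℕ) : ℝ) = n + 1 := Nat.cast_succ n
        rw [e]; linarith

/-- membership -/
def Mem (y : ℝ) (p : TM) (x : ℝ) : Prop := |x * 2^180 - pev p.c y| ≤ (p.r : ℝ)

section
variable {y : ℝ}

lemma Mem.add {p q : TM} {a b : ℝ} (ha : Mem y p a) (hb : Mem y q b) :
    Mem y (p.add q) (a + b) := by
  unfold Mem at *
  simp only [TM.add, pev_ladd]
  have : ((Nat.add p.r q.r : ℕ) : ℝ) = (p.r:ℝ) + q.r := Nat.cast_add _ _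
  rw [this]
  calc _ = |(a * 2^180 - pev p.c y) + (b * 2^180 - pev q.c y)| := by congr 1; ring
    _ ≤ _ := (abs_add_le _ _).trans (add_le_add ha hb)

lemma Mem.neg {p : TM} {a : ℝ} (ha : Mem y p a) : Mem y p.neg (-a) := by
  unfold Mem at *
  simp only [TM.neg, pev_lneg]
  rw [← abs_neg]
  convert ha using 2; ring

lemma Mem.sub {p q : TM} {a b : ℝ} (ha : Mem y p a) (hb : Mem y q b) :
    Mem y (p.sub q) (a - b) := by
  rw [sub_eq_add_neg]; exact ha.add hb.neg

lemma div_aux {n K : ℕ} (hK : 0 < K) {x : ℝ} (h : x * (K:ℝ) ≤ n + 5 * (K:ℝ)) :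
    x ≤ ((n / K + 6 : ℕ) : ℝ) := by
  have h1 : n ≤ (n / K) * K + K := by
    have h2 := Nat.div_add_mod n K
    have h3 := Nat.mod_lt n hK
    rw [mul_comm] at h2
    omega
  have h4 : (n:ℝ) ≤ ((n / K : ℕ) : ℝ) * K + K := by exact_mod_cast h1
  have h5 : (0:ℝ) < K := by exact_mod_cast hK
  push_cast
  refine le_of_mul_le_mul_right ?_ h5
  linarith

lemma Mem.mul (hy : |y| ≤ 1) {p q : TM} {a b : ℝ} (ha : Mem y p a) (hb : Mem y q b) :
    Mem y (p.mul q) (a * b) := by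
  unfold Mem at *
  simp only [TM.mul]
  set l := lmul q.c p.c with hl
  have e1 := pev_lohi hy 5 l
  have e2 : pev l y = pev p.c y * pev q.c y := pev_lmul y q.c p.c
  set P := pev p.c y
  set Q := pev q.c y
  set n : ℕ := p.r * nrm q.c + (q.r * nrm p.c + (p.r * q.r + nrm (hi 5 l))) with hn
  change |a * b * 2^180 - pev (lo 5 l) y| ≤ ((n / 2^180 + 6 : ℕ) : ℝ)
  have hP : |P| ≤ (nrm p.c : ℝ) := pev_le hy _
  have hQ : |Q| ≤ (nrm q.c : ℝ) := pev_le hy _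
  have e3 : |a * 2^180 * (b * 2^180) - P * Q| ≤ (p.r:ℝ) * nrm q.c + q.r * nrm p.c + p.r * q.r := by
    have : a * 2^180 * (b * 2^180) - P * Q =
      (a * 2^180 - P) * Q + (b * 2^180 - Q) * P + (a * 2^180 - P) * (b * 2^180 - Q) := by ring
    rw [this]
    refine (abs_add_le _ _).trans (add_le_add ((abs_add_le _ _).trans (add_le_add ?_ ?_)) ?_) <;>
      rw [abs_mul]
    · exact mul_le_mul ha hQ (abs_nonneg _) (Nat.cast_nonneg _)
    · exact mul_le_mul hb hP (abs_nonneg _) (Nat.cast_nonneg _)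
    · exact mul_le_mul ha hb (abs_nonneg _) (Nat.cast_nonneg _)
  have e4 : |(a * b * 2^180 - pev (lo 5 l) y) * 2^180| ≤ (n:ℝ) + 5 * 2^180 := by
    have : (a * b * 2^180 - pev (lo 5 l) y) * 2^180 =
      (a * 2^180 * (b * 2^180) - P * Q) + (pev l y - 2^180 * pev (lo 5 l) y) := by rw [e2]; ring
    rw [this, hn]
    push_cast at e1 ⊢
    exact (abs_add_le _ _).trans (by linarith)
  rw [abs_mul, abs_of_pos (show (0:ℝ) < 2^180 by positivity)] at e4
  have hK : ((2^180 : ℕ) : ℝ) = 2^180 := by rw [Nat.cast_pow]; norm_num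
  refine div_aux (by positivity) ?_
  rw [hK]; exact e4

lemma Mem.pos (hy : |y| ≤ 1) {p : TM} {a : ℝ} (ha : Mem y p a) (hp : p.pos = true) : 0 < a := by
  unfold Mem at ha
  rcases p with ⟨_ | ⟨c, l⟩, r⟩
  · simp [TM.pos] at hp
  · change Nat.ble (Nat.succ (Nat.add (nrm l) r)) (Int.toNat c) = true at hp
    have hp2 : Nat.add (nrm l) r < Int.toNat c := Nat.le_of_ble_eq_true hp
    have hp3 : (nrm l : ℤ) + r < c := by
      have : nrm l + r < Int.toNat c := hp2
      omega
    have hp4 : (nrm l : ℝ) + r < c := by exact_mod_cast hp3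
    simp only [pev] at ha
    have h1 := pev_le hy l
    have h2 : |y * pev l y| ≤ (nrm l : ℝ) := by
      rw [abs_mul]; nlinarith [abs_nonneg y, abs_nonneg (pev l y)]
    have h3 := abs_le.1 ha
    have h4 := abs_le.1 h2
    have : 0 < a * 2^180 := by linarith [h3.1, h4.1]
    exact pos_of_mul_pos_left this (by positivity)

lemma Mem.qu (n : ℤ) {x : ℝ} (hx : x = n / 4) : Mem y (TM.qu n) x := by
  unfold Mem TM.qu
  simp only [pev]
  have : ((Int.mul n (2^178) : ℤ) : ℝ) = n * 2^178 := by
    change ((n * 2^178 : ℤ) : ℝ) = _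
    norm_num
  rw [this, hx]
  norm_num
  ring

lemma Mem.ivl {l h : ℤ} {x : ℝ} (h1 : (l:ℝ) ≤ x * 2^180) (h2 : x * 2^180 ≤ h) :
    Mem y (TM.ivl l h) x := by
  unfold Mem TM.ivl
  simp only [pev]
  have hlh : l ≤ h := by exact_mod_cast h1.trans h2
  have e1 : Int.ediv (Int.add l h) 2 = (l + h) / 2 := rfl
  have e2 : (Nat.add (Int.toNat (Int.ediv (Int.sub h l) 2)) 1 : ℕ) = Int.toNat ((h - l)/2) + 1 := rfl
  rw [e1, e2]
  set m := (l + h) / 2 with hm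
  set k := (h - l)/2 with hk
  have hk0 : 0 ≤ k := by omega
  have e3 : ((Int.toNat k : ℕ) : ℝ) = (k:ℝ) := by
    have := Int.toNat_of_nonneg hk0
    exact_mod_cast this
  have i1 : (m:ℝ) - k - 1 ≤ l := by exact_mod_cast (show m - k - 1 ≤ l by omega)
  have i2 : (h:ℝ) ≤ m + k + 1 := by exact_mod_cast (show h ≤ m + k + 1 by omega)
  push_cast
  rw [e3, abs_le]
  constructor <;> simp <;> linarith

lemma Mem.mk1 (c : ℤ) (r : ℕ) {x : ℝ} (h : |x * 2^180 - c| ≤ (r : ℝ)) : Mem y ⟨[c], r⟩ x := by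
  unfold Mem; simpa [pev] using h

lemma Mem.lin (A H : ℤ) {x : ℝ} (h : x = (A + H * y) / 16) :
    Mem y ⟨[Int.mul A (2^176), Int.mul H (2^176)], 0⟩ x := by
  unfold Mem
  simp only [pev]
  have e : ∀ n : ℤ, ((Int.mul n (2^176) : ℤ) : ℝ) = n * 2^176 := by
    intro n
    change ((n * 2^176 : ℤ) : ℝ) = _
    norm_num
  rw [e, e, h]
  norm_num
  ring

end

/-! complex Taylor models -/

structure CT where
  a : TM
  b : TM

namespace CT
def add (p q : CT) : CT := ⟨p.a.add q.a, p.b.add q.b⟩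
def sub (p q : CT) : CT := ⟨p.a.sub q.a, p.b.sub q.b⟩
def neg (p : CT) : CT := ⟨p.a.neg, p.b.neg⟩
def mul (p q : CT) : CT :=
  ⟨(p.a.mul q.a).sub (p.b.mul q.b), (p.a.mul q.b).add (p.b.mul q.a)⟩
def sc (x : TM) (p : CT) : CT := ⟨x.mul p.a, x.mul p.b⟩
def conj (p : CT) : CT := ⟨p.a, p.b.neg⟩
def nsq (p : CT) : TM := (p.a.mul p.a).add (p.b.mul p.b)
def re (p : TM) : CT := ⟨p, ⟨[], 0⟩⟩
end CT

def CMem (y : ℝ) (p : CT) (z : ℂ) : Prop := Mem y p.a z.re ∧ Mem y p.b z.im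

section
variable {y : ℝ}

lemma CMem.add {p q : CT} {a b : ℂ} (ha : CMem y p a) (hb : CMem y q b) :
    CMem y (p.add q) (a + b) := ⟨ha.1.add hb.1, ha.2.add hb.2⟩
lemma CMem.sub {p q : CT} {a b : ℂ} (ha : CMem y p a) (hb : CMem y q b) :
    CMem y (p.sub q) (a - b) := ⟨ha.1.sub hb.1, ha.2.sub hb.2⟩
lemma CMem.neg {p : CT} {a : ℂ} (ha : CMem y p a) : CMem y p.neg (-a) := ⟨ha.1.neg, ha.2.neg⟩
lemma CMem.mul (hy : |y| ≤ 1) {p q : CT} {a b : ℂ} (ha : CMem y p a) (hb : CMem y q b) :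
    CMem y (p.mul q) (a * b) := by
  refine ⟨?_, ?_⟩
  · rw [mul_re]; exact (ha.1.mul hy hb.1).sub (ha.2.mul hy hb.2)
  · rw [mul_im]; exact (ha.1.mul hy hb.2).add (ha.2.mul hy hb.1)
lemma CMem.sc (hy : |y| ≤ 1) {p : TM} {q : CT} {a : ℝ} {b : ℂ} (ha : Mem y p a) (hb : CMem y q b) :
    CMem y (CT.sc p q) (a * b) := by
  refine ⟨?_, ?_⟩
  · rw [re_ofReal_mul]; exact ha.mul hy hb.1
  · rw [im_ofReal_mul]; exact ha.mul hy hb.2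
lemma CMem.conj {p : CT} {a : ℂ} (ha : CMem y p a) : CMem y p.conj ((starRingEnd ℂ) a) :=
  ⟨by rw [conj_re]; exact ha.1, by rw [conj_im]; exact ha.2.neg⟩
lemma CMem.nsq (hy : |y| ≤ 1) {p : CT} {a : ℂ} (ha : CMem y p a) : Mem y p.nsq (normSq a) := by
  rw [normSq_apply]; exact (ha.1.mul hy ha.1).add (ha.2.mul hy ha.2)
lemma CMem.re {p : TM} {a : ℝ} (ha : Mem y p a) : CMem y (CT.re p) (a : ℂ) :=
  ⟨by rw [ofReal_re]; exact ha, by rw [ofReal_im]; simp [CT.re, Mem, pev]⟩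
lemma CMem.mk {p q : TM} {a b : ℝ} {z : ℂ} (ha : Mem y p a) (hb : Mem y q b) (hr : z.re = a)
    (hi : z.im = b) : CMem y ⟨p, q⟩ z := ⟨by rw [hr]; exact ha, by rw [hi]; exact hb⟩
end

end G2RH


namespace G2RH
open Complex

noncomputable def dl : ℝ := Real.pi / 6 - 1 / 2
noncomputable def c3 : ℝ := 2 * Real.pi / (12 + Real.pi)
noncomputable def c2 : ℝ := Real.pi ^ 2 / (6 * (12 + Real.pi))
def DE : TM := ⟨[36165018374287771438483573764412839899055968570273719], 1532495540865888858358347027150309183618⟩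
def C3 : TM := ⟨[635927387955714062217684443228277298396500369192485498], 1532495540865888858358347027150309183618⟩
def C2 : TM := ⟨[166485400851518138399972644111290133311925160469589308], 1532495540865888858358347027150309183618⟩
def dcT : ℕ → ℤ × ℕ
  | 0 => (36165018374287770000000000000000000000000000000000000, 3616504391588011920585203897163977383482)
  | 1 => (418396138444142000000000000000000000000000000000000, 41839976248709523618204444451000326951)
  | 2 => (3178062859279201000000000000000000000000000000000, 317823257131122752871017356731973733)
  | 3 => (17884566219612670000000000000000000000000000000, 1788853453846798425479073710559160)
  | 4 => (79708500685195470000000000000000000000000000, 7976434267235027051342248230469)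
  | 5 => (293542145912459500000000000000000000000000, 29406922936059295917017127364)
  | 6 => (919916523804575900000000000000000000000, 92350160559983022220452116)
  | 7 => (2506784486562037000000000000000000000, 252528455252084578118051)
  | 8 => (6038874784462419000000000000000000, 611419907368217477516)
  | 9 => (13029829050807180000000000000000, 1327950662444896171)
  | 10 => (25448402276103890000000000000, 2613986711989858)
  | _ => (0, 0)

def dcM (j : ℕ) : TM := ⟨[(dcT j).1], (dcT j).2⟩
def dcU (j : ℕ) : ℕ := Nat.add (Int.toNat (dcT j).1) (dcT j).2

lemma dcT_spec (j : ℕ) (hj : j ≤ 10) : |dc j * 2^180 - ((dcT j).1 : ℝ)| ≤ ((dcT j).2 : ℝ) := by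
  interval_cases j
  · simpa [dcT] using dcv0
  · simpa [dcT] using dcv1
  · simpa [dcT] using dcv2
  · simpa [dcT] using dcv3
  · simpa [dcT] using dcv4
  · simpa [dcT] using dcv5
  · simpa [dcT] using dcv6
  · simpa [dcT] using dcv7
  · simpa [dcT] using dcv8
  · simpa [dcT] using dcv9
  · simpa [dcT] using dcv10

lemma dcM_mem {y : ℝ} (j : ℕ) (hj : j ≤ 10) : Mem y (dcM j) (dc j) := Mem.mk1 _ _ (dcT_spec j hj)

lemma dcU_spec (j : ℕ) (hj : j ≤ 10) : dc j * 2^180 ≤ (dcU j : ℝ) := by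
  have h := (abs_le.1 (dcT_spec j hj)).2
  have h2 : ((dcU j : ℕ) : ℝ) = ((Int.toNat (dcT j).1 : ℕ) : ℝ) + ((dcT j).2 : ℝ) := Nat.cast_add _ _
  have h3 : ((dcT j).1 : ℝ) ≤ ((Int.toNat (dcT j).1 : ℕ) : ℝ) := by
    exact_mod_cast Int.self_le_toNat (dcT j).1
  rw [h2]; linarith

lemma DE_mem {y : ℝ} : Mem y DE dl := by
  obtain ⟨h1, h2⟩ := pi_pow_bd 1
  apply Mem.mk1
  unfold dl
  rw [abs_le]
  norm_num at h1 h2 ⊢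
  constructor <;> linarith

lemma C3_mem {y : ℝ} : Mem y C3 c3 := by
  obtain ⟨h1, h2⟩ := pi_pow_bd 1
  apply Mem.mk1
  have h0 := Real.pi_pos
  have e : c3 * (12 + Real.pi) = 2 * Real.pi := by unfold c3; field_simp
  rw [abs_le]
  norm_num at h1 h2 ⊢
  constructor
  · refine le_of_mul_le_mul_right ?_ (show 0 < 12 + Real.pi by linarith)
    linarith
  · refine le_of_mul_le_mul_right ?_ (show 0 < 12 + Real.pi by linarith)
    linarith

lemma C2_mem {y : ℝ} : Mem y C2 c2 := by
  obtain ⟨h1, h2⟩ := pi_pow_bd 1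
  obtain ⟨h3, h4⟩ := pi_pow_bd 2
  apply Mem.mk1
  have h0 := Real.pi_pos
  have e : c2 * (12 + Real.pi) = Real.pi ^ 2 / 6 := by unfold c2; field_simp
  rw [abs_le]
  norm_num at h1 h2 h3 h4 ⊢
  constructor
  · refine le_of_mul_le_mul_right ?_ (show 0 < 12 + Real.pi by linarith)
    linarith
  · refine le_of_mul_le_mul_right ?_ (show 0 < 12 + Real.pi by linarith)
    linarith

/-! Newton-Horner evaluation -/

def horT (w : CT) : ℕ → CT → CT
  | 0, acc => acc
  | j+1, acc => horT w j ((CT.re (dcM j)).add ((w.sub (CT.re (TM.qu ((4*j+3)^2)))).mul acc))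

def accT (w : CT) (N k : ℕ) : CT :=
  ⟨TM.ivl (-((k * dcU N / 1024 + 1 : ℕ) : ℤ)) (dcU N), w.b.mul ⟨[], dcU (N+1)⟩⟩

def XT (w : CT) (N k : ℕ) : CT :=
  (CT.re (TM.qu 4)).add ((w.sub (CT.re (TM.qu 1))).mul (horT w N (accT w N k)))

section
variable {y : ℝ}

lemma horT_mem (hy : |y| ≤ 1) {W : CT} {w : ℂ} (hw : CMem y W w) : ∀ (n : ℕ) (_ : n ≤ 11) (acc : CT)
    (_ : CMem y acc (evc (cs n) w)), CMem y (horT W n acc) (evc (cs 0) w)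
  | 0, _, acc, h => h
  | n+1, hn, acc, h => by
    simp only [horT]
    refine horT_mem hy hw n (by omega) _ ?_
    rw [cs_step]
    refine (CMem.re (dcM_mem n (by omega))).add ((hw.sub (CMem.re (Mem.qu _ ?_))).mul hy h)
    simp only [nd]; push_cast; ring

lemma accT_mem (hy : |y| ≤ 1) {W : CT} {w : ℂ} (hw : CMem y W w) {N k : ℕ} (hN : N ≤ 9) (hk : k ≤ 1024)
    (hn : ‖w‖ ≤ (k:ℝ)/1024 * nd N) : CMem y (accT W N k) (evc (cs N) w) := by
  have hk1 : (k:ℝ)/1024 ≤ 1 := by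
    rw [div_le_one (by norm_num)]; exact_mod_cast hk
  have hn1 : ‖w‖ ≤ nd N := hn.trans (by nlinarith [nd_nonneg N])
  refine ⟨Mem.ivl ?_ ?_, ?_⟩
  · have h1 := cs_re_ge N (by positivity) hk1 hn
    have h2 := dcU_spec N (by omega)
    have h3 : ((k * dcU N : ℕ) : ℝ) ≤ ((k * dcU N / 1024 : ℕ) : ℝ) * 1024 + 1024 := by
      exact_mod_cast (show k * dcU N ≤ (k * dcU N / 1024) * 1024 + 1024 by omega)
    have h4 : (k:ℝ) * (dc N * 2^180) ≤ ((k * dcU N : ℕ) : ℝ) := by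
      rw [Nat.cast_mul]; exact mul_le_mul_of_nonneg_left h2 (Nat.cast_nonneg _)
    have h5 : ((-((k * dcU N / 1024 + 1 : ℕ) : ℤ) : ℤ) : ℝ) = -(((k * dcU N / 1024 : ℕ) : ℝ) + 1) := by
      rw [Int.cast_neg, Int.cast_natCast, Nat.cast_add, Nat.cast_one]
    rw [h5]
    linarith
  · have h1 := cs_re_le N hn1
    have h2 := dcU_spec N (by omega)
    push_cast
    linarith
  · have h1 := cs_im N hn1
    have h2 := dcU_spec (N+1) (by omega)
    obtain ⟨e, he, hed⟩ : ∃ e : ℝ, (evc (cs N) w).im = w.im * e ∧ |e| ≤ dc (N+1) := by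
      by_cases h : w.im = 0
      · refine ⟨0, ?_, by simpa using dc_nonneg (N+1)⟩
        rw [h] at h1 ⊢
        simpa using h1
      · refine ⟨(evc (cs N) w).im / w.im, by field_simp, ?_⟩
        rw [abs_div, div_le_iff₀ (abs_pos.2 h), mul_comm]; exact h1
    rw [he]
    refine hw.2.mul hy ?_
    unfold Mem
    simp only [pev, sub_zero]
    rw [abs_mul, abs_of_pos (show (0:ℝ) < 2^180 by positivity)]
    refine le_trans ?_ h2
    exact mul_le_mul_of_nonneg_right hed (by positivity)

lemma XT_mem (hy : |y| ≤ 1) {W : CT} {z : ℂ} (hw : CMem y W (z^2)) {N k : ℕ} (hN : N ≤ 9) (hk : k ≤ 1024)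
    (hn : ‖z^2‖ ≤ (k:ℝ)/1024 * nd N) : CMem y (XT W N k) (X (1/2 + z)) := by
  rw [X_evc]
  have h := horT_mem hy hw N (by omega) _ (accT_mem hy hw hN hk hn)
  have e1 : (1:ℂ) = ((1:ℝ):ℂ) := by simp
  have e2 : (1/4:ℂ) = ((1/4:ℝ):ℂ) := by push_cast; rfl
  refine CMem.add ?_ (CMem.mul hy (CMem.sub hw ?_) h)
  · rw [e1]; exact CMem.re (Mem.qu _ (by norm_num))
  · rw [e2]; exact CMem.re (Mem.qu _ (by norm_num))
end

/-! The functions `R`, `V` -/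

def shT (q : ℤ) (t : TM) : CT := ⟨TM.qu q, t⟩
def m3T (t : TM) : CT := ⟨(TM.qu 12).add DE, ((TM.qu 8).mul DE).mul t⟩

noncomputable def m3 (s : ℂ) : ℂ := 3 + 2 * dl * s

noncomputable def NRf (s a b r : ℂ) (q : ℝ) : ℂ :=
  (s-1)*(s-2)*((s-1)*m3 s*a - ((2*(1-c2) : ℝ) : ℂ) * ((s-3)*b)) + (((1-c3)*q : ℝ) : ℂ) * ((s-2)*r)
noncomputable def NVf (s b r : ℂ) (q : ℝ) : ℂ :=
  ((c3*q : ℝ) : ℂ) * ((s+1)*r) - ((2*c2 : ℝ) : ℂ) * ((s*(s+2)*(s+1))*(starRingEnd ℂ) b)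
noncomputable def Ef (s a : ℂ) : ℂ := -((starRingEnd ℂ) ((s-2)*m3 s*(s+3/2)*a) * (s+7))

def NRT (t a b r : CT) (t' q : TM) : CT :=
  ((shT (-2) t').mul (shT (-6) t')).mul ((((shT (-2) t').mul t).mul a).sub
    (CT.sc ((TM.qu 8).mul ((TM.qu 4).sub C2)) ((shT (-10) t').mul b))) |>.add
  (CT.sc (((TM.qu 4).sub C3).mul q) ((shT (-6) t').mul r))
def NVT (b r : CT) (t' q : TM) : CT :=
  (CT.sc (C3.mul q) ((shT 6 t').mul r)).sub
    (CT.sc ((TM.qu 8).mul C2) ((((shT 2 t').mul (shT 10 t')).mul (shT 6 t')).mul b.conj))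
def ET (m a : CT) (t' : TM) : CT :=
  (((((shT (-6) t').mul m).mul (shT 8 t')).mul a).conj.mul (shT 30 t')).neg

section
variable {y t : ℝ}

lemma shT_mem {p : TM} (hp : Mem y p t) (q : ℤ) {s : ℂ} (h1 : s.re = q/4) (h2 : s.im = t) :
    CMem y (shT q p) s := CMem.mk (Mem.qu q rfl) hp h1 h2

noncomputable def sl (t : ℝ) : ℂ := ⟨1/2, t⟩

lemma m3T_mem (hy : |y| ≤ 1) {p : TM} (hp : Mem y p t) : CMem y (m3T p) (m3 (sl t)) := by
  refine CMem.mk (a := 3 + dl) (b := 2 * dl * t) ((Mem.qu 12 (by norm_num)).add DE_mem)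
    (((Mem.qu 8 (by norm_num)).mul hy DE_mem).mul hy hp) ?_ ?_
  · simp [m3, sl]
    ring
  · simp [m3, sl]

lemma NRT_mem (hy : |y| ≤ 1) {p q : TM} {m a b r : CT} {a' b' r' : ℂ} {q' : ℝ} (hp : Mem y p t)
    (hm : CMem y m (m3 (sl t)))
    (ha : CMem y a a') (hb : CMem y b b') (hr : CMem y r r') (hq : Mem y q q') :
    CMem y (NRT m a b r p q) (NRf (sl t) a' b' r' q') := by
  have s1 : CMem y (shT (-2) p) (sl t - 1) := shT_mem hp _ (by simp [sl]; norm_num) (by simp [sl])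
  have s2 : CMem y (shT (-6) p) (sl t - 2) := shT_mem hp _ (by simp [sl]; norm_num) (by simp [sl])
  have s3 : CMem y (shT (-10) p) (sl t - 3) := shT_mem hp _ (by simp [sl]; norm_num) (by simp [sl])
  have one : Mem y (TM.qu 4) 1 := Mem.qu 4 (by norm_num)
  have two : Mem y (TM.qu 8) 2 := Mem.qu 8 (by norm_num)
  exact ((s1.mul hy s2).mul hy (((s1.mul hy hm).mul hy ha).sub
    (CMem.sc hy (two.mul hy (one.sub C2_mem)) (s3.mul hy hb)))).add
    (CMem.sc hy ((one.sub C3_mem).mul hy hq) (s2.mul hy hr))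

lemma NVT_mem (hy : |y| ≤ 1) {p q : TM} {b r : CT} {b' r' : ℂ} {q' : ℝ} (hp : Mem y p t)
    (hb : CMem y b b') (hr : CMem y r r') (hq : Mem y q q') :
    CMem y (NVT b r p q) (NVf (sl t) b' r' q') := by
  have s0 : CMem y (shT 2 p) (sl t) := shT_mem hp _ (by simp [sl]; norm_num) (by simp [sl])
  have s1 : CMem y (shT 6 p) (sl t + 1) := shT_mem hp _ (by simp [sl]; norm_num) (by simp [sl])
  have s2 : CMem y (shT 10 p) (sl t + 2) := shT_mem hp _ (by simp [sl]; norm_num) (by simp [sl])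
  have two : Mem y (TM.qu 8) 2 := Mem.qu 8 (by norm_num)
  exact (CMem.sc hy (C3_mem.mul hy hq) (s1.mul hy hr)).sub
    (CMem.sc hy (two.mul hy C2_mem) (((s0.mul hy s2).mul hy s1).mul hy hb.conj))

lemma ET_mem (hy : |y| ≤ 1) {p : TM} {m a : CT} {a' : ℂ} (hp : Mem y p t)
    (hm : CMem y m (m3 (sl t))) (ha : CMem y a a') :
    CMem y (ET m a p) (Ef (sl t) a') := by
  have s0 : CMem y (shT (-6) p) (sl t - 2) := shT_mem hp _ (by simp [sl]; norm_num) (by simp [sl])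
  have s1 : CMem y (shT 8 p) (sl t + 3/2) := shT_mem hp _ (by simp [sl]; norm_num) (by simp [sl])
  have s2 : CMem y (shT 30 p) (sl t + 7) := shT_mem hp _ (by simp [sl]; norm_num) (by simp [sl])
  exact ((((s0.mul hy hm).mul hy s1).mul hy ha).conj.mul hy s2).neg
end

/-! `R`, `V` and `u` on the line -/

noncomputable def af (t : ℝ) : ℂ := X (sl t + 2)
noncomputable def bf (t : ℝ) : ℂ := X (sl t + 1)
noncomputable def rf (t : ℝ) : ℂ := X (sl t)
noncomputable def uf (t : ℝ) : ℂ := X (2 * sl t)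
noncomputable def Rf (t : ℝ) : ℂ := NRf (sl t) (af t) (bf t) (rf t) (t*t + 25/4) * Ef (sl t) (af t)
noncomputable def Vf (t : ℝ) : ℂ := NVf (sl t) (bf t) (rf t) (t*t + 25/4) * Ef (sl t) (af t)

def tT (A H : ℤ) : TM := ⟨[Int.mul A (2^176), Int.mul H (2^176)], 0⟩
def wa (t q : TM) : CT := ⟨(TM.qu 16).sub q, (TM.qu 16).mul t⟩
def wb (t q : TM) : CT := ⟨(TM.qu 4).sub q, (TM.qu 8).mul t⟩
def wr (q : TM) : CT := ⟨q.neg, ⟨[], 0⟩⟩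
def wu (t q : TM) : CT := ⟨(TM.qu 1).sub ((TM.qu 16).mul q), (TM.qu 8).mul t⟩

def RT (m a b r : CT) (t q : TM) : CT := (NRT m a b r t q).mul (ET m a t)
def VT (m a b r : CT) (t q : TM) : CT := (NVT b r t q).mul (ET m a t)
def RTb (t q : TM) (N k : ℕ) : CT :=
  RT (m3T t) (XT (wa t q) N k) (XT (wb t q) N k) (XT (wr q) N k) t (q.add (TM.qu 25))
def VTb (t q : TM) (N k : ℕ) : CT :=
  VT (m3T t) (XT (wa t q) N k) (XT (wb t q) N k) (XT (wr q) N k) t (q.add (TM.qu 25))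

def okA (A H : ℤ) (N k : ℕ) : Bool :=
  decide (0 ≤ A - H) && decide (0 ≤ H) && decide (N ≤ 9) && decide (k ≤ 1024) && decide (16 * (1024 + (A+H)^2) ≤ k * (4*N+3)^2)
def okU (A H : ℤ) (N k : ℕ) : Bool :=
  decide (0 ≤ A - H) && decide (0 ≤ H) && decide (N ≤ 9) && decide (k ≤ 1024) && decide (16 * (64 + 4 * (A+H)^2) ≤ k * (4*N+3)^2)

lemma norm_sq_mk (x t : ℝ) : ‖(⟨x, t⟩ : ℂ)^2‖ = x^2 + t^2 := by
  rw [norm_pow, ← normSq_eq_norm_sq, normSq_mk]; ring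

section
variable {y t : ℝ}

lemma t_bd {A H : ℤ} (hy : |y| ≤ 1) (ht : t = (A + H * y)/16) (h1 : 0 ≤ A - H) (h2 : 0 ≤ H) :
    t^2 ≤ ((A:ℝ)+H)^2/256 := by
  obtain ⟨h3, h4⟩ := abs_le.1 hy
  have h1' : (0:ℝ) ≤ A - H := by exact_mod_cast h1
  have h2' : (0:ℝ) ≤ H := by exact_mod_cast h2
  have : 0 ≤ t := by rw [ht]; nlinarith
  have : t ≤ (A + H)/16 := by rw [ht]; nlinarith
  nlinarith

lemma RV_mem (hy : |y| ≤ 1) {A H : ℤ} {N k : ℕ} (ht : t = (A + H * y)/16) (hok : okA A H N k = true) :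
    CMem y (RTb (tT A H) ((tT A H).mul (tT A H)) N k) (Rf t) ∧
    CMem y (VTb (tT A H) ((tT A H).mul (tT A H)) N k) (Vf t) := by
  simp only [okA, Bool.and_eq_true, decide_eq_true_eq] at hok
  obtain ⟨⟨⟨⟨h1, h2⟩, h3⟩, h4⟩, h5⟩ := hok
  have hb := t_bd hy ht h1 h2
  have h5' : (16:ℝ) * (1024 + (A+H)^2) ≤ k * (4*N+3)^2 := by exact_mod_cast h5
  have hM : t^2 + 4 ≤ (k:ℝ)/1024 * nd N := by
    simp only [nd]; nlinarith
  have hp : Mem y (tT A H) t := Mem.lin A H ht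
  set p := tT A H
  have hq : Mem y (p.mul p) (t*t) := hp.mul hy hp
  set q := p.mul p
  have ea : af t = X (1/2 + ⟨2, t⟩) := by
    unfold af; congr 1; apply Complex.ext <;> simp [sl]
  have eb : bf t = X (1/2 + ⟨1, t⟩) := by
    unfold bf; congr 1; apply Complex.ext <;> simp [sl]
  have er : rf t = X (1/2 + ⟨0, t⟩) := by
    unfold rf; congr 1; apply Complex.ext <;> simp [sl]
  have ha : CMem y (XT (wa p q) N k) (af t) := by
    rw [ea]; refine XT_mem hy ?_ h3 h4 ?_
    · refine CMem.mk ((Mem.qu 16 (x := 4) (by norm_num)).sub hq) ((Mem.qu 16 (x := 4) (by norm_num)).mul hy hp) ?_ ?_ <;>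
      simp [pow_two] <;> ring
    · rw [norm_sq_mk]; linarith
  have hb : CMem y (XT (wb p q) N k) (bf t) := by
    rw [eb]; refine XT_mem hy ?_ h3 h4 ?_
    · refine CMem.mk ((Mem.qu 4 (x := 1) (by norm_num)).sub hq) ((Mem.qu 8 (x := 2) (by norm_num)).mul hy hp) ?_ ?_ <;>
      simp [pow_two]; ring
    · rw [norm_sq_mk]; linarith
  have hr : CMem y (XT (wr q) N k) (rf t) := by
    rw [er]; refine XT_mem hy ?_ h3 h4 ?_
    · refine CMem.mk (b := 0) hq.neg (by simp [Mem, pev]) ?_ ?_ <;>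
      simp [pow_two]
    · rw [norm_sq_mk]; linarith
  have hm := m3T_mem hy hp
  have hq4 : Mem y (q.add (TM.qu 25)) (t*t + 25/4) := hq.add (Mem.qu 25 (by norm_num))
  exact ⟨(NRT_mem hy hp hm ha hb hr hq4).mul hy (ET_mem hy hp hm ha),
    (NVT_mem hy hp hb hr hq4).mul hy (ET_mem hy hp hm ha)⟩

lemma U_mem (hy : |y| ≤ 1) {A H : ℤ} {N k : ℕ} (ht : t = (A + H * y)/16) (hok : okU A H N k = true) :
    CMem y (XT (wu (tT A H) ((tT A H).mul (tT A H))) N k) (uf t) := by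
  simp only [okU, Bool.and_eq_true, decide_eq_true_eq] at hok
  obtain ⟨⟨⟨⟨h1, h2⟩, h3⟩, h4⟩, h5⟩ := hok
  have hb := t_bd hy ht h1 h2
  have h5' : (16:ℝ) * (64 + 4*(A+H)^2) ≤ k * (4*N+3)^2 := by exact_mod_cast h5
  have hM : 1/4 + 4*t^2 ≤ (k:ℝ)/1024 * nd N := by
    simp only [nd]; nlinarith
  have hp : Mem y (tT A H) t := Mem.lin A H ht
  set p := tT A H
  have hq : Mem y (p.mul p) (t*t) := hp.mul hy hp
  set q := p.mul p
  have eu : uf t = X (1/2 + ⟨1/2, 2*t⟩) := by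
    unfold uf; congr 1; apply Complex.ext <;> simp [sl]; norm_num
  rw [eu]; refine XT_mem hy ?_ h3 h4 ?_
  · refine CMem.mk ((Mem.qu 1 (x := 1/4) (by norm_num)).sub ((Mem.qu 16 (x := 4) (by norm_num)).mul hy hq)) ((Mem.qu 8 (x := 2) (by norm_num)).mul hy hp) ?_ ?_ <;>
    simp [pow_two] <;> ring
  · rw [norm_sq_mk]; linarith
end

def WT (u R V : CT) : TM :=
  (u.a.mul ((u.a.mul (R.a.add V.a)).add (((TM.qu 8).mul u.b).mul V.b))).sub
    ((u.b.mul u.b).mul (V.a.sub R.a))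
def chkA1 (A H : ℤ) (N k Nu ku : ℕ) : Bool :=
  okA A H N k && okU A H Nu ku &&
  (WT (XT (wu (tT A H) ((tT A H).mul (tT A H))) Nu ku) (RTb (tT A H) ((tT A H).mul (tT A H)) N k)
    (VTb (tT A H) ((tT A H).mul (tT A H)) N k)).pos
def ok2 (u R V : CT) : Bool :=
  (R.a.sub V.a).pos && u.a.pos && ((u.a.mul (R.a.add V.a)).add (((TM.qu 8).mul u.b).mul V.b)).pos
def chkA2 (A H : ℤ) (N k Nu ku : ℕ) : Bool :=
  okA A H N k && okU A H Nu ku &&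
  (ok2 (XT (wu (tT A H) ((tT A H).mul (tT A H))) Nu ku) (RTb (tT A H) ((tT A H).mul (tT A H)) N k)
    (VTb (tT A H) ((tT A H).mul (tT A H)) N k))
def ok3 (R V : CT) : Bool := R.a.pos && ((R.a.mul R.a).sub V.nsq).pos
def chkA3 (A H : ℤ) (N k : ℕ) : Bool :=
  okA A H N k && (ok3 (RTb (tT A H) ((tT A H).mul (tT A H)) N k)
    (VTb (tT A H) ((tT A H).mul (tT A H)) N k))

/-- real part of `|u|²(R + (conj u / u) V)` -/
noncomputable def Wf (t : ℝ) : ℝ := ((normSq (uf t) : ℂ) * Rf t + (starRingEnd ℂ (uf t))^2 * Vf t).re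

lemma Wf_eq (t : ℝ) : Wf t = (uf t).re * ((uf t).re * ((Rf t).re + (Vf t).re) + 2 * (uf t).im * (Vf t).im)
    - (uf t).im * (uf t).im * ((Vf t).re - (Rf t).re) := by
  simp [Wf, normSq_apply, pow_two]; ring

lemma box_y {A H : ℤ} (hH : 0 < H) {t : ℝ} (h1 : ((A:ℝ) - H)/16 ≤ t) (h2 : t ≤ (A + H)/16) :
    ∃ y : ℝ, |y| ≤ 1 ∧ t = (A + H * y)/16 := by
  have hH' : (0:ℝ) < H := by exact_mod_cast hH
  refine ⟨(16*t - A)/H, ?_, by field_simp; ring⟩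
  rw [abs_le, le_div_iff₀ hH', div_le_iff₀ hH']
  constructor <;> linarith

lemma WT_mem {y : ℝ} (hy : |y| ≤ 1) {u R V : CT} {u' R' V' : ℂ} (hu : CMem y u u') (hR : CMem y R R')
    (hV : CMem y V V') (h : (WT u R V).pos = true) :
    0 < u'.re * (u'.re * (R'.re + V'.re) + 2 * u'.im * V'.im) - u'.im * u'.im * (V'.re - R'.re) :=
  Mem.pos hy ((hu.1.mul hy ((hu.1.mul hy (hR.1.add hV.1)).add (((Mem.qu 8 (by norm_num)).mul hy hu.2).mul hy hV.2))).sub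
    ((hu.2.mul hy hu.2).mul hy (hV.1.sub hR.1))) h

lemma ok2_mem {y : ℝ} (hy : |y| ≤ 1) {u R V : CT} {u' R' V' : ℂ} (hu : CMem y u u') (hR : CMem y R R')
    (hV : CMem y V V') (h : ok2 u R V = true) :
    0 < u'.re * (u'.re * (R'.re + V'.re) + 2 * u'.im * V'.im) - u'.im * u'.im * (V'.re - R'.re) := by
  simp only [Bool.and_eq_true, ok2] at h
  obtain ⟨⟨k3, k4⟩, k5⟩ := h
  have p1 := Mem.pos hy (hR.1.sub hV.1) k3
  have p2 := Mem.pos hy hu.1 k4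
  have p3 := Mem.pos hy ((hu.1.mul hy (hR.1.add hV.1)).add (((Mem.qu 8 (x := 2) (by norm_num)).mul hy hu.2).mul hy hV.2)) k5
  have := mul_pos p2 p3
  nlinarith [mul_nonneg (mul_self_nonneg u'.im) p1.le]

lemma ok3_mem {y : ℝ} (hy : |y| ≤ 1) {R V : CT} {R' V' : ℂ} (hR : CMem y R R')
    (hV : CMem y V V') (h : ok3 R V = true) : ‖V'‖ < R'.re := by
  simp only [Bool.and_eq_true, ok3] at h
  obtain ⟨k3, k4⟩ := h
  have p1 := Mem.pos hy hR.1 k3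
  have p2 := Mem.pos hy ((hR.1.mul hy hR.1).sub (hV.nsq hy)) k4
  rw [normSq_eq_norm_sq] at p2
  nlinarith [norm_nonneg V']

lemma A1_sound {A H : ℤ} {N k Nu ku : ℕ} (hH : 0 < H) (hc : chkA1 A H N k Nu ku = true) {t : ℝ}
    (h1 : ((A:ℝ) - H)/16 ≤ t) (h2 : t ≤ (A + H)/16) : 0 < Wf t := by
  obtain ⟨y, hy, ht⟩ := box_y hH h1 h2
  rw [chkA1, Bool.and_eq_true, Bool.and_eq_true] at hc
  obtain ⟨⟨k1, k2⟩, k3⟩ := hc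
  obtain ⟨hR, hV⟩ := RV_mem hy ht k1
  have hu := U_mem hy ht k2
  rw [Wf_eq]
  exact WT_mem hy hu hR hV k3

lemma A2_sound {A H : ℤ} {N k Nu ku : ℕ} (hH : 0 < H) (hc : chkA2 A H N k Nu ku = true) {t : ℝ}
    (h1 : ((A:ℝ) - H)/16 ≤ t) (h2 : t ≤ (A + H)/16) : 0 < Wf t := by
  obtain ⟨y, hy, ht⟩ := box_y hH h1 h2
  rw [chkA2, Bool.and_eq_true, Bool.and_eq_true] at hc
  obtain ⟨⟨k1, k2⟩, k3⟩ := hc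
  obtain ⟨hR, hV⟩ := RV_mem hy ht k1
  have hu := U_mem hy ht k2
  rw [Wf_eq]
  exact ok2_mem hy hu hR hV k3

lemma A3_sound {A H : ℤ} {N k : ℕ} (hH : 0 < H) (hc : chkA3 A H N k = true) {t : ℝ}
    (h1 : ((A:ℝ) - H)/16 ≤ t) (h2 : t ≤ (A + H)/16) : ‖Vf t‖ < (Rf t).re := by
  obtain ⟨y, hy, ht⟩ := box_y hH h1 h2
  rw [chkA3, Bool.and_eq_true] at hc
  obtain ⟨k1, k3⟩ := hc
  obtain ⟨hR, hV⟩ := RV_mem hy ht k1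
  exact ok3_mem hy hR hV k3

end G2RH

namespace G2RH
set_option maxRecDepth 100000

lemma bx0 : chkA1 2 2 4 47 6 3 = true := by decide +kernel
lemma bx1 : chkA1 6 2 4 49 6 8 = true := by decide +kernel
lemma bx2 : chkA1 12 4 4 57 6 24 = true := by decide +kernel
lemma bx3 : chkA1 20 4 4 71 6 52 = true := by decide +kernel
lemma bx4 : chkA1 28 4 4 91 6 92 = true := by decide +kernel
lemma bx5 : chkA1 36 4 5 80 8 85 = true := by decide +kernel
lemma bx6 : chkA1 44 4 5 101 8 122 = true := by decide +kernel
lemma bx7 : chkA1 52 4 5 126 8 165 = true := by decide +kernel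
lemma bx8 : chkA2 58 2 7 77 9 153 = true := by decide +kernel
lemma bx9 : chkA2 62 2 7 86 9 174 = true := by decide +kernel
lemma bx10 : chkA2 66 2 7 95 9 196 = true := by decide +kernel
lemma bx11 : chkA2 70 2 7 104 9 219 = true := by decide +kernel
lemma bx12 : chkA3 73 1 9 69 = true := by decide +kernel
lemma bx13 : chkA3 75 1 9 72 = true := by decide +kernel
lemma bx14 : chkA3 77 1 9 75 = true := by decide +kernel
lemma bx15 : chkA3 79 1 9 79 = true := by decide +kernel
lemma bx16 : chkA3 82 2 9 85 = true := by decide +kernel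
lemma bx17 : chkA3 86 2 9 93 = true := by decide +kernel
lemma bx18 : chkA3 90 2 9 100 = true := by decide +kernel
lemma bx19 : chkA3 94 2 9 108 = true := by decide +kernel
lemma bx20 : chkA3 98 2 9 116 = true := by decide +kernel
lemma bx21 : chkA3 102 2 9 125 = true := by decide +kernel
lemma bx22 : chkA3 106 2 9 134 = true := by decide +kernel
end G2RH


namespace G2RH
open Complex
set_option maxRecDepth 100000

def XTn (n : ℕ) : TM := (XT ⟨TM.qu ((2*n-1)^2), ⟨[], 0⟩⟩ 9 400).a
noncomputable def Xn (n : ℕ) : ℝ := Xr n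

lemma XTn_mem (n : ℕ) (hn1 : 1 ≤ n) (hn : n ≤ 12) : Mem 0 (XTn n) (Xn n) := by
  have h := XT_mem (y := 0) (by simp) (W := ⟨TM.qu ((2*n-1)^2), ⟨[], 0⟩⟩) (z := ((n - 1/2 : ℝ) : ℂ))
    (N := 9) (k := 400) ?_ (by norm_num) (by norm_num) ?_
  · have e : (1/2 + ((n - 1/2 : ℝ) : ℂ)) = ((n:ℝ):ℂ) := by push_cast; ring
    rw [e, X_ofReal] at h
    exact h.1
  · rw [← ofReal_pow]
    refine CMem.re (Mem.qu _ ?_)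
    push_cast; ring
  · rw [norm_pow, norm_real, Real.norm_eq_abs, sq_abs]
    have h1 : (1:ℝ) ≤ n := by exact_mod_cast hn1
    have h2 : (n:ℝ) ≤ 12 := by exact_mod_cast hn
    have : (n - 1/2 : ℝ)^2 ≤ (23/2)^2 := by
      apply pow_le_pow_left₀ <;> linarith
    simp only [nd]; norm_num at this ⊢; linarith

def cI (l : ℤ) : TM := ⟨[l], 0⟩
lemma cI_mem (l : ℤ) : Mem 0 (cI l) ((l:ℝ) / 2^180) := by
  apply Mem.mk1
  rw [div_mul_cancel₀ _ (by positivity)]; simp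

/-- test `l ≤ a/b ≤ h` and `l' ≤ (m/8)(d/c - a/b)/(1 - (a/b)(d/c)) ≤ h'` -/
def chkN (a b d c : TM) (m : ℤ) (l h l' h' : ℤ) : Bool :=
  (a.sub ((cI l).mul b)).pos && (((cI h).mul b).sub a).pos &&
  (((TM.qu (4*m)).mul ((d.mul b).sub (a.mul c))).sub (((TM.qu 32).mul (cI l')).mul ((b.mul c).sub (a.mul d)))).pos &&
  ((((TM.qu 32).mul (cI h')).mul ((b.mul c).sub (a.mul d))).sub ((TM.qu (4*m)).mul ((d.mul b).sub (a.mul c)))).pos &&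
  ((b.mul c).sub (a.mul d)).pos

lemma chkN_mem {a b c d : TM} {a' b' c' d' : ℝ} {m l h l1 h1 : ℤ} (ha : Mem 0 a a') (hb : Mem 0 b b')
    (hc : Mem 0 c c') (hd : Mem 0 d d') (hb0 : 0 < b') (hc0 : 0 < c') (hk : chkN a b d c m l h l1 h1 = true) :
    ∃ H : ℝ, (d'/c' - a'/b') * m = 8 * H * (1 - a'/b' * (d'/c')) ∧ (l:ℝ) ≤ a'/b' * 2^180 ∧ a'/b' * 2^180 ≤ h ∧
      (l1:ℝ) ≤ H * 2^180 ∧ H * 2^180 ≤ h1 := by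
  simp only [chkN, Bool.and_eq_true] at hk
  obtain ⟨⟨⟨⟨k1, k2⟩, k3⟩, k4⟩, k5⟩ := hk
  have y0 : |(0:ℝ)| ≤ 1 := by simp
  have p1 := Mem.pos y0 (ha.sub ((cI_mem l).mul y0 hb)) k1
  have p2 := Mem.pos y0 (((cI_mem h).mul y0 hb).sub ha) k2
  have hm : Mem 0 (TM.qu (4*m)) (m:ℝ) := Mem.qu _ (by push_cast; ring)
  have h8 : Mem 0 (TM.qu 32) (8:ℝ) := Mem.qu _ (by norm_num)
  have q1 := hm.mul y0 ((hd.mul y0 hb).sub (ha.mul y0 hc))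
  have q2 := (hb.mul y0 hc).sub (ha.mul y0 hd)
  have p3 := Mem.pos y0 (q1.sub ((h8.mul y0 (cI_mem l1)).mul y0 q2)) k3
  have p4 := Mem.pos y0 (((h8.mul y0 (cI_mem h1)).mul y0 q2).sub q1) k4
  have p5 := Mem.pos y0 q2 k5
  have hS : (0:ℝ) < 2^180 := by positivity
  have e8 : 0 < 8 * (b'*c' - a'*d') := by linarith
  refine ⟨m * (d'*b' - a'*c') / (8 * (b'*c' - a'*d')), ?_, ?_, ?_, ?_, ?_⟩
  · have : b'*c' - a'*d' ≠ 0 := p5.ne'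
    have i1 : d'/c' - a'/b' = (d'*b' - a'*c') / (b'*c') := by field_simp
    have i2 : 1 - a'/b' * (d'/c') = (b'*c' - a'*d') / (b'*c') := by field_simp
    rw [i1, i2]
    generalize d'*b' - a'*c' = u at *
    generalize b'*c' - a'*d' = v at *
    field_simp
  · rw [← div_le_iff₀ hS, le_div_iff₀ hb0]; linarith
  · rw [← le_div_iff₀ hS, div_le_iff₀ hb0]; linarith
  · rw [← div_le_iff₀ hS, le_div_iff₀ e8]; linarith
  · rw [← le_div_iff₀ hS, div_le_iff₀ e8]; linarith

lemma chkN1 : chkN (XTn 3) (XTn 4) (XTn 11) (XTn 12) 14 (1336769870806009012151256121383491976615650051599064801) (1336772935797090743928972838077546277234017289077309169) (-1395588393734652191772391489762355166383258277408185020) (-1395496444002200238440889988940726147832241153060854004) = true := by decide +kernel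
lemma chkN2 : chkN (XTn 2) (XTn 4) (XTn 10) (XTn 12) 13 (1219519670479928380975596197082096440267330212482879601) (1219522735471010112753312913776150740885697449961123969) (-1387431350537192300388307060676421350232479247079213050) (-1387400700626374982611139893735878344048806872296769377) = true := by decide +kernel

def gAT : TM := TM.ivl (1336769870806009012151256121383491976615650051599064801) (1336772935797090743928972838077546277234017289077309169)
def hAT : TM := TM.ivl (-1395588393734652191772391489762355166383258277408185020) (-1395496444002200238440889988940726147832241153060854004)
def gBT : TM := TM.ivl (1219519670479928380975596197082096440267330212482879601) (1219522735471010112753312913776150740885697449961123969)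
def hBT : TM := TM.ivl (-1387431350537192300388307060676421350232479247079213050) (-1387400700626374982611139893735878344048806872296769377)

lemma Xn_pos (n : ℕ) (hn : 1 ≤ n) : 0 < Xn n := by
  have := Xr_pos (x := n) (by exact_mod_cast hn)
  unfold Xn; linarith

lemma npA : ∃ g g2 h : ℝ, g = Xn 3 / Xn 4 ∧ g2 = Xn 11 / Xn 12 ∧ (g2 - g) * 14 = 8 * h * (1 - g * g2) ∧
    |g| < 1 ∧ |h| < 1 ∧ ∀ y : ℝ, Mem y gAT g ∧ Mem y hAT h := by
  obtain ⟨H, e1, e2, e3, e4, e5⟩ := chkN_mem (XTn_mem 3 (by norm_num) (by norm_num)) (XTn_mem 4 (by norm_num) (by norm_num))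
    (XTn_mem 12 (by norm_num) (by norm_num)) (XTn_mem 11 (by norm_num) (by norm_num)) (Xn_pos 4 (by norm_num)) (Xn_pos 12 (by norm_num)) chkN1
  refine ⟨_, _, H, rfl, rfl, by exact_mod_cast e1, ?_, ?_, fun y => ⟨Mem.ivl e2 e3, Mem.ivl e4 e5⟩⟩
  · rw [abs_lt]; push_cast at e2 e3; norm_num at e2 e3; constructor <;> linarith
  · rw [abs_lt]; push_cast at e4 e5; norm_num at e4 e5; constructor <;> linarith

lemma npB : ∃ g g2 h : ℝ, g = Xn 2 / Xn 4 ∧ g2 = Xn 10 / Xn 12 ∧ (g2 - g) * 13 = 8 * h * (1 - g * g2) ∧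
    |g| < 1 ∧ |h| < 1 ∧ ∀ y : ℝ, Mem y gBT g ∧ Mem y hBT h := by
  obtain ⟨H, e1, e2, e3, e4, e5⟩ := chkN_mem (XTn_mem 2 (by norm_num) (by norm_num)) (XTn_mem 4 (by norm_num) (by norm_num))
    (XTn_mem 12 (by norm_num) (by norm_num)) (XTn_mem 10 (by norm_num) (by norm_num)) (Xn_pos 4 (by norm_num)) (Xn_pos 12 (by norm_num)) chkN2
  refine ⟨_, _, H, rfl, rfl, by exact_mod_cast e1, ?_, ?_, fun y => ⟨Mem.ivl e2 e3, Mem.ivl e4 e5⟩⟩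
  · rw [abs_lt]; push_cast at e2 e3; norm_num at e2 e3; constructor <;> linarith
  · rw [abs_lt]; push_cast at e4 e5; norm_num at e4 e5; constructor <;> linarith

end G2RH


namespace G2RH
open Complex

noncomputable def Df (g h : ℝ) (n0 b0 b1 : ℂ) : ℂ := b1 * (b0 + ((g*h : ℝ) : ℂ) * n0)
noncomputable def Bf (g h : ℝ) (n0 b0 b1 : ℂ) : ℂ := b1 * ((g : ℂ) * b0 + (h : ℂ) * n0)
noncomputable def Af (g h : ℝ) (n0 n1 b0 : ℂ) : ℂ := n1 * (((g*h : ℝ) : ℂ) * b0 + n0)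
noncomputable def Cf (g h : ℝ) (n0 n1 b0 : ℂ) : ℂ := n1 * ((h : ℂ) * b0 + (g : ℂ) * n0)
noncomputable def Mf (g h : ℝ) (n0 n1 b0 b1 : ℂ) : ℝ := normSq (Df g h n0 b0 b1) - normSq (Cf g h n0 n1 b0)
noncomputable def Nf (g h : ℝ) (n0 n1 b0 b1 : ℂ) : ℂ :=
  Bf g h n0 b0 b1 * (starRingEnd ℂ) (Df g h n0 b0 b1) - Af g h n0 n1 b0 * (starRingEnd ℂ) (Cf g h n0 n1 b0)

def DfT (g h : TM) (n0 b0 b1 : CT) : CT := b1.mul (b0.add (CT.sc (g.mul h) n0))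
def BfT (g h : TM) (n0 b0 b1 : CT) : CT := b1.mul ((CT.sc g b0).add (CT.sc h n0))
def AfT (g h : TM) (n0 n1 b0 : CT) : CT := n1.mul ((CT.sc (g.mul h) b0).add n0)
def CfT (g h : TM) (n0 n1 b0 : CT) : CT := n1.mul ((CT.sc h b0).add (CT.sc g n0))
def MfT (g h : TM) (n0 n1 b0 b1 : CT) : TM := (DfT g h n0 b0 b1).nsq.sub (CfT g h n0 n1 b0).nsq
def NfT (g h : TM) (n0 n1 b0 b1 : CT) : CT :=
  ((BfT g h n0 b0 b1).mul (DfT g h n0 b0 b1).conj).sub ((AfT g h n0 n1 b0).mul (CfT g h n0 n1 b0).conj)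

section
variable {y : ℝ}
lemma disc_mem (hy : |y| ≤ 1) {g h : TM} {n0 n1 b0 b1 : CT} {g' h' : ℝ} {n0' n1' b0' b1' : ℂ}
    (hg : Mem y g g') (hh : Mem y h h') (h0 : CMem y n0 n0') (h1 : CMem y n1 n1') (k0 : CMem y b0 b0')
    (k1 : CMem y b1 b1') :
    Mem y (MfT g h n0 n1 b0 b1) (Mf g' h' n0' n1' b0' b1') ∧ CMem y (NfT g h n0 n1 b0 b1) (Nf g' h' n0' n1' b0' b1') := by
  have hD : CMem y (DfT g h n0 b0 b1) (Df g' h' n0' b0' b1') := k1.mul hy (k0.add (CMem.sc hy (hg.mul hy hh) h0))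
  have hB : CMem y (BfT g h n0 b0 b1) (Bf g' h' n0' b0' b1') := k1.mul hy ((CMem.sc hy hg k0).add (CMem.sc hy hh h0))
  have hA : CMem y (AfT g h n0 n1 b0) (Af g' h' n0' n1' b0') := h1.mul hy ((CMem.sc hy (hg.mul hy hh) k0).add h0)
  have hC : CMem y (CfT g h n0 n1 b0) (Cf g' h' n0' n1' b0') := h1.mul hy ((CMem.sc hy hh k0).add (CMem.sc hy hg h0))
  exact ⟨(hD.nsq hy).sub (hC.nsq hy), (hB.mul hy hD.conj).sub (hA.mul hy hC.conj)⟩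

/-- upper bound for the square root -/
def sqT (k : ℕ) (q : TM) : TM := (TM.qu 2).mul (TM.add ⟨[Int.mul k (2^160)], 0⟩ (q.mul ⟨[Int.ediv (2^200) k], 1⟩))
noncomputable def sqR (k : ℕ) (q : ℝ) : ℝ := 1/2 * (k / 2^20 + q * (2^20 / k))

lemma sqT_mem (hy : |y| ≤ 1) {k : ℕ} (hk : 0 < k) {q : TM} {q' : ℝ} (hq : Mem y q q') :
    Mem y (sqT k q) (sqR k q') := by
  refine (Mem.qu 2 (by norm_num)).mul hy (Mem.add ?_ (hq.mul hy ?_))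
  · apply Mem.mk1
    have : ((Int.mul k (2^160) : ℤ) : ℝ) = k * 2^160 := by
      change (((k:ℤ) * 2^160 : ℤ) : ℝ) = _
      push_cast; norm_num
    rw [this]
    norm_num
    ring
  · apply Mem.mk1
    change |(2^20 / (k:ℝ)) * 2^180 - (((2^200 : ℤ) / (k:ℤ) : ℤ) : ℝ)| ≤ ((1:ℕ):ℝ)
    have hk' : (0:ℝ) < k := by exact_mod_cast hk
    have hkz : (0:ℤ) < k := by exact_mod_cast hk
    set m : ℤ := (2^200 : ℤ) / (k:ℤ) with hm
    have m1 : m * k ≤ 2^200 := Int.ediv_mul_le _ hkz.ne'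
    have m2 : (2^200 : ℤ) < (m + 1) * k := Int.lt_ediv_add_one_mul_self _ hkz
    have m1' : (m:ℝ) * k ≤ 2^200 := by
      have := (Int.cast_le (R := ℝ)).2 m1
      push_cast at this; norm_num at this ⊢; linarith
    have m2' : (2:ℝ)^200 < (m + 1) * k := by
      have := (Int.cast_lt (R := ℝ)).2 m2
      push_cast at this; norm_num at this ⊢; linarith
    have e : (2^20 / (k:ℝ)) * 2^180 = 2^200 / k := by field_simp
    rw [e, abs_le]
    constructor
    · have := (le_div_iff₀ hk').2 m1'
      push_cast; linarith
    · have := (div_lt_iff₀ hk').2 m2'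
      push_cast; linarith

lemma le_sqR {k : ℕ} (hk : 0 < k) {x q : ℝ} (hx : x^2 = q) : x ≤ sqR k q := by
  have hk' : (0:ℝ) < k := by exact_mod_cast hk
  unfold sqR
  have h1 : (0:ℝ) < k / 2^20 := by positivity
  have h2 : (2^20 / (k:ℝ)) = (k / 2^20 : ℝ)⁻¹ := by rw [inv_div]
  rw [h2, ← hx]
  generalize (k / 2^20 : ℝ) = c at *
  have h3 : 0 ≤ (x - c)^2 * c⁻¹ := by positivity
  have h4 : (x - c)^2 * c⁻¹ = x^2 * c⁻¹ - 2 * x + c := by field_simp; ring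
  linarith
end

/-! the function `k` -/

noncomputable def kf (s : ℂ) : ℂ :=
  (s-1) * m3 s + (1-c2) * (-2 * (s-3) * (X (s+1) / X (s+2))) +
  c2 * (-2 * (X (2*s-1) / X (2*s)) * (X (s-1) / X (s+2)) * (s*(s+1)*(s+2) / ((s-1)*(s-2)))) +
  (1-c3) * (-((s-3)*(s+2)/(s-1)) * (X s / X (s+2))) +
  c3 * (-((s-3)*(s+2)*(s+1)/((s-1)*(s-2))) * (X s / X (s+2)) * (X (2*s-1) / X (2*s)))

noncomputable def E0 (s : ℂ) : ℂ := (s+7) * (starRingEnd ℂ) (s * m3 s * (s+3/2))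

lemma G1_le {s : ℂ} (hs : -1 ≤ s.re) : ‖X (s+1) / X (s+2)‖ ≤ 1 := by
  rw [norm_div]
  have h := X_cmp (a := 1/2) le_rfl (v := s + 3/2) (by simp; linarith)
  rw [show s + 3/2 - ((1/2:ℝ):ℂ) = s + 1 by push_cast; ring, show s + 3/2 + ((1/2:ℝ):ℂ) = s + 2 by push_cast; ring] at h
  exact div_le_one_of_le₀ h (norm_nonneg _)

lemma G2_le {s : ℂ} (hs : -1/2 ≤ s.re) : ‖X s / X (s+2)‖ ≤ 1 := by
  rw [norm_div]
  have h := X_cmp (a := 1) (by norm_num) (v := s + 1) (by simp; linarith)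
  rw [show s + 1 - ((1:ℝ):ℂ) = s by push_cast; ring, show s + 1 + ((1:ℝ):ℂ) = s + 2 by push_cast; ring] at h
  exact div_le_one_of_le₀ h (norm_nonneg _)

lemma G3_le {s : ℂ} (hs : 1/2 ≤ s.re) : ‖X (s-1) / X (s+2)‖ ≤ 1 := by
  rw [norm_div]
  have h := X_cmp (a := 3/2) (by norm_num) (v := s + 1/2) (by simp; linarith)
  rw [show s + 1/2 - ((3/2:ℝ):ℂ) = s - 1 by push_cast; ring, show s + 1/2 + ((3/2:ℝ):ℂ) = s + 2 by push_cast; ring] at h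
  exact div_le_one_of_le₀ h (norm_nonneg _)

lemma G4_le {s : ℂ} (hs : 1/2 ≤ s.re) : ‖X (s-2) / X (s+2)‖ ≤ 1 := by
  rw [norm_div]
  have h := X_cmp (a := 2) (by norm_num) (v := s) hs
  push_cast at h
  exact div_le_one_of_le₀ h (norm_nonneg _)

lemma U_le {s : ℂ} (hs : 1/2 ≤ s.re) : ‖X (2*s-1) / X (2*s)‖ ≤ 1 := by
  rw [norm_div]
  have h := X_cmp (a := 1/2) le_rfl (v := 2*s - 1/2) (by simp; linarith)
  rw [show 2*s - 1/2 - ((1/2:ℝ):ℂ) = 2*s - 1 by push_cast; ring, show 2*s - 1/2 + ((1/2:ℝ):ℂ) = 2*s by push_cast; ring] at h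
  exact div_le_one_of_le₀ h (norm_nonneg _)

lemma c2_mem' : 0 < c2 ∧ c2 < 1 := by
  have h := C2_mem (y := 0)
  unfold Mem at h; simp only [C2, pev] at h
  rw [abs_le] at h; norm_num at h
  constructor <;> linarith
lemma c3_mem' : 0 < c3 ∧ c3 < 1 := by
  have h := C3_mem (y := 0)
  unfold Mem at h; simp only [C3, pev] at h
  rw [abs_le] at h; norm_num at h
  constructor <;> linarith

/-- moduli on the line -/
lemma nq (x t : ℝ) {z : ℂ} (h : z = ⟨x, t⟩) : ‖z‖^2 = x^2 + t^2 := by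
  rw [h, ← normSq_eq_norm_sq, normSq_mk]; ring

end G2RH


namespace G2RH
open Complex

lemma sl_n0 (t : ℝ) : ‖sl t‖^2 = t*t+1/4 := by rw [nq (1/2) t (z := sl t) rfl]; ring
lemma sl_n1 (t : ℝ) : ‖sl t - 1‖ = ‖sl t‖ := by
  have h : ‖sl t - 1‖^2 = ‖sl t‖^2 := by
    rw [sl_n0, nq (-1/2) t (by apply Complex.ext <;> simp [sl]; norm_num)]; ring
  exact (pow_left_inj₀ (norm_nonneg _) (norm_nonneg _) two_ne_zero).1 h
lemma sl_n2 (t : ℝ) : ‖sl t - 2‖ = ‖sl t + 1‖ := by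
  have h : ‖sl t - 2‖^2 = ‖sl t + 1‖^2 := by
    rw [nq (3/2) t (z := sl t + 1) (by apply Complex.ext <;> simp [sl]; norm_num), nq (-3/2) t (by apply Complex.ext <;> simp [sl]; norm_num)]; ring
  exact (pow_left_inj₀ (norm_nonneg _) (norm_nonneg _) two_ne_zero).1 h
lemma sl_n3' (t : ℝ) : ‖sl t - 3‖^2 = t*t+25/4 := by
  rw [nq (-5/2) t (by apply Complex.ext <;> simp [sl]; norm_num)]; ring
lemma sl_n3 (t : ℝ) : ‖sl t - 3‖ = ‖sl t + 2‖ := by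
  have h : ‖sl t - 3‖^2 = ‖sl t + 2‖^2 := by
    rw [nq (5/2) t (z := sl t + 2) (by apply Complex.ext <;> simp [sl]; norm_num), sl_n3']; ring
  exact (pow_left_inj₀ (norm_nonneg _) (norm_nonneg _) two_ne_zero).1 h
lemma sl_ne (t : ℝ) (x : ℝ) (hx : x ≠ 1/2) : sl t - x ≠ 0 := by
  intro h
  have := congrArg Complex.re h
  simp [sl] at this
  exact hx (by linarith)
lemma sl0 (t : ℝ) : sl t ≠ 0 := by simpa using sl_ne t 0 (by norm_num)
lemma sl1 (t : ℝ) : sl t - 1 ≠ 0 := by simpa using sl_ne t 1 (by norm_num)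
lemma sl2 (t : ℝ) : sl t - 2 ≠ 0 := by simpa using sl_ne t 2 (by norm_num)
lemma sl3 (t : ℝ) : sl t - 3 ≠ 0 := by simpa using sl_ne t 3 (by norm_num)
lemma sl_q3 (t : ℝ) : (sl t - 3) * (sl t + 2) = -((t*t+25/4 : ℝ) : ℂ) := by
  apply Complex.ext <;> simp [sl] <;> ring
lemma sl_q1 (t : ℝ) : sl t * (sl t - 1) = -((t*t+1/4 : ℝ) : ℂ) := by
  apply Complex.ext <;> simp [sl] <;> ring

/-- the terms with `U` -/
noncomputable def t5f (s : ℂ) : ℂ := (-2 * (X (2*s-1) / X (2*s)) * (X (s-1) / X (s+2)) * (s*(s+1)*(s+2) / ((s-1)*(s-2))))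
noncomputable def t8f (s : ℂ) : ℂ := (-((s-3)*(s+2)*(s+1)/((s-1)*(s-2))) * (X s / X (s+2)) * (X (2*s-1) / X (2*s)))

lemma t5_le (t : ℝ) : ‖t5f (sl t)‖ ≤ 2 * ‖sl t - 3‖ := by
  have hU := U_le (s := sl t) (by simp [sl])
  have hG := G3_le (s := sl t) (by simp [sl])
  have e : ‖sl t*(sl t+1)*(sl t+2) / ((sl t-1)*(sl t-2))‖ = ‖sl t - 3‖ := by
    rw [norm_div, norm_mul, norm_mul, norm_mul, sl_n1, sl_n2, sl_n3]
    have h0 : ‖sl t‖ ≠ 0 := norm_ne_zero_iff.2 (sl0 t)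
    have h1 : ‖sl t + 1‖ ≠ 0 := by rw [← sl_n2]; exact norm_ne_zero_iff.2 (sl2 t)
    field_simp
  unfold t5f
  rw [norm_mul, norm_mul, norm_mul, e]
  have : ‖X (2*sl t-1) / X (2*sl t)‖ * ‖X (sl t-1) / X (sl t+2)‖ ≤ 1 := mul_le_one₀ hU (norm_nonneg _) hG
  have h2 : ‖(-2:ℂ)‖ = 2 := by simp
  rw [h2]
  nlinarith [norm_nonneg (sl t - 3)]

lemma t8_le (t : ℝ) : ‖sl t‖ * ‖t8f (sl t)‖ ≤ t*t+25/4 := by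
  have hU := U_le (s := sl t) (by simp [sl])
  have hG := G2_le (s := sl t) (by simp [sl]; norm_num)
  have e : ‖sl t‖ * ‖-((sl t-3)*(sl t+2)*(sl t+1) / ((sl t-1)*(sl t-2)))‖ = t*t+25/4 := by
    rw [norm_neg, norm_div, sl_q3, norm_mul, norm_mul, sl_n1, sl_n2, norm_neg, norm_real, Real.norm_of_nonneg (by nlinarith [mul_self_nonneg t])]
    have h0 : ‖sl t‖ ≠ 0 := norm_ne_zero_iff.2 (sl0 t)
    have h1 : ‖sl t + 1‖ ≠ 0 := by rw [← sl_n2]; exact norm_ne_zero_iff.2 (sl2 t)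
    field_simp
  unfold t8f
  rw [norm_mul, norm_mul, ← mul_assoc, ← mul_assoc, e, mul_assoc]
  have : ‖X (sl t) / X (sl t+2)‖ * ‖X (2*sl t-1) / X (2*sl t)‖ ≤ 1 := mul_le_one₀ hG (norm_nonneg _) hU
  nlinarith [mul_self_nonneg t]

noncomputable def Mn (s : ℂ) (q1 q3 M1 M2 : ℝ) (N1 N2 : ℂ) : ℂ :=
  ((q1*M1*M2 : ℝ) : ℂ) * ((s-1) * m3 s) - ((2*(1-c2)*q1*M2 : ℝ) : ℂ) * ((s-3)*N1) - (((1-c3)*q3*M1 : ℝ):ℂ) * (s*N2)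

lemma re_ge (a b : ℂ) : -(‖a‖*‖b‖) ≤ (a*b).re := by
  have := abs_re_le_norm (a*b)
  rw [norm_mul] at this
  exact (abs_le.1 this).1

lemma B_core {t M1 M2 ρ1 ρ2 e0 r13 : ℝ} {N1 N2 : ℂ} (hM1 : 0 < M1) (hM2 : 0 < M2)
    (d1 : ‖X (sl t+1) / X (sl t+2) * M1 - N1‖ ≤ ρ1) (d2 : ‖X (sl t) / X (sl t+2) * M2 - N2‖ ≤ ρ2)
    (he : ‖m3 (sl t)‖ * ‖(sl t + 7) * (sl t + 3/2)‖ ≤ e0) (hr : ‖sl t‖ * ‖sl t - 3‖ ≤ r13)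
    (hpos : 0 < (E0 (sl t) * Mn (sl t) (t*t+1/4) (t*t+25/4) M1 M2 N1 N2).re -
      (t*t+1/4) * e0 * (2 * r13 * ((1-c2) * ρ1 * M2 + c2 * (M1*M2)) +
        (t*t+25/4) * ((1-c3) * ρ2 * M1 + c3 * (M1*M2)))) :
    0 < (kf (sl t) * E0 (sl t)).re := by
  obtain ⟨c20, c21⟩ := c2_mem'
  obtain ⟨c30, c31⟩ := c3_mem'
  have h5 := t5_le t
  have h8 := t8_le t
  have hq1 := sl_n0 t
  have hq3 := sl_n3' t
  have key : (((t*t+1/4) * M1 * M2 : ℝ) : ℂ) * (kf (sl t) * E0 (sl t)) =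
      E0 (sl t) * Mn (sl t) (t*t+1/4) (t*t+25/4) M1 M2 N1 N2 +
      E0 (sl t) * (-((2*(1-c2)*(t*t+1/4)*M2 : ℝ) : ℂ) * ((sl t-3) * (X (sl t+1) / X (sl t+2) * M1 - N1)) +
        -(((1-c3)*(t*t+25/4)*M1 : ℝ):ℂ) * (sl t * (X (sl t) / X (sl t+2) * M2 - N2)) +
        (((t*t+1/4) * M1 * M2 *c2 : ℝ) : ℂ) * t5f (sl t) + (((t*t+1/4) * M1 * M2 *c3 : ℝ) : ℂ) * t8f (sl t)) := by
    have e7 : -((sl t-3)*(sl t+2)/(sl t-1)) * ((t*t+1/4 : ℝ) : ℂ) = -((t*t+25/4 : ℝ) : ℂ) * sl t := by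
      have : ((t*t+1/4 : ℝ) : ℂ) = -(sl t * (sl t - 1)) := by rw [sl_q1]; ring
      rw [this, sl_q3]
      field_simp [sl1 t]
    have e := congrArg (fun z => z * ((1-c3) * (X (sl t) / X (sl t+2)) * M1 * M2 * E0 (sl t))) e7
    unfold kf Mn t5f t8f
    push_cast at e ⊢
    linear_combination e
  have hre := congrArg Complex.re key
  rw [re_ofReal_mul, add_re] at hre
  have hb := re_ge (E0 (sl t)) (-((2*(1-c2)*(t*t+1/4)*M2 : ℝ) : ℂ) * ((sl t-3) * (X (sl t+1) / X (sl t+2) * M1 - N1)) +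
        -(((1-c3)*(t*t+25/4)*M1 : ℝ):ℂ) * (sl t * (X (sl t) / X (sl t+2) * M2 - N2)) +
        (((t*t+1/4) * M1 * M2 *c2 : ℝ) : ℂ) * t5f (sl t) + (((t*t+1/4) * M1 * M2 *c3 : ℝ) : ℂ) * t8f (sl t))
  have hE : ‖E0 (sl t)‖ = ‖sl t‖ * (‖m3 (sl t)‖ * ‖(sl t + 7) * (sl t + 3/2)‖) := by
    unfold E0; rw [norm_mul, norm_conj]; simp only [norm_mul]; ring
  set q1 := t*t+1/4 with hq1d
  set q3 := t*t+25/4 with hq3d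
  have q1p : 0 < q1 := by nlinarith [mul_self_nonneg t]
  have q3p : 0 < q3 := by nlinarith [mul_self_nonneg t]
  have hn : ∀ x : ℝ, 0 ≤ x → ‖(x:ℂ)‖ = x := fun x hx => by rw [norm_real, Real.norm_of_nonneg hx]
  set S := ‖sl t‖ with hS
  set Q := ‖sl t - 3‖ with hQ
  have S0 : 0 ≤ S := norm_nonneg _
  have Q0 : 0 ≤ Q := norm_nonneg _
  have a1 : 0 ≤ 2*(1-c2)*q1*M2 := by have := sub_pos.2 c21; positivity
  have a2 : 0 ≤ (1-c3)*q3*M1 := by have := sub_pos.2 c31; positivity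
  have a3 : 0 ≤ q1*M1*M2*c2 := by positivity
  have a4 : 0 ≤ q1*M1*M2*c3 := by positivity
  have hsum : S * ‖(-((2*(1-c2)*q1*M2 : ℝ) : ℂ) * ((sl t-3) * (X (sl t+1) / X (sl t+2) * M1 - N1)) +
        -(((1-c3)*q3*M1 : ℝ):ℂ) * (sl t * (X (sl t) / X (sl t+2) * M2 - N2)) +
        ((q1 * M1 * M2 *c2 : ℝ) : ℂ) * t5f (sl t) + ((q1 * M1 * M2 *c3 : ℝ) : ℂ) * t8f (sl t))‖ ≤
      2*(1-c2)*q1*M2*((S*Q)*ρ1) + (1-c3)*q3*M1*(S^2*ρ2) + q1*M1*M2*c2*(2*(S*Q)) + q1*M1*M2*c3*q3 := by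
    refine (mul_le_mul_of_nonneg_left (norm_add₄_le) S0).trans ?_
    rw [norm_mul, norm_mul, norm_mul, norm_mul, norm_mul, norm_mul, norm_neg, norm_neg, hn _ a1, hn _ a2, hn _ a3, hn _ a4]
    rw [← hS, ← hQ]
    rw [mul_add, mul_add, mul_add]
    have i1 := mul_le_mul_of_nonneg_left d1 (mul_nonneg a1 (mul_nonneg S0 Q0))
    have i2 := mul_le_mul_of_nonneg_left d2 (mul_nonneg a2 (mul_nonneg S0 S0))
    have i3 := mul_le_mul_of_nonneg_left h5 (mul_nonneg a3 S0)
    have i4 := mul_le_mul_of_nonneg_left h8 a4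
    linarith
  set Y := ‖(-((2*(1-c2)*q1*M2 : ℝ) : ℂ) * ((sl t-3) * (X (sl t+1) / X (sl t+2) * M1 - N1)) +
        -(((1-c3)*q3*M1 : ℝ):ℂ) * (sl t * (X (sl t) / X (sl t+2) * M2 - N2)) +
        ((q1 * M1 * M2 *c2 : ℝ) : ℂ) * t5f (sl t) + ((q1 * M1 * M2 *c3 : ℝ) : ℂ) * t8f (sl t))‖
  have ρ10 : 0 ≤ ρ1 := (norm_nonneg _).trans d1
  have ρ20 : 0 ≤ ρ2 := (norm_nonneg _).trans d2
  set w := ‖m3 (sl t)‖ * ‖(sl t + 7) * (sl t + 3/2)‖ with hw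
  have w0 : 0 ≤ w := by positivity
  have f1 : ‖E0 (sl t)‖ * Y ≤ q1 * e0 * (2 * r13 * ((1-c2) * ρ1 * M2 + c2 * (M1*M2)) +
        q3 * ((1-c3) * ρ2 * M1 + c3 * (M1*M2))) := by
    rw [hE]
    have e : S * w * Y = w * (S * Y) := by ring
    rw [e]
    have g1 : S * Y ≤ q1 * (2 * r13 * ((1-c2) * ρ1 * M2 + c2 * (M1*M2)) +
        q3 * ((1-c3) * ρ2 * M1 + c3 * (M1*M2))) := by
      refine hsum.trans ?_
      rw [hq1]
      have i : (S*Q) * (q1 * (2 * ((1-c2) * ρ1 * M2 + c2 * (M1*M2)))) ≤ r13 * (q1 * (2 * ((1-c2) * ρ1 * M2 + c2 * (M1*M2)))) := by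
        refine mul_le_mul_of_nonneg_right hr ?_
        have := sub_pos.2 c21; positivity
      linarith
    have : w * (S * Y) ≤ e0 * (q1 * (2 * r13 * ((1-c2) * ρ1 * M2 + c2 * (M1*M2)) +
        q3 * ((1-c3) * ρ2 * M1 + c3 * (M1*M2)))) :=
      mul_le_mul he g1 (mul_nonneg S0 (norm_nonneg _)) (w0.trans he)
    linarith
  have : 0 < (q1*M1*M2) * (kf (sl t) * E0 (sl t)).re := by rw [hre]; linarith
  exact pos_of_mul_pos_right this (by positivity)

end G2RH


namespace G2RH
open Complex

def E0T (m : CT) (p : TM) : CT := (shT 30 p).mul (((shT 2 p).mul m).mul (shT 8 p)).conj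
def MnT (m : CT) (p q1 q3 M1 M2 : TM) (N1 N2 : CT) : CT :=
  ((CT.sc ((q1.mul M1).mul M2) ((shT (-2) p).mul m)).sub
    (CT.sc ((((TM.qu 8).mul ((TM.qu 4).sub C2)).mul q1).mul M2) ((shT (-10) p).mul N1))).sub
    (CT.sc ((((TM.qu 4).sub C3).mul q3).mul M1) ((shT 2 p).mul N2))
def fnT (m : CT) (p q1 q3 M1 M2 : TM) (N1 N2 : CT) (r1 r2 e0 r13 : TM) : TM :=
  ((E0T m p).mul (MnT m p q1 q3 M1 M2 N1 N2)).a.sub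
    ((q1.mul e0).mul ((((TM.qu 8).mul r13).mul (((((TM.qu 4).sub C2).mul r1).mul M2).add (C2.mul (M1.mul M2)))).add
      (q3.mul (((((TM.qu 4).sub C3).mul r2).mul M1).add (C3.mul (M1.mul M2))))))
/-- product of two moduli squared -/
def ppT (T : TM) (a b : ℤ) : TM := (T.add (TM.qu a)).mul (T.add (TM.qu b))
def rdT (g h : TM) (k l : ℕ) (q r : TM) : TM :=
  (((TM.qu 4).sub (g.mul g)).mul ((TM.qu 4).sub (h.mul h))).mul ((sqT k q).mul (sqT l r))

def okB (m : CT) (p T M1 M2 : TM) (N1 N2 : CT) (a b c d e f : ℕ) : Bool :=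
  M1.pos && M2.pos &&
  (fnT m p (T.add (TM.qu 1)) (T.add (TM.qu 25)) M1 M2 N1 N2
    (rdT gAT hAT d e (ppT T 9 361) (ppT T 81 625)) (rdT gBT hBT d f (ppT T 9 361) (ppT T 49 529))
    ((sqT a m.nsq).mul (sqT b (ppT T 225 16))) (sqT c (ppT T 1 25))).pos

def chkB1 (p T : TM) (a b c d e f : ℕ) : Bool :=
  okB (m3T p) p T (MfT gAT hAT (shT (-6) p) (shT (-38) p) (shT 18 p) (shT 50 p))
    (MfT gBT hBT (shT (-6) p) (shT (-38) p) (shT 14 p) (shT 46 p))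
    (NfT gAT hAT (shT (-6) p) (shT (-38) p) (shT 18 p) (shT 50 p))
    (NfT gBT hBT (shT (-6) p) (shT (-38) p) (shT 14 p) (shT 46 p)) a b c d e f
def chkB (A H : ℤ) (a b c d e f : ℕ) : Bool := chkB1 (tT A H) ((tT A H).mul (tT A H)) a b c d e f

section
variable {y t : ℝ}

lemma sl_sh {p : TM} (hp : Mem y p t) (q : ℤ) {z : ℂ} (h : z = (q:ℂ)/4 - 1/2) : CMem y (shT q p) (sl t + z) :=
  shT_mem hp q (by
    have e : ((q:ℂ)/4 - 1/2) = (((q:ℝ)/4 - 1/2 : ℝ) : ℂ) := by push_cast; rfl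
    rw [h, e, add_re, ofReal_re]; simp [sl]) (by
    have e : ((q:ℂ)/4 - 1/2) = (((q:ℝ)/4 - 1/2 : ℝ) : ℂ) := by push_cast; rfl
    rw [h, e, add_im, ofReal_im]; simp [sl])

lemma sl_sh' {p : TM} (hp : Mem y p t) (q : ℤ) {z : ℂ} (h : -z = (q:ℂ)/4 - 1/2) : CMem y (shT q p) (sl t - z) := by
  rw [sub_eq_add_neg]; exact sl_sh hp q h

lemma fnT_mem (hy : |y| ≤ 1) {m N1 N2 : CT} {p q1 q3 M1 M2 r1 r2 e0 r13 : TM} {N1' N2' : ℂ}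
    {q1' q3' M1' M2' r1' r2' e0' r13' : ℝ} (hp : Mem y p t) (hm : CMem y m (m3 (sl t)))
    (hq1 : Mem y q1 q1') (hq3 : Mem y q3 q3') (hM1 : Mem y M1 M1') (hM2 : Mem y M2 M2')
    (hN1 : CMem y N1 N1') (hN2 : CMem y N2 N2') (hr1 : Mem y r1 r1') (hr2 : Mem y r2 r2')
    (he : Mem y e0 e0') (hr : Mem y r13 r13') :
    Mem y (fnT m p q1 q3 M1 M2 N1 N2 r1 r2 e0 r13)
      ((E0 (sl t) * Mn (sl t) q1' q3' M1' M2' N1' N2').re -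
      q1' * e0' * (2 * r13' * ((1-c2) * r1' * M2' + c2 * (M1'*M2')) +
        q3' * ((1-c3) * r2' * M1' + c3 * (M1'*M2')))) := by
  have s0 : CMem y (shT 2 p) (sl t) := by simpa using sl_sh hp 2 (z := 0) (by norm_num)
  have s1 : CMem y (shT (-2) p) (sl t - 1) := sl_sh' hp _ (by norm_num)
  have s3 : CMem y (shT (-10) p) (sl t - 3) := sl_sh' hp _ (by norm_num)
  have s7 : CMem y (shT 30 p) (sl t + 7) := sl_sh hp _ (by norm_num)
  have s8 : CMem y (shT 8 p) (sl t + 3/2) := sl_sh hp _ (by norm_num)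
  have one : Mem y (TM.qu 4) 1 := Mem.qu 4 (by norm_num)
  have two : Mem y (TM.qu 8) 2 := Mem.qu 8 (by norm_num)
  have d2 := one.sub (C2_mem (y := y))
  have d3 := one.sub (C3_mem (y := y))
  have hE : CMem y (E0T m p) (E0 (sl t)) := s7.mul hy ((s0.mul hy hm).mul hy s8).conj
  have hM : CMem y (MnT m p q1 q3 M1 M2 N1 N2) (Mn (sl t) q1' q3' M1' M2' N1' N2') :=
    ((CMem.sc hy ((hq1.mul hy hM1).mul hy hM2) (s1.mul hy hm)).sub
    (CMem.sc hy (((two.mul hy d2).mul hy hq1).mul hy hM2) (s3.mul hy hN1))).sub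
    (CMem.sc hy ((d3.mul hy hq3).mul hy hM1) (s0.mul hy hN2))
  exact (hE.mul hy hM).1.sub
    ((hq1.mul hy he).mul hy (((two.mul hy hr).mul hy (((d2.mul hy hr1).mul hy hM2).add (C2_mem.mul hy (hM1.mul hy hM2)))).add
      (hq3.mul hy (((d3.mul hy hr2).mul hy hM1).add (C3_mem.mul hy (hM1.mul hy hM2))))))

lemma ppT_mem (hy : |y| ≤ 1) {T : TM} {T' : ℝ} (hT : Mem y T T') (a b : ℤ) :
    Mem y (ppT T a b) ((T'+a/4)*(T'+b/4)) := (hT.add (Mem.qu a rfl)).mul hy (hT.add (Mem.qu b rfl))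

lemma rdT_mem (hy : |y| ≤ 1) {g h q r : TM} {g' h' q' r' : ℝ} (hg : Mem y g g') (hh : Mem y h h')
    {k l : ℕ} (hk : 0 < k) (hl : 0 < l) (hq : Mem y q q') (hr : Mem y r r') :
    Mem y (rdT g h k l q r) ((1-g'*g')*(1-h'*h')*(sqR k q' * sqR l r')) := by
  have one : Mem y (TM.qu 4) 1 := Mem.qu 4 (by norm_num)
  exact ((one.sub (hg.mul hy hg)).mul hy (one.sub (hh.mul hy hh))).mul hy ((sqT_mem hy hk hq).mul hy (sqT_mem hy hl hr))

lemma two_norm (t : ℝ) (z w : ℂ) (a b : ℤ) (x x' : ℝ) (hz : z = x) (hw : w = x') (ha : (1/2+x)^2 = a/4) (hb : (1/2+x')^2 = b/4) :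
    ‖(sl t + z) * (sl t + w)‖^2 = (t*t+a/4)*(t*t+b/4) := by
  rw [norm_mul, mul_pow, nq (1/2+x) t (z := sl t + z), nq (1/2+x') t (z := sl t + w), ha, hb]
  · ring
  · rw [hw]; apply Complex.ext <;> simp [sl]
  · rw [hz]; apply Complex.ext <;> simp [sl]

lemma rad_le {g h u v : ℝ} {n0 n1 b0 b1 : ℂ} (hk : 0 ≤ (1-g*g)*(1-h*h)) (h1 : ‖n0*n1‖ ≤ u) (h2 : ‖b0*b1‖ ≤ v) :
    (1-g^2)*(1-h^2)*‖n0*n1*b0*b1‖ ≤ (1-g*g)*(1-h*h)*(u*v) := by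
  rw [pow_two, pow_two, mul_assoc (n0*n1), norm_mul]
  exact mul_le_mul_of_nonneg_left (mul_le_mul h1 h2 (norm_nonneg _) ((norm_nonneg _).trans h1)) hk

lemma G1_diff : DifferentiableOn ℂ (fun s => X (s+1) / X (s+2)) {s | (-1:ℝ) < s.re} := by
  intro s hs
  refine DifferentiableAt.differentiableWithinAt (DifferentiableAt.div ?_ ?_ (X_ne_zero ?_))
  · exact X_diff.differentiableAt.comp s (by fun_prop)
  · exact X_diff.differentiableAt.comp s (by fun_prop)
  · simp only [Set.mem_setOf_eq] at hs; simp; linarith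

lemma G2_diff : DifferentiableOn ℂ (fun s => X s / X (s+2)) {s | (-1/2:ℝ) < s.re} := by
  intro s hs
  refine DifferentiableAt.differentiableWithinAt (DifferentiableAt.div ?_ ?_ (X_ne_zero ?_))
  · exact X_diff.differentiableAt
  · exact X_diff.differentiableAt.comp s (by fun_prop)
  · simp only [Set.mem_setOf_eq] at hs; simp; linarith

lemma G1_at (x : ℝ) : X ((x:ℂ)+1) / X ((x:ℂ)+2) = ((Xr (x+1) / Xr (x+2) : ℝ) : ℂ) := by
  rw [← ofReal_one, ← ofReal_ofNat, ← ofReal_add, ← ofReal_add, X_ofReal, X_ofReal]; push_cast; rfl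

lemma G2_at (x : ℝ) : X (x:ℂ) / X ((x:ℂ)+2) = ((Xr x / Xr (x+2) : ℝ) : ℂ) := by
  rw [← ofReal_ofNat, ← ofReal_add, X_ofReal, X_ofReal]; push_cast; rfl

lemma kap {g h : ℝ} (i : |g| < 1) (j : |h| < 1) : 0 ≤ (1-g*g)*(1-h*h) := by
  have a : ∀ {x : ℝ}, |x| < 1 → 0 ≤ 1-x*x := fun {x} i => by
    obtain ⟨h1, h2⟩ := abs_lt.1 i; nlinarith
  exact mul_nonneg (a i) (a j)

set_option maxHeartbeats 1000000 in
lemma B_sound {A H : ℤ} {a b c d e f : ℕ} (hH : 0 < H) (ha : 0 < a) (hb : 0 < b) (hcc : 0 < c) (hd : 0 < d) (he : 0 < e)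
    (hf : 0 < f) (hc : chkB A H a b c d e f = true) {t : ℝ}
    (h1 : ((A:ℝ) - H)/16 ≤ t) (h2 : t ≤ (A + H)/16) : 0 < (kf (sl t) * E0 (sl t)).re := by
  obtain ⟨y, hy, ht⟩ := box_y hH h1 h2
  have hp : Mem y (tT A H) t := Mem.lin A H ht
  have hT : Mem y ((tT A H).mul (tT A H)) (t*t) := hp.mul hy hp
  rw [chkB] at hc
  generalize tT A H = p at *
  generalize p.mul p = T at *
  rw [chkB1] at hc
  obtain ⟨g, g2, h, hg, hg2, hh, ga, ha1, hgm⟩ := npA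
  obtain ⟨gb, gb2, h', hgb, hgb2, hh', gab, hb1, hgbm⟩ := npB
  obtain ⟨mg, mh⟩ := hgm y
  obtain ⟨mgb, mhb⟩ := hgbm y
  have n0 : CMem y (shT (-6) p) (sl t - 2) := sl_sh' hp _ (by norm_num)
  have n1 : CMem y (shT (-38) p) (sl t - 10) := sl_sh' hp _ (by norm_num)
  have b0 : CMem y (shT 18 p) (sl t + 4) := sl_sh hp _ (by norm_num)
  have b1 : CMem y (shT 50 p) (sl t + 12) := sl_sh hp _ (by norm_num)
  have b0' : CMem y (shT 14 p) (sl t + 3) := sl_sh hp _ (by norm_num)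
  have b1' : CMem y (shT 46 p) (sl t + 11) := sl_sh hp _ (by norm_num)
  obtain ⟨mM1, mN1⟩ := disc_mem hy mg mh n0 n1 b0 b1
  obtain ⟨mM2, mN2⟩ := disc_mem hy mgb mhb n0 n1 b0' b1'
  generalize MfT gAT hAT (shT (-6) p) (shT (-38) p) (shT 18 p) (shT 50 p) = M1 at *
  generalize MfT gBT hBT (shT (-6) p) (shT (-38) p) (shT 14 p) (shT 46 p) = M2 at *
  generalize NfT gAT hAT (shT (-6) p) (shT (-38) p) (shT 18 p) (shT 50 p) = N1 at *
  generalize NfT gBT hBT (shT (-6) p) (shT (-38) p) (shT 14 p) (shT 46 p) = N2 at *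
  rw [okB, Bool.and_eq_true, Bool.and_eq_true] at hc
  obtain ⟨⟨k1, k2⟩, k3⟩ := hc
  have pM1 := Mem.pos hy mM1 k1
  have pM2 := Mem.pos hy mM2 k2
  have hm := m3T_mem hy hp
  have p1 := ppT_mem hy hT 9 361
  have p2 := ppT_mem hy hT 81 625
  have p3 := ppT_mem hy hT 49 529
  have p4 := ppT_mem hy hT 225 16
  have p5 := ppT_mem hy hT 1 25
  have fin := Mem.pos hy (fnT_mem hy hp hm (hT.add (Mem.qu 1 rfl)) (hT.add (Mem.qu 25 rfl)) mM1 mM2 mN1 mN2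
    (rdT_mem hy mg mh hd he p1 p2) (rdT_mem hy mgb mhb hd hf p1 p3)
    ((sqT_mem hy ha (hm.nsq hy)).mul hy (sqT_mem hy hb p4)) (sqT_mem hy hcc p5)) k3
  have sre : (sl t).re = 1/2 := rfl
  have x1 : ‖(sl t - 2) * (sl t - 10)‖ ≤ sqR d ((t*t+(9:ℤ)/4)*(t*t+(361:ℤ)/4)) :=
    le_sqR hd (by rw [sub_eq_add_neg, sub_eq_add_neg]; exact two_norm t _ _ 9 361 (-2) (-10) (by push_cast; rfl) (by push_cast; rfl) (by norm_num) (by norm_num))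
  have x2 : ‖(sl t + 4) * (sl t + 12)‖ ≤ sqR e ((t*t+(81:ℤ)/4)*(t*t+(625:ℤ)/4)) :=
    le_sqR he (two_norm t _ _ 81 625 4 12 (by push_cast; rfl) (by push_cast; rfl) (by norm_num) (by norm_num))
  have x3 : ‖(sl t + 3) * (sl t + 11)‖ ≤ sqR f ((t*t+(49:ℤ)/4)*(t*t+(529:ℤ)/4)) :=
    le_sqR hf (two_norm t _ _ 49 529 3 11 (by push_cast; rfl) (by push_cast; rfl) (by norm_num) (by norm_num))
  have x4 : ‖(sl t + 7) * (sl t + 3/2)‖ ≤ sqR b ((t*t+(225:ℤ)/4)*(t*t+(16:ℤ)/4)) :=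
    le_sqR hb (two_norm t _ _ 225 16 7 (3/2) (by push_cast; rfl) (by push_cast; rfl) (by norm_num) (by norm_num))
  have x5 : ‖sl t‖ * ‖sl t - 3‖ ≤ sqR c ((t*t+(1:ℤ)/4)*(t*t+(25:ℤ)/4)) :=
    le_sqR hcc (by rw [mul_pow, sl_n0, sl_n3']; push_cast; ring)
  have x6 : ‖m3 (sl t)‖ ≤ sqR a (normSq (m3 (sl t))) := le_sqR ha (by rw [normSq_eq_norm_sq])
  have d1 := np_disc (e := -1) (x := 2) (y := 10) (g2 := g2) (h := h) (by norm_num) (by norm_num) (f := fun s => X (s+1) / X (s+2))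
    (G1_diff) (fun s hs => G1_le hs.le) (by rw [hg, G1_at]; norm_num [Xn]) ga
    (by rw [hg2, G1_at]; norm_num [Xn]) (by linear_combination hh) ha1 (by norm_num)
    (s := sl t) (by rw [sre]; norm_num) (n0 := sl t - 2) (n1 := sl t - 10) (b0 := sl t + 4) (b1 := sl t + 12)
    (by push_cast; ring) (by push_cast; ring) (by push_cast; ring) (by push_cast; ring)
    (D := Df g h (sl t - 2) (sl t + 4) (sl t + 12)) (by unfold Df; push_cast; ring)
    (B := Bf g h (sl t - 2) (sl t + 4) (sl t + 12)) (by unfold Bf; push_cast; ring)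
    (A := Af g h (sl t - 2) (sl t - 10) (sl t + 4)) (by unfold Af; push_cast; ring)
    (C := Cf g h (sl t - 2) (sl t - 10) (sl t + 4)) (by unfold Cf; push_cast; ring) pM1
  have d2 := np_disc (e := -1/2) (x := 2) (y := 10) (g2 := gb2) (h := h') (by norm_num) (by norm_num) (f := fun s => X s / X (s+2))
    (G2_diff) (fun s hs => G2_le hs.le) (by rw [hgb, G2_at]; norm_num [Xn]) gab
    (by rw [hgb2, G2_at]; norm_num [Xn]) (by linear_combination hh') hb1 (by norm_num)
    (s := sl t) (by rw [sre]; norm_num) (n0 := sl t - 2) (n1 := sl t - 10) (b0 := sl t + 3) (b1 := sl t + 11)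
    (by push_cast; ring) (by push_cast; ring) (by push_cast; ring) (by push_cast; ring)
    (D := Df gb h' (sl t - 2) (sl t + 3) (sl t + 11)) (by unfold Df; push_cast; ring)
    (B := Bf gb h' (sl t - 2) (sl t + 3) (sl t + 11)) (by unfold Bf; push_cast; ring)
    (A := Af gb h' (sl t - 2) (sl t - 10) (sl t + 3)) (by unfold Af; push_cast; ring)
    (C := Cf gb h' (sl t - 2) (sl t - 10) (sl t + 3)) (by unfold Cf; push_cast; ring) pM2
  have D1 := d1.trans (rad_le (kap ga ha1) x1 x2)
  have D2 := d2.trans (rad_le (kap gab hb1) x1 x3)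
  refine B_core pM1 pM2 D1 D2 (e0 := sqR a (normSq (m3 (sl t))) * sqR b ((t*t+(225:ℤ)/4)*(t*t+(16:ℤ)/4)))
    (mul_le_mul x6 x4 (norm_nonneg _) ((norm_nonneg _).trans x6)) x5 ?_
  norm_num at fin ⊢
  exact fin
end

end G2RH


namespace G2RH

lemma by0 : chkB 110 2 3188678 76386392 52875981 86526088 122913883 108384341 = true := by decide +kernel
lemma by1 : chkB 114 2 3190022 80274486 56552064 90664125 127138895 112607709 = true := by decide +kernel
lemma by2 : chkB 118 2 3191413 84280826 60358658 94909367 131479673 116942543 = true := by decide +kernel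
lemma by3 : chkB 122 2 3192852 88406244 64295828 99263117 135936121 121389215 = true := by decide +kernel
lemma by4 : chkB 126 2 3194338 92651520 68363631 103726617 140508237 125948156 = true := by decide +kernel
lemma by5 : chkB 132 4 3196655 99245763 74710379 110630223 147583478 132998123 = true := by decide +kernel
lemma by6 : chkB 140 4 3199910 108464060 83630330 120229699 157423215 142795726 = true := by decide +kernel
lemma by7 : chkB 148 4 3203352 118173548 93073511 130287562 167728852 153051818 = true := by decide +kernel
lemma by8 : chkB 156 4 3206982 128378400 103040121 140811001 178502849 163770897 = true := by decide +kernel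
lemma by9 : chkB 164 4 3210799 139082231 113530315 151806403 189747998 174957420 = true := by decide +kernel
lemma by10 : chkB 172 4 3214801 150288166 124544215 163279429 201467268 186615702 = true := by decide +kernel
lemma by11 : chkB 180 4 3218989 161998908 136081918 175235090 213663693 198749857 = true := by decide +kernel
lemma by12 : chkB 188 4 3223361 174216791 148143501 187677815 226340291 211363760 = true := by decide +kernel
lemma by13 : chkB 200 8 3230263 193498855 167218286 207263586 246261930 231191985 = true := by decide +kernel
lemma by14 : chkB 216 8 3240105 220999986 194485409 235115549 274531235 259340319 = true := by decide +kernel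
lemma by15 : chkB 232 8 3250671 250558382 223848874 264972997 304770107 289464433 = true := by decide +kernel
lemma by16 : chkB 248 8 3261953 282182157 255308877 296853051 336996486 321583489 = true := by decide +kernel
lemma by17 : chkB 264 8 3273945 315877537 288865560 330769223 371225894 355713470 = true := by decide +kernel
lemma by18 : chkB 280 8 3286638 351649346 324519026 366732242 407471628 391867666 = true := by decide +kernel

end G2RH


namespace G2RH
open Complex

lemma sl_conj (t : ℝ) : (starRingEnd ℂ) (sl t) = 1 - sl t := by
  apply Complex.ext <;> simp [sl]; norm_num

lemma X_u (t : ℝ) : X (2 * sl t - 1) = (starRingEnd ℂ) (uf t) := by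
  rw [uf, ← X_conj, ← X_one_sub]; congr 1; rw [map_mul, sl_conj, map_ofNat]; ring
lemma X_b (t : ℝ) : X (sl t - 1) = (starRingEnd ℂ) (bf t) := by
  rw [bf, ← X_conj, ← X_one_sub]; congr 1; rw [map_add, sl_conj, map_one]; ring
lemma uf_ne (t : ℝ) : uf t ≠ 0 := X_ne_zero (by simp [sl])
lemma af_ne (t : ℝ) : af t ≠ 0 := X_ne_zero (by simp [sl]; norm_num)

lemma kf_RV (t : ℝ) : kf (sl t) * E0 (sl t) * (normSq ((sl t - 2) * af t) : ℝ) =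
    Rf t + (starRingEnd ℂ (uf t) / uf t) * Vf t := by
  have h1 : kf (sl t) * (af t * ((sl t - 1) * (sl t - 2))) = NRf (sl t) (af t) (bf t) (rf t) (t*t+25/4) +
      (starRingEnd ℂ (uf t) / uf t) * NVf (sl t) (bf t) (rf t) (t*t+25/4) := by
    have e : ((t*t+25/4 : ℝ) : ℂ) = -((sl t - 3) * (sl t + 2)) := by rw [sl_q3]; ring
    unfold kf NRf NVf
    rw [X_u, X_b, ofReal_mul (1-c3), ofReal_mul c3, e]
    rw [show X (sl t + 2) = af t from rfl, show X (sl t + 1) = bf t from rfl, show X (2 * sl t) = uf t from rfl,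
      show X (sl t) = rf t from rfl]
    have := uf_ne t
    have := af_ne t
    have := sl1 t
    have := sl2 t
    push_cast
    field_simp
    ring
  have h2 : E0 (sl t) * (normSq ((sl t - 2) * af t) : ℝ) = (af t * ((sl t - 1) * (sl t - 2))) * Ef (sl t) (af t) := by
    rw [← mul_conj]
    unfold E0 Ef
    simp only [map_mul]
    rw [sl_conj]
    ring
  unfold Rf Vf
  rw [mul_assoc, h2, ← mul_assoc, h1]; ring

lemma A_of_V {t : ℝ} (h : ‖Vf t‖ < (Rf t).re) : 0 < (kf (sl t) * E0 (sl t)).re := by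
  have h1 := congrArg Complex.re (kf_RV t)
  rw [re_mul_ofReal, add_re] at h1
  have h2 := re_ge (starRingEnd ℂ (uf t) / uf t) (Vf t)
  rw [norm_div, norm_conj, div_self (norm_ne_zero_iff.2 (uf_ne t))] at h2
  have : 0 < (kf (sl t) * E0 (sl t)).re * normSq ((sl t - 2) * af t) := by rw [h1]; linarith
  exact pos_of_mul_pos_left this (normSq_nonneg _)

lemma A_of_W {t : ℝ} (h : 0 < Wf t) : 0 < (kf (sl t) * E0 (sl t)).re := by
  have e : ((normSq (uf t) : ℝ) : ℂ) * Rf t + (starRingEnd ℂ (uf t))^2 * Vf t =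
      ((normSq (uf t) : ℝ) : ℂ) * (kf (sl t) * E0 (sl t) * (normSq ((sl t - 2) * af t) : ℝ)) := by
    rw [kf_RV, ← mul_conj]
    have := uf_ne t
    field_simp
  rw [Wf, e, re_ofReal_mul, re_mul_ofReal] at h
  exact pos_of_mul_pos_left (pos_of_mul_pos_right h (normSq_nonneg _)) (normSq_nonneg _)

lemma C_pos {t : ℝ} (ht : 18 ≤ t) : 0 < (kf (sl t) * E0 (sl t)).re := by
  have hd : 0.02358 ≤ dl := by
    have := Real.pi_gt_d4
    unfold dl; linarith
  have hT : 324 ≤ t*t := by nlinarith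
  have hm : ‖m3 (sl t)‖^2 = (3+dl)^2 + 4*dl^2*(t*t) := by
    rw [← normSq_eq_norm_sq, normSq_apply]
    simp [m3, sl]; ring
  have hm2 : 3.14 ≤ ‖m3 (sl t)‖ := by
    have h1 : (3.02358:ℝ)^2 ≤ (3+dl)^2 := by nlinarith
    have h2 : (0.02358:ℝ)^2 ≤ dl^2 := by nlinarith
    have h3 : (0.02358:ℝ)^2*324 ≤ dl^2*(t*t) := mul_le_mul h2 hT (by norm_num) (by positivity)
    by_contra hc
    push Not at hc
    have : ‖m3 (sl t)‖^2 < 3.14^2 := by gcongr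
    norm_num at h1 h3 this
    linarith
  obtain ⟨c20, c21⟩ := c2_mem'
  obtain ⟨c30, c31⟩ := c3_mem'
  refine B_core (M1 := 1) (M2 := 1) (ρ1 := 1) (ρ2 := 1) (N1 := 0) (N2 := 0) (e0 := ‖m3 (sl t)‖ * (t*t + 30.125))
    (r13 := t*t+13/4) one_pos one_pos ?_ ?_ ?_ ?_ ?_
  · simpa using G1_le (s := sl t) (by simp [sl]; norm_num)
  · simpa using G2_le (s := sl t) (by simp [sl]; norm_num)
  · refine mul_le_mul_of_nonneg_left ?_ (norm_nonneg _)
    have h := two_norm t 7 (3/2) 225 16 7 (3/2) (by push_cast; rfl) (by push_cast; rfl) (by norm_num) (by norm_num)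
    refine abs_le_of_sq_le_sq' (b := t*t+30.125) ?_ (by positivity) |>.2
    rw [h]; norm_num; nlinarith
  · have h1 := sl_n0 t
    have h2 := sl_n3' t
    nlinarith [sq_nonneg (‖sl t‖ - ‖sl t - 3‖)]
  · have e : (E0 (sl t) * Mn (sl t) (t*t+1/4) (t*t+25/4) 1 1 0 0).re =
      (t*t+1/4) * (‖m3 (sl t)‖^2 * ((t*t)^2+20.25*(t*t)-3.75)) := by
      have : E0 (sl t) * Mn (sl t) (t*t+1/4) (t*t+25/4) 1 1 0 0 =
        (((t*t+1/4) * normSq (m3 (sl t)) : ℝ) : ℂ) * ((sl t + 7) * (starRingEnd ℂ (sl t)) * starRingEnd ℂ (sl t + 3/2) * (sl t - 1)) := by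
        unfold E0 Mn; rw [ofReal_mul (t*t+1/4) (normSq _), ← mul_conj]; simp only [map_mul]; push_cast; ring
      rw [this, re_ofReal_mul, normSq_eq_norm_sq, mul_assoc]
      congr 2
      simp [sl, map_ofNat]; ring
    rw [e]
    have q : 0 < t*t+1/4 := by linarith
    have : 0 < (t*t+1/4) * (‖m3 (sl t)‖ * (‖m3 (sl t)‖ * ((t*t)^2+20.25*(t*t)-3.75) - (t*t+30.125)*(3*(t*t)+12.75))) := by
      refine mul_pos q (mul_pos (by linarith) ?_)
      have : 3.14 * ((t*t)^2+20.25*(t*t)-3.75) ≤ ‖m3 (sl t)‖ * ((t*t)^2+20.25*(t*t)-3.75) :=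
        mul_le_mul_of_nonneg_right hm2 (by nlinarith)
      nlinarith
    convert this using 1
    ring

lemma P4 {t : ℝ} (h : 0 ≤ t) : 0 < (kf (sl t) * E0 (sl t)).re := by
  rcases le_total t (1/4) with k | k
  · exact A_of_W (A1_sound (by norm_num) bx0 (by norm_num; linarith) (by norm_num; linarith))
  replace h := k; clear k
  rcases le_total t (1/2) with k | k
  · exact A_of_W (A1_sound (by norm_num) bx1 (by norm_num; linarith) (by norm_num; linarith))
  replace h := k; clear k
  rcases le_total t (1) with k | k
  · exact A_of_W (A1_sound (by norm_num) bx2 (by norm_num; linarith) (by norm_num; linarith))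
  replace h := k; clear k
  rcases le_total t (3/2) with k | k
  · exact A_of_W (A1_sound (by norm_num) bx3 (by norm_num; linarith) (by norm_num; linarith))
  replace h := k; clear k
  rcases le_total t (2) with k | k
  · exact A_of_W (A1_sound (by norm_num) bx4 (by norm_num; linarith) (by norm_num; linarith))
  replace h := k; clear k
  rcases le_total t (5/2) with k | k
  · exact A_of_W (A1_sound (by norm_num) bx5 (by norm_num; linarith) (by norm_num; linarith))
  replace h := k; clear k
  rcases le_total t (3) with k | k
  · exact A_of_W (A1_sound (by norm_num) bx6 (by norm_num; linarith) (by norm_num; linarith))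
  replace h := k; clear k
  rcases le_total t (7/2) with k | k
  · exact A_of_W (A1_sound (by norm_num) bx7 (by norm_num; linarith) (by norm_num; linarith))
  replace h := k; clear k
  rcases le_total t (15/4) with k | k
  · exact A_of_W (A2_sound (by norm_num) bx8 (by norm_num; linarith) (by norm_num; linarith))
  replace h := k; clear k
  rcases le_total t (4) with k | k
  · exact A_of_W (A2_sound (by norm_num) bx9 (by norm_num; linarith) (by norm_num; linarith))
  replace h := k; clear k
  rcases le_total t (17/4) with k | k
  · exact A_of_W (A2_sound (by norm_num) bx10 (by norm_num; linarith) (by norm_num; linarith))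
  replace h := k; clear k
  rcases le_total t (9/2) with k | k
  · exact A_of_W (A2_sound (by norm_num) bx11 (by norm_num; linarith) (by norm_num; linarith))
  replace h := k; clear k
  rcases le_total t (37/8) with k | k
  · exact A_of_V (A3_sound (by norm_num) bx12 (by norm_num; linarith) (by norm_num; linarith))
  replace h := k; clear k
  rcases le_total t (19/4) with k | k
  · exact A_of_V (A3_sound (by norm_num) bx13 (by norm_num; linarith) (by norm_num; linarith))
  replace h := k; clear k
  rcases le_total t (39/8) with k | k
  · exact A_of_V (A3_sound (by norm_num) bx14 (by norm_num; linarith) (by norm_num; linarith))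
  replace h := k; clear k
  rcases le_total t (5) with k | k
  · exact A_of_V (A3_sound (by norm_num) bx15 (by norm_num; linarith) (by norm_num; linarith))
  replace h := k; clear k
  rcases le_total t (21/4) with k | k
  · exact A_of_V (A3_sound (by norm_num) bx16 (by norm_num; linarith) (by norm_num; linarith))
  replace h := k; clear k
  rcases le_total t (11/2) with k | k
  · exact A_of_V (A3_sound (by norm_num) bx17 (by norm_num; linarith) (by norm_num; linarith))
  replace h := k; clear k
  rcases le_total t (23/4) with k | k
  · exact A_of_V (A3_sound (by norm_num) bx18 (by norm_num; linarith) (by norm_num; linarith))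
  replace h := k; clear k
  rcases le_total t (6) with k | k
  · exact A_of_V (A3_sound (by norm_num) bx19 (by norm_num; linarith) (by norm_num; linarith))
  replace h := k; clear k
  rcases le_total t (25/4) with k | k
  · exact A_of_V (A3_sound (by norm_num) bx20 (by norm_num; linarith) (by norm_num; linarith))
  replace h := k; clear k
  rcases le_total t (13/2) with k | k
  · exact A_of_V (A3_sound (by norm_num) bx21 (by norm_num; linarith) (by norm_num; linarith))
  replace h := k; clear k
  rcases le_total t (27/4) with k | k
  · exact A_of_V (A3_sound (by norm_num) bx22 (by norm_num; linarith) (by norm_num; linarith))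
  replace h := k; clear k
  rcases le_total t (7) with k | k
  · exact B_sound (by norm_num) (by norm_num) (by norm_num) (by norm_num) (by norm_num) (by norm_num) (by norm_num) by0 (by norm_num; linarith) (by norm_num; linarith)
  replace h := k; clear k
  rcases le_total t (29/4) with k | k
  · exact B_sound (by norm_num) (by norm_num) (by norm_num) (by norm_num) (by norm_num) (by norm_num) (by norm_num) by1 (by norm_num; linarith) (by norm_num; linarith)
  replace h := k; clear k
  rcases le_total t (15/2) with k | k
  · exact B_sound (by norm_num) (by norm_num) (by norm_num) (by norm_num) (by norm_num) (by norm_num) (by norm_num) by2 (by norm_num; linarith) (by norm_num; linarith)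
  replace h := k; clear k
  rcases le_total t (31/4) with k | k
  · exact B_sound (by norm_num) (by norm_num) (by norm_num) (by norm_num) (by norm_num) (by norm_num) (by norm_num) by3 (by norm_num; linarith) (by norm_num; linarith)
  replace h := k; clear k
  rcases le_total t (8) with k | k
  · exact B_sound (by norm_num) (by norm_num) (by norm_num) (by norm_num) (by norm_num) (by norm_num) (by norm_num) by4 (by norm_num; linarith) (by norm_num; linarith)
  replace h := k; clear k
  rcases le_total t (17/2) with k | k
  · exact B_sound (by norm_num) (by norm_num) (by norm_num) (by norm_num) (by norm_num) (by norm_num) (by norm_num) by5 (by norm_num; linarith) (by norm_num; linarith)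
  replace h := k; clear k
  rcases le_total t (9) with k | k
  · exact B_sound (by norm_num) (by norm_num) (by norm_num) (by norm_num) (by norm_num) (by norm_num) (by norm_num) by6 (by norm_num; linarith) (by norm_num; linarith)
  replace h := k; clear k
  rcases le_total t (19/2) with k | k
  · exact B_sound (by norm_num) (by norm_num) (by norm_num) (by norm_num) (by norm_num) (by norm_num) (by norm_num) by7 (by norm_num; linarith) (by norm_num; linarith)
  replace h := k; clear k
  rcases le_total t (10) with k | k
  · exact B_sound (by norm_num) (by norm_num) (by norm_num) (by norm_num) (by norm_num) (by norm_num) (by norm_num) by8 (by norm_num; linarith) (by norm_num; linarith)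
  replace h := k; clear k
  rcases le_total t (21/2) with k | k
  · exact B_sound (by norm_num) (by norm_num) (by norm_num) (by norm_num) (by norm_num) (by norm_num) (by norm_num) by9 (by norm_num; linarith) (by norm_num; linarith)
  replace h := k; clear k
  rcases le_total t (11) with k | k
  · exact B_sound (by norm_num) (by norm_num) (by norm_num) (by norm_num) (by norm_num) (by norm_num) (by norm_num) by10 (by norm_num; linarith) (by norm_num; linarith)
  replace h := k; clear k
  rcases le_total t (23/2) with k | k
  · exact B_sound (by norm_num) (by norm_num) (by norm_num) (by norm_num) (by norm_num) (by norm_num) (by norm_num) by11 (by norm_num; linarith) (by norm_num; linarith)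
  replace h := k; clear k
  rcases le_total t (12) with k | k
  · exact B_sound (by norm_num) (by norm_num) (by norm_num) (by norm_num) (by norm_num) (by norm_num) (by norm_num) by12 (by norm_num; linarith) (by norm_num; linarith)
  replace h := k; clear k
  rcases le_total t (13) with k | k
  · exact B_sound (by norm_num) (by norm_num) (by norm_num) (by norm_num) (by norm_num) (by norm_num) (by norm_num) by13 (by norm_num; linarith) (by norm_num; linarith)
  replace h := k; clear k
  rcases le_total t (14) with k | k
  · exact B_sound (by norm_num) (by norm_num) (by norm_num) (by norm_num) (by norm_num) (by norm_num) (by norm_num) by14 (by norm_num; linarith) (by norm_num; linarith)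
  replace h := k; clear k
  rcases le_total t (15) with k | k
  · exact B_sound (by norm_num) (by norm_num) (by norm_num) (by norm_num) (by norm_num) (by norm_num) (by norm_num) by15 (by norm_num; linarith) (by norm_num; linarith)
  replace h := k; clear k
  rcases le_total t (16) with k | k
  · exact B_sound (by norm_num) (by norm_num) (by norm_num) (by norm_num) (by norm_num) (by norm_num) (by norm_num) by16 (by norm_num; linarith) (by norm_num; linarith)
  replace h := k; clear k
  rcases le_total t (17) with k | k
  · exact B_sound (by norm_num) (by norm_num) (by norm_num) (by norm_num) (by norm_num) (by norm_num) (by norm_num) by17 (by norm_num; linarith) (by norm_num; linarith)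
  replace h := k; clear k
  rcases le_total t (18) with k | k
  · exact B_sound (by norm_num) (by norm_num) (by norm_num) (by norm_num) (by norm_num) (by norm_num) (by norm_num) by18 (by norm_num; linarith) (by norm_num; linarith)
  replace h := k; clear k
  exact C_pos h

lemma P4' (t : ℝ) : 0 < (kf (sl t) * E0 (sl t)).re := by
  rcases le_total 0 t with h | h
  · exact P4 h
  · have h1 := P4 (t := -t) (by linarith)
    have e : sl (-t) = (starRingEnd ℂ) (sl t) := by apply Complex.ext <;> simp [sl]
    have e2 : kf ((starRingEnd ℂ) (sl t)) = (starRingEnd ℂ) (kf (sl t)) := by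
      have hX : ∀ z, (starRingEnd ℂ) (X z) = X ((starRingEnd ℂ) z) := fun z => (X_conj z).symm
      simp [kf, m3, hX, map_ofNat]
    have e3 : E0 ((starRingEnd ℂ) (sl t)) = (starRingEnd ℂ) (E0 (sl t)) := by
      simp [E0, m3, map_ofNat]
    rw [e, e2, e3, ← map_mul, conj_re] at h1
    exact h1

end G2RH


namespace G2RH
open Complex

noncomputable def Y (s : ℂ) : ℂ :=
  (s-1)^2*(s-2) * m3 s * X (2*s) * X (s+2) - 2*(1-c2)*(s-1)*(s-2)*(s-3)*X (s+1)*X (2*s)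
  - 2*c2*s*(s+1)*(s+2)*X (2*s-1)*X (s-1) - (1-c3)*(s-3)*(s+2)*(s-2)*X s*X (2*s)
  - c3*(s-3)*(s+2)*(s+1)*X s*X (2*s-1)

lemma Y_one_sub (s : ℂ) : Y (1-s) =
  s^2*(-1-s) * m3 (1-s) * X (2*s-1) * X (s-2) - 2*(1-c2)*(-s)*(-1-s)*(-2-s)*X (s-1)*X (2*s-1)
  - 2*c2*(1-s)*(2-s)*(3-s)*X (2*s)*X (s+1) - (1-c3)*(-2-s)*(3-s)*(-1-s)*X s*X (2*s-1)
  - c3*(-2-s)*(3-s)*(2-s)*X s*X (2*s) := by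
  unfold Y
  rw [← X_one_sub (2*(1-s)), ← X_one_sub (1-s+2), ← X_one_sub (1-s+1), ← X_one_sub (2*(1-s)-1),
    ← X_one_sub (1-s-1), X_one_sub s]
  rw [show 1-2*(1-s) = 2*s-1 by ring, show 1-(1-s+2) = s-2 by ring, show 1-(1-s+1) = s-1 by ring,
    show 1-(2*(1-s)-1) = 2*s by ring, show 1-(1-s-1) = s+1 by ring]
  ring

lemma Xr2 : Xr 2 = Real.pi/3 := by
  have h := Lv0
  unfold nd at h
  unfold Xr
  rw [show ((2:ℝ)-1/2)^2 = (2*((0:ℕ):ℝ)+3/2)^2 by norm_num, h]; norm_num; ring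
lemma X_two : X 2 = (Real.pi:ℂ)/3 := by
  have := X_ofReal 2
  rw [Xr2] at this
  push_cast at this; exact this
lemma Xr6 : Xr 6 = 4*Real.pi^3/63 := by
  have h := Lv2
  unfold nd at h
  unfold Xr
  rw [show ((6:ℝ)-1/2)^2 = (2*((2:ℕ):ℝ)+3/2)^2 by norm_num, h]; norm_num; ring
lemma X_six : X 6 = 4*(Real.pi:ℂ)^3/63 := by
  have := X_ofReal 6
  rw [Xr6] at this
  push_cast at this; exact this
lemma X_m1 : X (-1) = (Real.pi:ℂ)/3 := by
  rw [← X_one_sub]; norm_num; exact X_two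

lemma xi_eq {w : ℂ} (h0 : w ≠ 0) (h1 : w - 1 ≠ 0) : completedRiemannZeta w = X w / (w * (w-1)) := by
  rw [X_eq h0 (sub_ne_zero.1 h1)]; field_simp

lemma xi_two : completedRiemannZeta 2 = (Real.pi:ℂ)/6 := by
  rw [xi_eq two_ne_zero (by norm_num), X_two]; ring

lemma Z_rel {s : ℂ} (hs : s ∉ S2) :
    xiG2Pshort s * (4*s^2*(2*s-1)*(s+2)*(s+1)*(s-1)^2*(s-2)*(s-3)) = Y s - Y (1-s) := by
  simp only [S2, Set.mem_insert_iff, Set.mem_singleton_iff, not_or] at hs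
  obtain ⟨a1, a2, a3, a4, a5, a6, a7⟩ := hs
  have b1 : s + 2 ≠ 0 := fun h => a1 (by linear_combination h)
  have b2 : s + 1 ≠ 0 := fun h => a2 (by linear_combination h)
  have b4 : 2*s - 1 ≠ 0 := fun h => a4 (by linear_combination h/2)
  have b5 : s - 1 ≠ 0 := sub_ne_zero.2 a5
  have b6 : s - 2 ≠ 0 := sub_ne_zero.2 a6
  have b7 : s - 3 ≠ 0 := sub_ne_zero.2 a7
  have e1 := xi_eq (w := s+2) b1 (by convert b2 using 1; ring)
  have e2 := xi_eq (w := 2*s) (mul_ne_zero two_ne_zero a3) b4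
  have e3 := xi_eq (w := s-2) b6 (by convert b7 using 1; ring)
  have e4 := xi_eq (w := 2*s-1) b4 (by convert mul_ne_zero two_ne_zero b5 using 1; ring)
  have e5 := xi_eq (w := s-1) b5 (by convert b6 using 1; ring)
  have e6 := xi_eq (w := s+1) b2 (by convert a3 using 1; ring)
  have e7 := xi_eq (w := s) a3 b5
  rw [show s+2-1 = s+1 by ring] at e1
  rw [show s-2-1 = s-3 by ring] at e3
  rw [show 2*s-1-1 = 2*(s-1) by ring] at e4
  rw [show s-1-1 = s-2 by ring] at e5
  rw [show s+1-1 = s by ring] at e6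
  rw [xiG2Pshort, Y_one_sub, Y, xi_two, e1, e2, e3, e4, e5, e6, e7]
  rw [show 2*s-2 = 2*(s-1) by ring]
  simp only [m3, dl]
  generalize (c2:ℂ) = k2
  generalize (c3:ℂ) = k3
  push_cast
  generalize (Real.pi:ℂ) = p
  generalize X (s+2) = x1
  generalize X (s-2) = x2
  generalize X (s+1) = x3
  generalize X (s-1) = x4
  generalize X (2*s) = x5
  generalize X (2*s-1) = x6
  generalize X s = x7
  clear e1 e2 e3 e4 e5 e6 e7
  obtain ⟨m, hm⟩ : ∃ m, m = 2*s-1 := ⟨_, rfl⟩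
  rw [← hm] at b4 ⊢
  field_simp
  first | done | (rw [hm]; ring) | ring

end G2RH


namespace G2RH
open Complex

lemma pi12 : (12:ℂ) + (Real.pi:ℂ) ≠ 0 := by
  have : (12:ℝ) + Real.pi ≠ 0 := by positivity
  exact_mod_cast this

lemma c3C : (c3:ℂ) = 2*Real.pi/(12+Real.pi) := by unfold c3; push_cast; rfl
lemma c2C : (c2:ℂ) = Real.pi^2/(6*(12+Real.pi)) := by unfold c2; push_cast; rfl
lemma dlC : (dl:ℂ) = Real.pi/6-1/2 := by unfold dl; push_cast; rfl

lemma Y1 : Y 1 = 0 := by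
  have h := pi12
  unfold Y; norm_num [X_one, X_zero, X_two, c3C, c2C]
  field_simp; ring
lemma Y2 : Y 2 = 0 := by
  have h := pi12
  unfold Y; norm_num [X_one, X_zero, X_two, c3C, c2C]
  field_simp; ring
lemma Y0 : Y 0 = 0 := by
  have h := pi12
  unfold Y; norm_num [X_one, X_zero, X_two, X_m1, c3C, c2C, m3]
  field_simp; ring
lemma Ym1 : Y (-1) = 0 := by
  have h := pi12
  have h3 : X (-2) = X 3 := by rw [← X_one_sub]; norm_num
  unfold Y; norm_num [X_one, X_zero, X_two, X_m1, c3C, c2C, dlC, m3, h3]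
  field_simp; ring

lemma Y3 : Y 3 ≠ Y (-2) := by
  have h := pi12
  have h4 : X (-4) = X 5 := by rw [← X_one_sub]; norm_num
  have h3 : X (-3) = X 4 := by rw [← X_one_sub]; norm_num
  have h5 : X 5 ≠ 0 := X_ne_zero (by norm_num)
  have e : Y 3 - Y (-2) = X 5 * ((16*Real.pi^4/63 + 180 - 64*Real.pi : ℝ) : ℂ) := by
    unfold Y; norm_num [X_one, X_zero, X_two, X_m1, X_six, c3C, c2C, dlC, m3, h3, h4]
    field_simp; ring
  have hp : 16*Real.pi^4/63 + 180 - 64*Real.pi ≠ 0 := by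
    have a := Real.pi_gt_d2
    have b := Real.pi_lt_d2
    have c : (3.14:ℝ)^4 ≤ Real.pi^4 := by gcongr
    norm_num at a b c
    apply ne_of_gt
    linarith
  intro hh
  rw [hh, sub_self] at e
  rcases mul_eq_zero.1 e.symm with h6 | h6
  · exact h5 h6
  · exact hp (by exact_mod_cast h6)

lemma Y_diff : Differentiable ℂ Y := by
  have := X_diff
  unfold Y m3
  fun_prop

lemma Y_conj (s : ℂ) : Y ((starRingEnd ℂ) s) = (starRingEnd ℂ) (Y s) := by
  have hX : ∀ z, (starRingEnd ℂ) (X z) = X ((starRingEnd ℂ) z) := fun z => (X_conj z).symm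
  simp [Y, m3, hX, map_ofNat]

lemma Y_line (t : ℝ) : ‖Y (1 - sl t)‖ = ‖Y (sl t)‖ := by
  rw [← sl_conj, Y_conj, RCLike.norm_conj]

lemma m3_ne {s : ℂ} (hs : 1/2 ≤ s.re) : m3 s ≠ 0 := by
  have h : 0 < (m3 s).re := by
    have : (m3 s).re = 3 + 2*dl*s.re := by simp [m3]
    rw [this]
    have d : 0 < dl := by unfold dl; linarith [Real.pi_gt_three]
    nlinarith
  intro h0; rw [h0] at h; simp at h

end G2RH


namespace G2RH
open Complex Filter Topology Bornology

lemma PLw {f : ℂ → ℂ} (hd : ∀ s : ℂ, 1/2 ≤ s.re → DifferentiableAt ℂ f s) {M C : ℝ}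
    (hM : ∀ s : ℂ, 1/2 ≤ s.re → ‖f s‖ ≤ M) (hC : ∀ t : ℝ, ‖f (sl t)‖ ≤ C)
    {s : ℂ} (hs : 1/2 ≤ s.re) : ‖f s‖ ≤ C := by
  have key : ∀ z : ℂ, 0 ≤ z.re → ‖(fun z : ℂ => f (z + 1/2)) z‖ ≤ C := by
    intro z hz
    refine PhragmenLindelof.right_half_plane_of_bounded_on_real
      (f := fun z : ℂ => f (z + 1/2)) ?_ ?_ ?_ ?_ hz
    · refine DifferentiableOn.diffContOnCl fun w hw => ?_
      have hcl : closure {z : ℂ | 0 < z.re} = {z : ℂ | 0 ≤ z.re} := by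
        have := closure_preimage_re (Set.Ioi (0:ℝ))
        rw [closure_Ioi] at this
        exact this
      rw [hcl] at hw
      have hw' : 0 ≤ w.re := hw
      have d1 := (hd (w + 1/2) (by simp; linarith)).comp w
        (show DifferentiableAt ℂ (fun z : ℂ => z + 1/2) w by fun_prop)
      exact d1.differentiableWithinAt
    · refine ⟨1, by norm_num, 0, ?_⟩
      refine Asymptotics.IsBigO.of_bound M ?_
      rw [eventually_inf_principal]
      filter_upwards with w hw0
      have hw0' : 0 < w.re := hw0
      have := hM (w + 1/2) (by simp; linarith)
      simpa using this
    · refine ⟨M, ?_⟩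
      rw [eventually_map]
      filter_upwards [eventually_ge_atTop 0] with x hx
      exact hM _ (by simp; linarith)
    · intro x
      have := hC x
      rw [show sl x = (x:ℂ) * I + 1/2 by apply Complex.ext <;> simp [sl]] at this
      exact this
  have := key (s - 1/2) (by simp; linarith)
  simpa using this

lemma abs_max {K Ks : ℂ → ℂ} (hK : ∀ s : ℂ, 1/2 ≤ s.re → DifferentiableAt ℂ K s)
    (hKs : ∀ s : ℂ, 1/2 ≤ s.re → DifferentiableAt ℂ Ks s) {M : ℝ}
    (bK : ∀ s : ℂ, 1/2 ≤ s.re → ‖K s‖ ≤ M) (bKs : ∀ s : ℂ, 1/2 ≤ s.re → ‖Ks s‖ ≤ M)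
    (pos : ∀ t : ℝ, 0 < (K (sl t)).re) (eqn : ∀ t : ℝ, ‖Ks (sl t)‖ ≤ ‖K (sl t)‖)
    {p : ℂ} (hp : 1/2 < p.re) (hzp : Ks p = -K p) {s : ℂ} (hs : 1/2 < s.re) : Ks s = -K s := by
  -- real part nonnegative
  have M0 : 0 ≤ M := (norm_nonneg _).trans (bK p hp.le)
  have dE : ∀ s : ℂ, 1/2 ≤ s.re → DifferentiableAt ℂ (fun s => exp (-K s)) s :=
    fun s hs => (hK s hs).neg.cexp
  have nE : ∀ s : ℂ, 1/2 ≤ s.re → ‖exp (-K s)‖ ≤ 1 := by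
    intro s hs
    refine PLw (f := fun s => exp (-K s)) (M := Real.exp M) (C := 1) dE ?_ ?_ hs
    · intro s hs
      rw [norm_exp]
      apply Real.exp_le_exp.2
      have h1 := abs_re_le_norm (K s)
      have h2 := neg_abs_le (K s).re
      have h3 := bK s hs
      simp only [neg_re]; linarith
    · intro t
      rw [norm_exp]
      apply Real.exp_le_one_iff.2
      have := pos t
      simp only [neg_re]; linarith
  have re0 : ∀ s : ℂ, 1/2 ≤ s.re → 0 ≤ (K s).re := by
    intro s hs
    have := nE s hs
    rw [norm_exp, Real.exp_le_one_iff] at this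
    simp only [neg_re] at this; linarith
  set U : Set ℂ := {z : ℂ | 1/2 < z.re} with hU
  have Uo : IsOpen U := isOpen_lt continuous_const continuous_re
  have Uc : IsPreconnected U := (convex_halfSpace_re_gt (1/2)).isPreconnected
  have Ucl : closure U = {z : ℂ | 1/2 ≤ z.re} := by
    have := closure_preimage_re (Set.Ioi (1/2:ℝ))
    rw [closure_Ioi] at this
    exact this
  have dcl : ∀ {f : ℂ → ℂ}, (∀ s : ℂ, 1/2 ≤ s.re → DifferentiableAt ℂ f s) → DiffContOnCl ℂ f U := by
    intro f hf
    refine DifferentiableOn.diffContOnCl fun w hw => ?_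
    rw [Ucl] at hw
    exact (hf w hw).differentiableWithinAt
  have ne : ∀ s : ℂ, 1/2 ≤ s.re → K s ≠ 0 := by
    intro q hq h0
    rcases hq.lt_or_eq with hq | hq
    · have hm : IsMaxOn (norm ∘ fun s => exp (-K s)) U q := by
        intro z hz
        have := nE z (le_of_lt hz)
        simp only [Set.mem_ofPred_eq, Function.comp, h0, neg_zero, exp_zero, norm_one]
        exact this
      have hc := Complex.eqOn_closure_of_isPreconnected_of_isMaxOn_norm Uc Uo (dcl dE) hq hm
      have h1 := hc (show sl 0 ∈ closure U by rw [Ucl]; simp [sl])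
      simp only [Function.const, h0, neg_zero, exp_zero] at h1
      have h2 := congrArg norm h1
      rw [norm_exp, norm_one, Real.exp_eq_one_iff] at h2
      have := pos 0
      simp only [neg_re] at h2; linarith
    · have e : q = sl q.im := by apply Complex.ext <;> simp [sl]; linarith
      have := pos q.im
      rw [← e, h0] at this; simp at this
  -- the quotient bound
  have le1 : ∀ s : ℂ, 1/2 ≤ s.re → ‖Ks s‖ ≤ ‖K s‖ := by
    intro s hs
    have he : ∀ η : ℝ, 0 < η → ‖Ks s‖ ≤ ‖K s‖ + η := by
      intro η hη
      have lb : ∀ z : ℂ, 1/2 ≤ z.re → η ≤ ‖K z + η‖ := by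
        intro z hz
        have h1 := re_le_norm (K z + η)
        have h2 := re0 z hz
        simp only [add_re, ofReal_re] at h1; linarith
      have nz : ∀ z : ℂ, 1/2 ≤ z.re → K z + η ≠ 0 := fun z hz =>
        norm_pos_iff.1 (lt_of_lt_of_le hη (lb z hz))
      have := PLw (f := fun s => Ks s / (K s + η)) (M := M / η) (C := 1)
        (fun z hz => (hKs z hz).div ((hK z hz).add_const _) (nz z hz)) ?_ ?_ hs
      · rw [norm_div, div_le_one (norm_pos_iff.2 (nz s hs))] at this
        refine this.trans ((norm_add_le _ _).trans ?_)
        rw [norm_real, Real.norm_of_nonneg hη.le]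
      · intro z hz
        rw [norm_div]
        exact div_le_div₀ M0 (bKs z hz) hη (lb z hz)
      · intro t
        have hz : 1/2 ≤ (sl t).re := by simp [sl]
        rw [norm_div, div_le_one (norm_pos_iff.2 (nz _ hz))]
        refine (eqn t).trans ?_
        refine le_of_sq_le_sq ?_ (norm_nonneg _)
        rw [← normSq_eq_norm_sq, ← normSq_eq_norm_sq, normSq_apply, normSq_apply]
        simp only [add_re, ofReal_re, add_im, ofReal_im, add_zero]
        nlinarith [mul_pos (pos t) hη]
    exact le_of_forall_pos_le_add he
  have hm : IsMaxOn (norm ∘ fun s => Ks s / K s) U p := by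
    intro z hz
    have h0 := ne p hp.le
    have hz' : 1/2 ≤ z.re := le_of_lt hz
    have : Ks p / K p = -1 := by rw [hzp, neg_div, div_self h0]
    simp only [Set.mem_ofPred_eq, Function.comp, this, norm_neg, norm_one]
    rw [norm_div]
    exact div_le_one_of_le₀ (le1 z hz') (norm_nonneg _)
  have hc := Complex.eqOn_closure_of_isPreconnected_of_isMaxOn_norm Uc Uo
    (dcl fun z hz => (hKs z hz).div (hK z hz) (ne z hz)) hp hm
  have h1 := hc (show s ∈ closure U by rw [Ucl]; exact hs.le)
  simp only [Function.const, Pi.div_apply] at h1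
  rw [hzp, neg_div, div_self (ne p hp.le), div_eq_iff (ne s hs.le)] at h1
  rw [h1]; ring

end G2RH


namespace G2RH
open Complex Filter Topology Bornology

noncomputable def Rd (g : ℂ → ℂ) : ℂ → ℂ := dslope (dslope g 1) 2
noncomputable def wf (s : ℂ) : ℂ := (s+7) / (s * m3 s * (s+3/2))

lemma dsl_diff {g : ℂ → ℂ} (hg : ∀ s : ℂ, 1/2 ≤ s.re → DifferentiableAt ℂ g s) {c : ℂ}
    (hc : 1/2 < c.re) {s : ℂ} (hs : 1/2 ≤ s.re) : DifferentiableAt ℂ (dslope g c) s := by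
  by_cases h : s = c
  · subst h
    have Uo : IsOpen {z : ℂ | 1/2 < z.re} := isOpen_lt continuous_const continuous_re
    have hn : {z : ℂ | 1/2 < z.re} ∈ 𝓝 s := Uo.mem_nhds hc
    refine ((Complex.differentiableOn_dslope hn).2 fun z hz => ?_).differentiableAt hn
    exact (hg z (le_of_lt hz)).differentiableWithinAt
  · exact (differentiableAt_dslope_of_ne h).2 (hg s hs)

lemma Rd_diff {g : ℂ → ℂ} (hg : ∀ s : ℂ, 1/2 ≤ s.re → DifferentiableAt ℂ g s)
    {s : ℂ} (hs : 1/2 ≤ s.re) : DifferentiableAt ℂ (Rd g) s := by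
  refine dsl_diff (fun z hz => dsl_diff hg ?_ hz) ?_ hs <;> norm_num

lemma Rd_eq {g : ℂ → ℂ} (g1 : g 1 = 0) (g2 : g 2 = 0) {s : ℂ} (h1 : s - 1 ≠ 0) (h2 : s - 2 ≠ 0) :
    Rd g s = g s / ((s-1)*(s-2)) := by
  unfold Rd
  rw [dslope_of_ne _ (sub_ne_zero.1 h2), slope_def_field, dslope_of_ne _ (sub_ne_zero.1 h1), slope_def_field,
    dslope_of_ne _ (by norm_num : (2:ℂ) ≠ 1), slope_def_field, g1, g2]
  field_simp
  ring

lemma dl_mem : 0 < dl ∧ dl < 1/30 := by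
  unfold dl
  have := Real.pi_gt_three
  have := Real.pi_lt_d2
  norm_num at this
  constructor <;> linarith

lemma m3_lb {s : ℂ} (hs : 1/2 ≤ s.re) : 2*dl*‖s‖ ≤ ‖m3 s‖ := by
  have d := dl_mem.1
  refine le_of_sq_le_sq ?_ (norm_nonneg _)
  rw [mul_pow, ← normSq_eq_norm_sq, ← normSq_eq_norm_sq, normSq_apply, normSq_apply]
  simp [m3]
  nlinarith [mul_nonneg d.le (show 0 ≤ s.re by linarith)]

lemma s32_lb {s : ℂ} (hs : 1/2 ≤ s.re) : ‖s‖ ≤ ‖s + 3/2‖ := by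
  refine le_of_sq_le_sq ?_ (norm_nonneg _)
  rw [← normSq_eq_norm_sq, ← normSq_eq_norm_sq, normSq_apply, normSq_apply]
  have h1 : (s + 3/2).re = s.re + 3/2 := by simp
  have h2 : (s + 3/2).im = s.im := by simp
  rw [h1, h2]
  nlinarith

lemma sne {s : ℂ} (hs : 1/2 ≤ s.re) : s ≠ 0 := by
  rintro rfl; norm_num at hs

lemma wden {s : ℂ} (hs : 1/2 ≤ s.re) : s * m3 s * (s+3/2) ≠ 0 := by
  refine mul_ne_zero (mul_ne_zero (sne hs) (m3_ne hs)) ?_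
  intro h
  have := s32_lb hs
  rw [h, norm_zero] at this
  exact sne hs (norm_le_zero_iff.1 this)

lemma wf_diff {s : ℂ} (hs : 1/2 ≤ s.re) : DifferentiableAt ℂ wf s := by
  unfold wf
  refine DifferentiableAt.div (by fun_prop) ?_ (wden hs)
  unfold m3; fun_prop

lemma Rw_bdd {g : ℂ → ℂ} (hg : ∀ s : ℂ, 1/2 ≤ s.re → DifferentiableAt ℂ g s) (g1 : g 1 = 0) (g2 : g 2 = 0)
    {C : ℝ} (hC : 0 ≤ C) (hb : ∀ s : ℂ, 1/2 ≤ s.re → 6 ≤ ‖s‖ → ‖g s‖ ≤ C * ‖s‖^4) :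
    ∃ M, ∀ s : ℂ, 1/2 ≤ s.re → ‖Rd g s * wf s‖ ≤ M := by
  have hcl : IsClosed {z : ℂ | 1/2 ≤ z.re} := isClosed_le continuous_const continuous_re
  have hcp : IsCompact (Metric.closedBall (0:ℂ) 6 ∩ {z : ℂ | 1/2 ≤ z.re}) :=
    (isCompact_closedBall 0 6).inter_right hcl
  have hco : ContinuousOn (fun s => Rd g s * wf s) (Metric.closedBall (0:ℂ) 6 ∩ {z : ℂ | 1/2 ≤ z.re}) :=
    fun z hz => (((Rd_diff hg hz.2).mul (wf_diff hz.2)).continuousAt).continuousWithinAt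
  obtain ⟨M, hM⟩ := hcp.exists_bound_of_continuousOn hco
  have d := dl_mem.1
  refine ⟨max M (6*C/dl), fun s hs => ?_⟩
  rcases le_total ‖s‖ 6 with h | h
  · exact (hM s ⟨by simpa using h, hs⟩).trans (le_max_left _ _)
  · refine le_trans ?_ (le_max_right _ _)
    have n1 : ‖s‖/2 ≤ ‖s - 1‖ := by
      have := norm_sub_norm_le s 1
      rw [norm_one] at this; linarith
    have n2 : ‖s‖/2 ≤ ‖s - 2‖ := by
      have := norm_sub_norm_le s 2
      rw [show ‖(2:ℂ)‖ = 2 by simp] at this; linarith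
    have n7 : ‖s + 7‖ ≤ 3 * ‖s‖ := by
      have := norm_add_le s 7
      rw [show ‖(7:ℂ)‖ = 7 by simp] at this; linarith
    have p1 : s - 1 ≠ 0 := norm_pos_iff.1 (by linarith)
    have p2 : s - 2 ≠ 0 := norm_pos_iff.1 (by linarith)
    rw [Rd_eq g1 g2 p1 p2, wf, norm_mul, norm_div, norm_div, norm_mul, norm_mul, norm_mul]
    have b1 : ‖g s‖ / (‖s - 1‖ * ‖s - 2‖) ≤ C * ‖s‖^4 / (‖s‖/2 * (‖s‖/2)) := by
      refine div_le_div₀ (by positivity) (hb s hs h) (by positivity) ?_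
      gcongr
    have b2 : ‖s + 7‖ / (‖s‖ * ‖m3 s‖ * ‖s + 3/2‖) ≤ 3 * ‖s‖ / (‖s‖ * (2*dl*‖s‖) * ‖s‖) := by
      have := m3_lb hs
      have := s32_lb hs
      refine div_le_div₀ (by positivity) n7 (by positivity) ?_
      gcongr
    refine (mul_le_mul b1 b2 (by positivity) (by positivity)).trans (le_of_eq ?_)
    have : ‖s‖ ≠ 0 := by linarith
    field_simp
    ring

lemma tb3 {N : ℝ} (hN : 1 ≤ N) {k a b c x y : ℂ} (hk : ‖k‖ ≤ 2) (ha : ‖a‖ ≤ 2*N) (hb : ‖b‖ ≤ 2*N)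
    (hc : ‖c‖ ≤ 2*N) (hx : ‖x‖ ≤ 1) (hy : ‖y‖ ≤ 1) : ‖k*a*b*c*x*y‖ ≤ 16*N^4 := by
  rw [norm_mul, norm_mul, norm_mul, norm_mul, norm_mul]
  calc ‖k‖*‖a‖*‖b‖*‖c‖*‖x‖*‖y‖ ≤ 2*(2*N)*(2*N)*(2*N)*1*1 := by gcongr
    _ = 16*N^3*1 := by ring
    _ ≤ 16*N^3*N := by gcongr
    _ = _ := by ring

lemma tb4 {N : ℝ} (hN : 1 ≤ N) {a b c d x y : ℂ} (ha : ‖a‖ ≤ 2*N) (hb : ‖b‖ ≤ 2*N)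
    (hc : ‖c‖ ≤ 2*N) (hd : ‖d‖ ≤ 2*N) (hx : ‖x‖ ≤ 1) (hy : ‖y‖ ≤ 1) : ‖a*b*c*d*x*y‖ ≤ 16*N^4 := by
  rw [norm_mul, norm_mul, norm_mul, norm_mul, norm_mul]
  calc ‖a‖*‖b‖*‖c‖*‖d‖*‖x‖*‖y‖ ≤ (2*N)*(2*N)*(2*N)*(2*N)*1*1 := by gcongr
    _ = _ := by ring

lemma five {a b c d e : ℂ} {B : ℝ} (ha : ‖a‖ ≤ B) (hb : ‖b‖ ≤ B) (hc : ‖c‖ ≤ B) (hd : ‖d‖ ≤ B)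
    (he : ‖e‖ ≤ B) : ‖a - b - c - d - e‖ ≤ 5*B := by
  have h1 := norm_sub_le (a-b-c-d) e
  have h2 := norm_sub_le (a-b-c) d
  have h3 := norm_sub_le (a-b) c
  have h4 := norm_sub_le a b
  linarith

noncomputable def qf (s : ℂ) : ℂ := Y s / (X (2*s) * X (s+2))
noncomputable def qs (s : ℂ) : ℂ := -Y (1-s) / (X (2*s) * X (s+2))

lemma X2_ne {s : ℂ} (hs : 1/2 ≤ s.re) : X (2*s) ≠ 0 := X_ne_zero (by simp; linarith)
lemma Xp_ne {s : ℂ} (hs : 1/2 ≤ s.re) : X (s+2) ≠ 0 := X_ne_zero (by simp; linarith)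

lemma qf_diff {s : ℂ} (hs : 1/2 ≤ s.re) : DifferentiableAt ℂ qf s := by
  unfold qf
  have hY := Y_diff
  have hX := X_diff
  refine DifferentiableAt.div (by fun_prop) (by fun_prop) (mul_ne_zero (X2_ne hs) (Xp_ne hs))
lemma qs_diff {s : ℂ} (hs : 1/2 ≤ s.re) : DifferentiableAt ℂ qs s := by
  unfold qs
  have hY := Y_diff
  have hX := X_diff
  refine DifferentiableAt.div (by fun_prop) (by fun_prop) (mul_ne_zero (X2_ne hs) (Xp_ne hs))

lemma qf1 : qf 1 = 0 := by rw [qf, Y1]; simp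
lemma qf2 : qf 2 = 0 := by rw [qf, Y2]; simp
lemma qs1 : qs 1 = 0 := by rw [qs, sub_self, Y0]; simp
lemma qs2 : qs 2 = 0 := by rw [qs, show (1:ℂ)-2 = -1 by norm_num, Ym1]; simp

lemma lin_bd {s : ℂ} (h : 6 ≤ ‖s‖) (c : ℂ) (hc : ‖c‖ ≤ 6) : ‖s + c‖ ≤ 2*‖s‖ :=
  (norm_add_le _ _).trans (by linarith)
lemma lin_bd' {s : ℂ} (h : 6 ≤ ‖s‖) (c : ℂ) (hc : ‖c‖ ≤ 6) : ‖s - c‖ ≤ 2*‖s‖ :=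
  (norm_sub_le _ _).trans (by linarith)

lemma m3_ub {s z : ℂ} (h : 6 ≤ ‖s‖) (hz : ‖z‖ ≤ 2*‖s‖) : ‖m3 z‖ ≤ 2*‖s‖ := by
  obtain ⟨d, d'⟩ := dl_mem
  unfold m3
  refine (norm_add_le _ _).trans ?_
  rw [norm_mul, norm_mul, norm_real, Real.norm_of_nonneg d.le]
  rw [show ‖(2:ℂ)‖ = 2 by simp, show ‖(3:ℂ)‖ = 3 by simp]
  nlinarith [mul_le_mul_of_nonneg_left hz d.le]

lemma kbd (x : ℝ) (h0 : 0 < x) (h1 : x < 1) :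
    ‖2*(1-(x:ℂ))‖ ≤ 2 ∧ ‖2*(x:ℂ)‖ ≤ 2 ∧ ‖1-(x:ℂ)‖ ≤ 2 ∧ ‖(x:ℂ)‖ ≤ 2 := by
  have e : ‖1-(x:ℂ)‖ = 1 - x := by
    rw [show 1-(x:ℂ) = ((1-x:ℝ):ℂ) by push_cast; rfl, norm_real, Real.norm_of_nonneg (by linarith)]
  have e2 : ‖(x:ℂ)‖ = x := by rw [norm_real, Real.norm_of_nonneg h0.le]
  have e3 : ‖(2:ℂ)‖ = 2 := by simp
  rw [norm_mul, norm_mul, e, e2, e3]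
  refine ⟨?_, ?_, ?_, ?_⟩ <;> linarith

lemma qf_bd (s : ℂ) (hs : 1/2 ≤ s.re) (h : 6 ≤ ‖s‖) : ‖qf s‖ ≤ 80*‖s‖^4 := by
  have e : qf s = (s-1)*(s-1)*(s-2)*m3 s*1*1 - (2*(1-c2))*(s-1)*(s-2)*(s-3)*(X (s+1)/X (s+2))*1
      - (2*c2)*s*(s+1)*(s+2)*(X (2*s-1)/X (2*s))*(X (s-1)/X (s+2))
      - (1-c3)*(s-3)*(s+2)*(s-2)*(X s/X (s+2))*1
      - c3*(s-3)*(s+2)*(s+1)*(X s/X (s+2))*(X (2*s-1)/X (2*s)) := by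
    have h1 := X2_ne hs
    have h2 := Xp_ne hs
    unfold qf Y
    generalize X (2*s) = a at *
    generalize X (s+2) = b at *
    field_simp
    try ring
  have hN : 1 ≤ ‖s‖ := by linarith
  have l0 : ‖s‖ ≤ 2*‖s‖ := by linarith
  have l1 := lin_bd h 1 (by simp)
  have l2 := lin_bd h 2 (by norm_num)
  have k1 := lin_bd' h 1 (by simp)
  have k2 := lin_bd' h 2 (by norm_num)
  have k3 := lin_bd' h 3 (by norm_num)
  have m := m3_ub h l0
  have o : ‖(1:ℂ)‖ ≤ 1 := by simp
  obtain ⟨x1, x2, -, -⟩ := kbd c2 c2_mem'.1 c2_mem'.2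
  obtain ⟨-, -, x3, x4⟩ := kbd c3 c3_mem'.1 c3_mem'.2
  have g1 := G1_le (s := s) (by linarith)
  have g2 := G2_le (s := s) (by linarith)
  have g3 := G3_le (s := s) hs
  have u := U_le (s := s) hs
  rw [e]
  refine (five (tb4 hN k1 k1 k2 m o o) (tb3 hN x1 k1 k2 k3 g1 o) (tb3 hN x2 l0 l1 l2 u g3)
    (tb3 hN x3 k3 l2 k2 g2 o) (tb3 hN x4 k3 l2 l1 g2 u)).trans (le_of_eq ?_)
  ring

lemma qs_bd (s : ℂ) (hs : 1/2 ≤ s.re) (h : 6 ≤ ‖s‖) : ‖qs s‖ ≤ 80*‖s‖^4 := by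
  have e : qs s = s*s*(s+1)*m3 (1-s)*(X (2*s-1)/X (2*s))*(X (s-2)/X (s+2))
      - (2*(1-c2))*s*(s+1)*(s+2)*(X (s-1)/X (s+2))*(X (2*s-1)/X (2*s))
      - (2*c2)*(s-1)*(s-2)*(s-3)*(X (s+1)/X (s+2))*1
      - (1-c3)*(s+2)*(s-3)*(s+1)*(X s/X (s+2))*(X (2*s-1)/X (2*s))
      - c3*(s+2)*(s-3)*(s-2)*(X s/X (s+2))*1 := by
    have h1 := X2_ne hs
    have h2 := Xp_ne hs
    unfold qs
    rw [Y_one_sub]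
    generalize X (2*s) = a at *
    generalize X (s+2) = b at *
    field_simp
    ring
  have hN : 1 ≤ ‖s‖ := by linarith
  have l0 : ‖s‖ ≤ 2*‖s‖ := by linarith
  have l1 := lin_bd h 1 (by simp)
  have l2 := lin_bd h 2 (by norm_num)
  have k1 := lin_bd' h 1 (by simp)
  have k2 := lin_bd' h 2 (by norm_num)
  have k3 := lin_bd' h 3 (by norm_num)
  have m := m3_ub (z := 1-s) h (by rw [norm_sub_rev]; exact k1)
  have o : ‖(1:ℂ)‖ ≤ 1 := by simp
  obtain ⟨x1, x2, -, -⟩ := kbd c2 c2_mem'.1 c2_mem'.2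
  obtain ⟨-, -, x3, x4⟩ := kbd c3 c3_mem'.1 c3_mem'.2
  have g1 := G1_le (s := s) (by linarith)
  have g2 := G2_le (s := s) (by linarith)
  have g3 := G3_le (s := s) hs
  have g4 := G4_le (s := s) hs
  have u := U_le (s := s) hs
  rw [e]
  refine (five (tb4 hN l0 l0 l1 m u g4) (tb3 hN x1 l0 l1 l2 g3 u) (tb3 hN x2 k1 k2 k3 g1 o)
    (tb3 hN x3 l2 k3 l1 g2 u) (tb3 hN x4 l2 k3 k2 g2 o)).trans (le_of_eq ?_)
  ring

end G2RH


namespace G2RH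
open Complex

lemma kf_eq (t : ℝ) : Rd qf (sl t) = kf (sl t) := by
  have h1 := X2_ne (s := sl t) (by simp [sl])
  have h2 := Xp_ne (s := sl t) (by simp [sl])
  have h3 := sl1 t
  have h4 := sl2 t
  rw [Rd_eq qf1 qf2 h3 h4, qf, Y, kf]
  generalize X (2*sl t) = a at *
  generalize X (sl t+2) = b at *
  field_simp
  ring

lemma K_pos (t : ℝ) : 0 < (Rd qf (sl t) * wf (sl t)).re := by
  have hP := P4' t
  have hw := wden (s := sl t) (by simp [sl])
  rw [kf_eq]
  have e : kf (sl t) * wf (sl t) = (kf (sl t) * E0 (sl t)) *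
      (((normSq (sl t * m3 (sl t) * (sl t+3/2)))⁻¹ : ℝ) : ℂ) := by
    unfold wf E0
    rw [div_eq_mul_inv, Complex.inv_def]
    push_cast; ring
  rw [e, re_mul_ofReal]
  exact mul_pos hP (inv_pos.2 (normSq_pos.2 hw))

lemma K_line (t : ℝ) : ‖Rd qs (sl t) * wf (sl t)‖ ≤ ‖Rd qf (sl t) * wf (sl t)‖ := by
  rw [norm_mul, norm_mul, Rd_eq qf1 qf2 (sl1 t) (sl2 t), Rd_eq qs1 qs2 (sl1 t) (sl2 t)]
  rw [norm_div, norm_div, qf, qs, norm_div, norm_div, norm_neg, Y_line]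

lemma no_zero {p : ℂ} (hp : 1/2 < p.re) (h1 : p - 1 ≠ 0) (h2 : p - 2 ≠ 0) : Y p ≠ Y (1-p) := by
  intro h
  obtain ⟨M1, b1⟩ := Rw_bdd (fun s hs => qf_diff hs) qf1 qf2 (by norm_num) qf_bd
  obtain ⟨M2, b2⟩ := Rw_bdd (fun s hs => qs_diff hs) qs1 qs2 (by norm_num) qs_bd
  have key := abs_max (K := fun s => Rd qf s * wf s) (Ks := fun s => Rd qs s * wf s) (M := max M1 M2)
    (fun s hs => (Rd_diff (fun s hs => qf_diff hs) hs).mul (wf_diff hs))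
    (fun s hs => (Rd_diff (fun s hs => qs_diff hs) hs).mul (wf_diff hs))
    (fun s hs => (b1 s hs).trans (le_max_left _ _)) (fun s hs => (b2 s hs).trans (le_max_right _ _))
    K_pos K_line hp
    (by
      rw [Rd_eq qf1 qf2 h1 h2, Rd_eq qs1 qs2 h1 h2, qf, qs, h]
      ring)
    (s := 3) (by norm_num)
  have h31 : (3:ℂ) - 1 ≠ 0 := by norm_num
  have h32 : (3:ℂ) - 2 ≠ 0 := by norm_num
  have hr : 1/2 ≤ (3:ℂ).re := by norm_num
  have w0 : wf 3 ≠ 0 := div_ne_zero (by norm_num) (wden hr)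
  rw [Rd_eq qf1 qf2 h31 h32, Rd_eq qs1 qs2 h31 h32, qf, qs] at key
  have x1 := X2_ne hr
  have x2 := Xp_ne hr
  rw [← neg_mul] at key
  have k2 := mul_right_cancel₀ w0 key
  rw [← neg_div, div_left_inj' (mul_ne_zero h31 h32), ← neg_div, div_left_inj' (mul_ne_zero x1 x2), neg_inj,
    show (1:ℂ)-3 = -2 by norm_num] at k2
  exact Y3 k2.symm

end G2RH

theorem xiG2Pshort_riemann_hypothesis (s : ℂ) (hs : s ∉ S2) (hzero : xiG2Pshort s = 0) :
    s.re = 1 / 2 := by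
  have hZ := G2RH.Z_rel hs
  rw [hzero, zero_mul] at hZ
  have hY : G2RH.Y s = G2RH.Y (1-s) := (sub_eq_zero.1 hZ.symm)
  simp only [S2, Set.mem_insert_iff, Set.mem_singleton_iff, not_or] at hs
  obtain ⟨a1, a2, a3, a4, a5, a6, a7⟩ := hs
  rcases lt_trichotomy s.re (1/2) with h | h | h
  · exfalso
    refine G2RH.no_zero (p := 1-s) (by simp; linarith) (fun h => a3 (by linear_combination -h))
      (fun h => a2 (by linear_combination -h)) ?_
    rw [show 1-(1-s) = s by ring]; exact hY.symm
  · exact h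
  · exact absurd hY (G2RH.no_zero h (sub_ne_zero.2 a5) (sub_ne_zero.2 a6))
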